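/- Let ρ > 2, ℓ ∈ {1,…,n}, a > 0, and define the doubly truncated Riesz transforms R^ε_{ℓ,a}(f)(x) = ∫_{ε<|x-y|<a} (x_ℓ - y_ℓ)/|x-y|^{n+1} f(y) dy. Then for every f ∈ BMO(ℝⁿ), the variation V_ρ(R^ε_{ℓ,a})(f) belongs to BMO(ℝⁿ) and ‖V_ρ(R^ε_{ℓ,a})(f)‖_{BMO(ℝⁿ)} ≤ C ‖f‖_{BMO(ℝⁿ)}, with C independent of f and of a. -/

import Mathlib

open MeasureTheory Filter Set
open scoped ENNReal

noncomputable section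

/-- A strictly decreasing sequence of positive reals converging to zero. -/
def NullSeq (t : ℕ → ℝ) : Prop :=
  StrictAnti t ∧ (∀ j, 0 < t j) ∧ Tendsto t atTop (nhds 0)

/-- The `ρ`-variation seminorm `‖F‖_{E_ρ}`: the supremum, over all strictly decreasing
null sequences `{t_j}`, of `(∑_j |F(t_j) - F(t_{j+1})|^ρ)^{1/ρ}` (valued in `ℝ≥0∞`). -/
def eVar (ρ : ℝ) (F : ℝ → ℝ) : ℝ≥0∞ :=
  ⨆ t : {t : ℕ → ℝ // NullSeq t},
    (∑' j : ℕ, ENNReal.ofReal (|F (t.1 j) - F (t.1 (j + 1))| ^ ρ)) ^ (1 / ρ)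

/-- The average of `f` over a set `s` (with respect to Lebesgue measure). -/
def avgOn {n : ℕ} (f : EuclideanSpace ℝ (Fin n) → ℝ) (s : Set (EuclideanSpace ℝ (Fin n))) : ℝ :=
  ((volume s).toReal)⁻¹ * ∫ y in s, f y

/-- `f` has BMO norm at most `M`: the mean oscillation of `f` over every ball is `≤ M`. -/
def IsBMOWith {n : ℕ} (f : EuclideanSpace ℝ (Fin n) → ℝ) (M : ℝ) : Prop :=
  ∀ (x₀ : EuclideanSpace ℝ (Fin n)) (r : ℝ), 0 < r →
    ((volume (Metric.ball x₀ r)).toReal)⁻¹ *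
      ∫ y in Metric.ball x₀ r, |f y - avgOn f (Metric.ball x₀ r)| ≤ M

/-- The doubly truncated Riesz transform in direction `ℓ`:
`R^ε_{ℓ,a}(f)(x) = ∫_{ε<|x-y|<a} (x_ℓ - y_ℓ)/|x-y|^{n+1} f(y) dy`. -/
def truncRiesz (n : ℕ) (ℓ : Fin n) (a ε : ℝ) (f : EuclideanSpace ℝ (Fin n) → ℝ)
    (x : EuclideanSpace ℝ (Fin n)) : ℝ :=
  ∫ y in {y : EuclideanSpace ℝ (Fin n) | ε < ‖x - y‖ ∧ ‖x - y‖ < a},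
    (x ℓ - y ℓ) / ‖x - y‖ ^ (n + 1) * f y

/-! ### Part A: `p`-variation over monotone sequences -/

/-- the `p`-variation over finite monotone sequences in `s` -/
def pv {ι : Type*} [Preorder ι] (p : ℝ) (F : ι → ℝ) (s : Set ι) : ℝ≥0∞ :=
  ⨆ q : ℕ × {u : ℕ → ι // Monotone u ∧ ∀ i, u i ∈ s},
    (∑ i ∈ Finset.range q.1, ‖F (q.2.1 (i + 1)) - F (q.2.1 i)‖ₑ ^ p) ^ (1 / p)

section
variable {ι : Type*} [Preorder ι]

theorem le_pv (p : ℝ) (F : ι → ℝ) {s : Set ι} (N : ℕ) {u : ℕ → ι} (hu : Monotone u)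
    (hs : ∀ i, u i ∈ s) :
    (∑ i ∈ Finset.range N, ‖F (u (i + 1)) - F (u i)‖ₑ ^ p) ^ (1 / p) ≤ pv p F s :=
  le_iSup (fun q : ℕ × {u : ℕ → ι // Monotone u ∧ ∀ i, u i ∈ s} =>
    (∑ i ∈ Finset.range q.1, ‖F (q.2.1 (i + 1)) - F (q.2.1 i)‖ₑ ^ p) ^ (1 / p)) (N, ⟨u, hu, hs⟩)

theorem pv_le {p : ℝ} {F : ι → ℝ} {s : Set ι} {b : ℝ≥0∞}
    (h : ∀ (N : ℕ) (u : ℕ → ι), Monotone u → (∀ i, u i ∈ s) →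
      (∑ i ∈ Finset.range N, ‖F (u (i + 1)) - F (u i)‖ₑ ^ p) ^ (1 / p) ≤ b) : pv p F s ≤ b :=
  iSup_le fun q => h q.1 q.2.1 q.2.2.1 q.2.2.2

theorem pv_le' {p : ℝ} (hp : 0 < p) {F : ι → ℝ} {s : Set ι} {b : ℝ≥0∞}
    (h : ∀ (N : ℕ) (u : ℕ → ι), Monotone u → (∀ i, u i ∈ s) →
      (∑ i ∈ Finset.range N, ‖F (u (i + 1)) - F (u i)‖ₑ ^ p) ≤ b ^ p) : pv p F s ≤ b := by
  refine pv_le fun N u hu hs => ?_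
  rw [one_div, ENNReal.rpow_inv_le_iff hp]
  exact h N u hu hs

theorem sum_le_pv {p : ℝ} (hp : 0 < p) (F : ι → ℝ) {s : Set ι} (N : ℕ) {u : ℕ → ι}
    (hu : Monotone u) (hs : ∀ i, u i ∈ s) :
    (∑ i ∈ Finset.range N, ‖F (u (i + 1)) - F (u i)‖ₑ ^ p) ≤ pv p F s ^ p := by
  rw [← ENNReal.rpow_inv_le_iff hp, ← one_div]
  exact le_pv p F N hu hs

theorem pv_congr {p : ℝ} {F G : ι → ℝ} {s : Set ι}
    (h : ∀ t ∈ s, ∀ t' ∈ s, t ≤ t' → F t' - F t = G t' - G t) : pv p F s = pv p G s := by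
  unfold pv
  congr 1
  ext q
  congr 1
  refine Finset.sum_congr rfl fun i _ => ?_
  rw [h _ (q.2.2.2 i) _ (q.2.2.2 (i+1)) (q.2.2.1 (Nat.le_succ i))]

theorem pv_mono_set {p : ℝ} {F : ι → ℝ} {s t : Set ι} (h : s ⊆ t) : pv p F s ≤ pv p F t :=
  pv_le fun N _ hu hs => le_pv p F N hu fun i => h (hs i)

theorem pv_add_le {p : ℝ} (hp : 1 ≤ p) (F G : ι → ℝ) (s : Set ι) :
    pv p (fun t => F t + G t) s ≤ pv p F s + pv p G s := by
  refine pv_le fun N u hu hs => ?_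
  refine le_trans ?_ (add_le_add (le_pv p F N hu hs) (le_pv p G N hu hs))
  refine le_trans ?_ (ENNReal.Lp_add_le _ _ _ hp)
  gcongr with i hi
  refine le_trans (le_of_eq ?_) (enorm_add_le _ _)
  congr 1; ring

theorem pv_neg (p : ℝ) (F : ι → ℝ) (s : Set ι) : pv p (fun t => - F t) s = pv p F s := by
  unfold pv
  congr 1
  ext q
  congr 1
  refine Finset.sum_congr rfl fun i _ => ?_
  rw [← enorm_neg]
  congr 2; ring

theorem pv_sub_le {p : ℝ} (hp : 1 ≤ p) (F G : ι → ℝ) (s : Set ι) :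
    pv p (fun t => F t - G t) s ≤ pv p F s + pv p G s := by
  have := pv_add_le hp F (fun t => - G t) s
  rw [pv_neg] at this
  simpa [sub_eq_add_neg] using this

theorem pv_sum_le {p : ℝ} (hp : 1 ≤ p) {κ : Type*} (J : Finset κ) (F : κ → ι → ℝ) (s : Set ι) :
    pv p (fun t => ∑ j ∈ J, F j t) s ≤ ∑ j ∈ J, pv p (F j) s := by
  classical
  induction J using Finset.induction_on with
  | empty =>
    refine pv_le' (by linarith) fun N u hu hs => ?_
    simp [ENNReal.zero_rpow_of_pos (by linarith : 0 < p)]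
  | insert a J ha ih =>
    simp only [Finset.sum_insert ha]
    exact (pv_add_le hp _ _ _).trans (add_le_add le_rfl ih)

theorem enorm_sub_le_pv {p : ℝ} (hp : 0 < p) (F : ι → ℝ) {s : Set ι} {t t' : ι} (ht : t ∈ s)
    (ht' : t' ∈ s) (h : t ≤ t') : ‖F t' - F t‖ₑ ≤ pv p F s := by
  have := le_pv p F (s := s) 1 (u := fun i => if i = 0 then t else t')
    (by
      refine monotone_nat_of_le_succ fun i => ?_
      rcases Nat.eq_zero_or_pos i with rfl | hi
      · simpa using h
      · simp [hi.ne'])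
    (by intro i; split_ifs <;> assumption)
  simpa [← ENNReal.rpow_mul, hp.ne'] using this

theorem pv_comp_le {κ : Type*} [Preorder κ] (p : ℝ) (F : ι → ℝ) (c : κ → ι) {s : Set κ}
    {t : Set ι} (hc : MonotoneOn c s) (hm : MapsTo c s t) :
    pv p (fun x => F (c x)) s ≤ pv p F t :=
  pv_le fun N u hu hs => le_pv p F N (u := fun i => c (u i))
    (fun i j hij => hc (hs i) (hs j) (hu hij)) fun i => hm (hs i)

theorem sum_rpow_le_rpow {κ : Type*} (S : Finset κ) (a : κ → ℝ≥0∞) {p q : ℝ} (hp : 0 < p)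
    (hpq : p ≤ q) : (∑ i ∈ S, a i ^ q) ^ (1 / q) ≤ (∑ i ∈ S, a i ^ p) ^ (1 / p) := by
  set A := (∑ i ∈ S, a i ^ p) ^ (1 / p) with hA
  have hq : 0 < q := by linarith
  have hle : ∀ i ∈ S, a i ≤ A := fun i hi => by
    rw [hA, one_div, ENNReal.le_rpow_inv_iff hp]
    exact Finset.single_le_sum (f := fun i => a i ^ p) (fun _ _ => zero_le) hi
  have hAp : A ^ p = ∑ i ∈ S, a i ^ p := by
    rw [hA, ← ENNReal.rpow_mul]; simp [hp.ne']
  rw [one_div, ENNReal.rpow_inv_le_iff hq]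
  calc ∑ i ∈ S, a i ^ q = ∑ i ∈ S, a i ^ p * a i ^ (q - p) := by
        refine Finset.sum_congr rfl fun i _ => ?_
        rw [← ENNReal.rpow_add_of_nonneg _ _ hp.le (by linarith)]; congr 1; ring
    _ ≤ ∑ i ∈ S, a i ^ p * A ^ (q - p) := by
        refine Finset.sum_le_sum fun i hi => ?_
        gcongr
        exact hle i hi
    _ = A ^ q := by
        rw [← Finset.sum_mul, ← hAp, ← ENNReal.rpow_add_of_nonneg _ _ hp.le (by linarith)]
        congr 1; ring

theorem pv_anti_exp {p q : ℝ} (hp : 0 < p) (hpq : p ≤ q) (F : ι → ℝ) (s : Set ι) :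
    pv q F s ≤ pv p F s :=
  pv_le fun N _ hu hs => (sum_rpow_le_rpow _ _ hp hpq).trans (le_pv p F N hu hs)

end

/-- The cell lemma. -/
theorem pv_cells {ι κ : Type*} [LinearOrder ι] [LinearOrder κ] {p : ℝ} (hp : 0 < p) (F : ι → ℝ)
    (s : Set ι) (c : ι → κ) (hc : MonotoneOn c s) (b : κ → ℝ≥0∞)
    (h1 : ∀ m, pv p F {t ∈ s | c t = m} ≤ b m) (h2 : ∀ t ∈ s, ‖F t‖ₑ ≤ b (c t)) :
    pv p F s ^ p ≤ ENNReal.ofReal (1 + 2 * 2 ^ p) * ∑' m, b m ^ p := by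
  classical
  set Sb := ∑' m, b m ^ p with hSb
  have key : ∀ (N : ℕ) (u : ℕ → ι), Monotone u → (∀ i, u i ∈ s) →
      (∑ i ∈ Finset.range N, ‖F (u (i + 1)) - F (u i)‖ₑ ^ p) ≤
        ENNReal.ofReal (1 + 2 * 2 ^ p) * Sb := by
    intro N u hu hs
    have hcu : Monotone fun i => c (u i) := fun i j hij => hc (hs i) (hs j) (hu hij)
    rw [← Finset.sum_filter_add_sum_filter_not (Finset.range N) (fun i => c (u i) = c (u (i+1)))]
    -- same cell
    have hA : ∑ i ∈ Finset.range N with c (u i) = c (u (i+1)),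
        ‖F (u (i + 1)) - F (u i)‖ₑ ^ p ≤ Sb := by
      set S := {i ∈ Finset.range N | c (u i) = c (u (i+1))} with hS
      rw [← Finset.sum_fiberwise_of_maps_to (s := S) (t := S.image fun i => c (u i))
        (g := fun i => c (u i)) (fun i hi => Finset.mem_image_of_mem _ hi)]
      refine le_trans (Finset.sum_le_sum fun m hm => ?_) (ENNReal.sum_le_tsum _)
      set Sm := {i ∈ S | c (u i) = m} with hSm
      have hne : Sm.Nonempty := by
        obtain ⟨i, hi, rfl⟩ := Finset.mem_image.1 hm
        exact ⟨i, by simp [hSm, hi]⟩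
      set lo := Sm.min' hne with hlo
      set hi := Sm.max' hne + 1 with hhi
      have hlomem : lo ∈ Sm := Finset.min'_mem _ _
      have himem : Sm.max' hne ∈ Sm := Finset.max'_mem _ _
      have hlohi : lo ≤ hi := (Finset.min'_le _ _ himem).trans (Nat.le_succ _)
      have hclo : c (u lo) = m := (Finset.mem_filter.1 hlomem).2
      have hchi : c (u hi) = m := by
        have h1 := Finset.mem_filter.1 himem
        have h2 := (Finset.mem_filter.1 h1.1).2
        rw [hhi, ← h2, h1.2]
      have hle : ∀ i, lo ≤ max lo (min i hi) ∧ max lo (min i hi) ≤ hi := fun i =>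
        ⟨le_max_left _ _, max_le hlohi (min_le_right _ _)⟩
      have := sum_le_pv hp F (s := {t ∈ s | c t = m}) N (u := fun i => u (max lo (min i hi)))
        (fun i j hij => hu (max_le_max le_rfl (min_le_min hij le_rfl)))
        (fun i => ⟨hs _, le_antisymm
          ((hcu (hle i).2).trans hchi.le) (hclo.ge.trans (hcu (hle i).1))⟩)
      refine le_trans ?_ (this.trans (ENNReal.rpow_le_rpow (h1 m) hp.le))
      have hsub : Sm ⊆ Finset.range N := (Finset.filter_subset _ _).trans (Finset.filter_subset _ _)
      refine le_trans (le_of_eq ?_) (Finset.sum_le_sum_of_subset hsub)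
      refine Finset.sum_congr rfl fun i hiS => ?_
      have h3 : lo ≤ i := Finset.min'_le _ _ hiS
      have h4 : i < hi := Nat.lt_succ_of_le (Finset.le_max' _ _ hiS)
      rw [min_eq_left h4.le, max_eq_right h3, min_eq_left (Nat.succ_le_of_lt h4),
        max_eq_right (by omega)]
    have hinj : ∀ g : ℕ → ℕ, (∀ i j, c (u i) ≠ c (u (i+1)) → c (u j) ≠ c (u (j+1)) → i < j →
        c (u (g i)) < c (u (g j))) →
        ∑ i ∈ Finset.range N with ¬ c (u i) = c (u (i+1)), b (c (u (g i))) ^ p ≤ Sb := by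
      intro g hg
      rw [← Finset.sum_image (f := fun m => b m ^ p) (g := fun i => c (u (g i)))]
      · exact ENNReal.sum_le_tsum _
      · intro i hi j hj hij
        simp only [Finset.coe_filter, Finset.mem_range, mem_setOf_eq] at hi hj
        rcases lt_trichotomy i j with h | h | h
        · exact absurd hij (hg i j hi.2 hj.2 h).ne
        · exact h
        · exact absurd hij (hg j i hj.2 hi.2 h).ne'
    have hB1 := hinj (fun i => i) (by
      intro i j hi hj hij
      exact lt_of_lt_of_le (lt_of_le_of_ne (hcu (Nat.le_succ i)) hi) (hcu hij))
    have hB2 := hinj (fun i => i + 1) (by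
      intro i j hi hj hij
      exact lt_of_le_of_lt (hcu hij) (lt_of_le_of_ne (hcu (Nat.le_succ j)) hj))
    have hB : ∑ i ∈ Finset.range N with ¬ c (u i) = c (u (i+1)),
        ‖F (u (i + 1)) - F (u i)‖ₑ ^ p ≤ ENNReal.ofReal (2 * 2 ^ p) * Sb := by
      calc _ ≤ ∑ i ∈ Finset.range N with ¬ c (u i) = c (u (i+1)),
            2 ^ p * (b (c (u (i+1))) ^ p + b (c (u i)) ^ p) := by
            refine Finset.sum_le_sum fun i _ => ?_
            have h5 : ‖F (u (i + 1)) - F (u i)‖ₑ ≤ 2 * max (b (c (u (i+1)))) (b (c (u i))) := by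
              refine (enorm_sub_le).trans ?_
              rw [two_mul]
              exact add_le_add ((h2 _ (hs _)).trans (le_max_left _ _))
                ((h2 _ (hs _)).trans (le_max_right _ _))
            refine (ENNReal.rpow_le_rpow h5 hp.le).trans ?_
            rw [ENNReal.mul_rpow_of_nonneg _ _ hp.le]
            gcongr
            rcases max_choice (b (c (u (i+1)))) (b (c (u i))) with h | h <;> rw [h]
            · exact le_self_add
            · exact le_add_self
        _ ≤ _ := by
            rw [← Finset.mul_sum, Finset.sum_add_distrib]
            refine (mul_le_mul_right (add_le_add hB2 hB1) _).trans (le_of_eq ?_)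
            rw [ENNReal.ofReal_mul (by norm_num), ← ENNReal.ofReal_rpow_of_pos (by norm_num)]
            simp only [ENNReal.ofReal_ofNat]
            ring
    calc _ ≤ Sb + ENNReal.ofReal (2 * 2 ^ p) * Sb := add_le_add hA hB
      _ = _ := by
        rw [ENNReal.ofReal_add zero_le_one (by positivity), add_mul]; simp
  rw [← ENNReal.le_rpow_inv_iff hp]
  refine pv_le' hp fun N u hu hs => ?_
  rw [← ENNReal.rpow_mul, inv_mul_cancel₀ hp.ne', ENNReal.rpow_one]
  exact key N u hu hs

/-! ### Part D: abstract almost orthogonality -/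

/-- distance of natural numbers -/
def nd (i j : ℕ) : ℕ := (i - j) + (j - i)

theorem nd_comm (i j : ℕ) : nd i j = nd j i := by unfold nd; omega

theorem sum_pow_inj_le {μ : ℝ} (h0 : 0 ≤ μ) (h1 : μ < 1) (S : Finset ℕ) (g : ℕ → ℕ)
    (hg : Set.InjOn g S) : ∑ j ∈ S, μ ^ g j ≤ (1 - μ)⁻¹ := by
  classical
  rw [← Finset.sum_image (f := fun m => μ ^ m) hg, ← tsum_geometric_of_lt_one h0 h1]
  exact (summable_geometric_of_lt_one h0 h1).sum_le_tsum _ fun _ _ => by positivity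

theorem sum_pow_nd_le {μ : ℝ} (h0 : 0 ≤ μ) (h1 : μ < 1) (S : Finset ℕ) (i : ℕ) :
    ∑ j ∈ S, μ ^ nd i j ≤ 2 * (1 - μ)⁻¹ := by
  rw [← Finset.sum_filter_add_sum_filter_not S (fun j => j ≤ i), two_mul]
  refine add_le_add (sum_pow_inj_le h0 h1 _ _ ?_) (sum_pow_inj_le h0 h1 _ _ ?_)
  · intro a ha b hb hab
    simp only [Finset.coe_filter, Set.mem_ofPred_eq, nd] at ha hb hab
    omega
  · intro a ha b hb hab
    simp only [Finset.coe_filter, Set.mem_ofPred_eq, nd] at ha hb hab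
    omega

theorem schur_sum {μ : ℝ} (h0 : 0 < μ) (h1 : μ < 1) (I J : Finset ℕ) (a : ℕ → ℝ) :
    ∑ i ∈ I, (∑ j ∈ J, μ ^ nd i j * a j) ^ 2 ≤ (2 * (1 - μ)⁻¹) ^ 2 * ∑ j ∈ J, a j ^ 2 := by
  have hS : 0 < 2 * (1 - μ)⁻¹ := by
    have : 0 < 1 - μ := by linarith
    positivity
  have h2 : ∀ i, (∑ j ∈ J, μ ^ nd i j * a j) ^ 2 ≤
      (2 * (1 - μ)⁻¹) * ∑ j ∈ J, μ ^ nd i j * a j ^ 2 := by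
    intro i
    have := Finset.sum_mul_sq_le_sq_mul_sq J (fun j => Real.sqrt (μ ^ nd i j))
      (fun j => Real.sqrt (μ ^ nd i j) * a j)
    have e : ∀ j, Real.sqrt (μ ^ nd i j) ^ 2 = μ ^ nd i j := fun j => Real.sq_sqrt (by positivity)
    simp only [← mul_assoc, ← sq, mul_pow, e] at this
    refine this.trans ?_
    refine mul_le_mul_of_nonneg_right (sum_pow_nd_le h0.le h1 J i)
      (Finset.sum_nonneg fun j _ => by positivity)
  calc _ ≤ ∑ i ∈ I, (2 * (1 - μ)⁻¹) * ∑ j ∈ J, μ ^ nd i j * a j ^ 2 :=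
        Finset.sum_le_sum fun i _ => h2 i
    _ = (2 * (1 - μ)⁻¹) * ∑ j ∈ J, (∑ i ∈ I, μ ^ nd j i) * a j ^ 2 := by
        rw [← Finset.mul_sum, Finset.sum_comm]
        simp only [Finset.sum_mul, nd_comm]
    _ ≤ (2 * (1 - μ)⁻¹) * ∑ j ∈ J, (2 * (1 - μ)⁻¹) * a j ^ 2 := by
        refine mul_le_mul_of_nonneg_left (Finset.sum_le_sum fun j _ => ?_) hS.le
        exact mul_le_mul_of_nonneg_right (sum_pow_nd_le h0.le h1 I j) (sq_nonneg _)
    _ = _ := by rw [← Finset.mul_sum]; ring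

theorem schur_sum2 {μ B : ℝ} (h0 : 0 < μ) (h1 : μ < 1) (_hB : 0 ≤ B) (I J L : Finset ℕ)
    (a b : ℕ → ℝ) (hb0 : ∀ k ∈ L, 0 ≤ b k)
    (hb : ∀ k ∈ L, b k ≤ ∑ i ∈ I, ∑ j ∈ J, B * μ ^ nd k i * μ ^ nd i j * a j) :
    ∑ k ∈ L, b k ^ 2 ≤ B ^ 2 * (2 * (1 - μ)⁻¹) ^ 4 * ∑ j ∈ J, a j ^ 2 := by
  calc ∑ k ∈ L, b k ^ 2 ≤ ∑ k ∈ L, B ^ 2 * (∑ i ∈ I, μ ^ nd k i * ∑ j ∈ J, μ ^ nd i j * a j) ^ 2 := by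
        refine Finset.sum_le_sum fun k hk => ?_
        rw [← mul_pow]
        refine pow_le_pow_left₀ (hb0 k hk) ((hb k hk).trans (le_of_eq ?_)) 2
        simp only [Finset.mul_sum, mul_assoc]
    _ ≤ B ^ 2 * ((2 * (1 - μ)⁻¹) ^ 2 * ∑ i ∈ I, (∑ j ∈ J, μ ^ nd i j * a j) ^ 2) := by
        rw [← Finset.mul_sum]
        exact mul_le_mul_of_nonneg_left (schur_sum h0 h1 _ _ _) (by positivity)
    _ ≤ B ^ 2 * ((2 * (1 - μ)⁻¹) ^ 2 * ((2 * (1 - μ)⁻¹) ^ 2 * ∑ j ∈ J, a j ^ 2)) := by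
        gcongr
        exact schur_sum h0 h1 _ _ _
    _ = _ := by ring

section hilb
open scoped InnerProductSpace
variable {H : Type*} [NormedAddCommGroup H] [InnerProductSpace ℝ H]

/-- a decreasing chain of orthogonal projections from the identity to zero -/
structure ProjChain (P : ℕ → H →L[ℝ] H) (m : ℕ) : Prop where
  sa : ∀ j x y, ⟪P j x, y⟫_ℝ = ⟪x, P j y⟫_ℝ
  nest : ∀ j k x, j ≤ k → P j (P k x) = P k x
  nest' : ∀ j k x, j ≤ k → P k (P j x) = P k x
  zero : ∀ x, P 0 x = x
  top : ∀ x, P (m + 2) x = 0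

namespace ProjChain
variable {P : ℕ → H →L[ℝ] H} {m : ℕ}
theorem sum_delta (hP : ProjChain P m) (x : H) : ∑ j ∈ Finset.range (m + 2), (P j x - P (j + 1) x) = x := by
  rw [Finset.sum_range_sub' (fun j => P j x), hP.zero, hP.top, sub_zero]

theorem delta_inner (hP : ProjChain P m) (j : ℕ) (x : H) :
    ‖P j x - P (j + 1) x‖ ^ 2 = ⟪P j x - P (j+1) x, x⟫_ℝ := by
  rw [← real_inner_self_eq_norm_sq]
  simp only [inner_sub_left, inner_sub_right, hP.sa]
  simp only [hP.nest _ _ _ (le_refl j), hP.nest _ _ _ (Nat.le_succ j),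
    hP.nest _ _ _ (le_refl (j+1)), hP.nest' _ _ _ (Nat.le_succ j)]
  ring

theorem sum_delta_sq (hP : ProjChain P m) (x : H) :
    ∑ j ∈ Finset.range (m + 2), ‖P j x - P (j + 1) x‖ ^ 2 = ‖x‖ ^ 2 := by
  simp only [hP.delta_inner]
  rw [← sum_inner, hP.sum_delta, real_inner_self_eq_norm_sq]

theorem norm_le (hP : ProjChain P m) (j : ℕ) (x : H) : ‖P j x‖ ≤ ‖x‖ := by
  have h : ‖P j x‖ ^ 2 ≤ ‖P j x‖ * ‖x‖ := by
    rw [← real_inner_self_eq_norm_sq, hP.sa, hP.nest _ _ _ le_rfl, mul_comm]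
    exact real_inner_le_norm _ _
  nlinarith [norm_nonneg (P j x), norm_nonneg x]

theorem norm_sub_le (hP : ProjChain P m) (j : ℕ) (x : H) : ‖x - P j x‖ ≤ ‖x‖ := by
  have h : ‖x - P j x‖ ^ 2 ≤ ‖x‖ * ‖x - P j x‖ := by
    refine le_trans (le_of_eq ?_) (real_inner_le_norm _ _)
    rw [← real_inner_self_eq_norm_sq, inner_sub_left, hP.sa, map_sub, hP.nest _ _ _ le_rfl]
    simp
  nlinarith [norm_nonneg (x - P j x), norm_nonneg x]

/-- almost orthogonality -/
theorem main (hP : ProjChain P m) {T : ℕ → H →L[ℝ] H} {μ A : ℝ} (h0 : 0 < μ) (h1 : μ < 1) (hA : 0 ≤ A)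
    (anti : ∀ i x y, ⟪T i x, y⟫_ℝ = - ⟪x, T i y⟫_ℝ)
    (hf : ∀ i j x, i < m → j ≤ i + 1 → ‖T i (x - P j x)‖ ≤ A * (μ ^ 2) ^ (i + 1 - j) * ‖x‖)
    (hc : ∀ i j x, i < m → i + 1 ≤ j → ‖T i (P j x)‖ ≤ A * (μ ^ 2) ^ (j - (i + 1)) * ‖x‖)
    (x : H) :
    ‖∑ i ∈ Finset.range m, T i x‖ ^ 2 ≤ (A / μ ^ 2) ^ 2 * (2 * (1 - μ)⁻¹) ^ 4 * ‖x‖ ^ 2 ∧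
    ∑ k ∈ Finset.range (m + 1), ‖∑ i ∈ Finset.Ico k m, T i x -
      P (k + 1) (∑ i ∈ Finset.range m, T i x)‖ ^ 2 ≤
      (A / μ ^ 2) ^ 2 * (2 * (1 - μ)⁻¹) ^ 4 * ‖x‖ ^ 2 := by
  set a : ℕ → ℝ := fun j => ‖P j x - P (j + 1) x‖ with ha
  set B := A / μ ^ 2 with hB
  have hB0 : 0 ≤ B := by positivity
  have hAB : A ≤ B := by
    rw [hB, le_div_iff₀ (by positivity)]
    have : μ ^ 2 ≤ 1 := pow_le_one₀ h0.le h1.le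
    nlinarith
  have hABe : A = B * μ ^ 2 := by rw [hB]; field_simp
  -- pieces
  have hTD : ∀ i j y, i < m → ‖T i (P j y - P (j + 1) y)‖ ≤
      B * (μ ^ 2) ^ nd i j * ‖P j y - P (j + 1) y‖ := by
    intro i j y hi
    set w := P j y - P (j + 1) y with hw
    rcases le_or_gt j i with hji | hji
    · have e : w - P (j + 1) w = w := by
        rw [hw, map_sub, hP.nest' _ _ _ (Nat.le_succ j), hP.nest _ _ _ le_rfl]; simp
      have := hf i (j + 1) w hi (by omega)
      rw [e] at this
      refine this.trans ?_
      gcongr ?_ * ?_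
      have : i + 1 - (j + 1) = nd i j := by unfold nd; omega
      rw [this]
      gcongr
    · have e : P j w = w := by
        rw [hw, map_sub, hP.nest _ _ _ (Nat.le_succ j), hP.nest _ _ _ le_rfl]
      have := hc i j w hi (by omega)
      rw [e] at this
      refine this.trans (le_of_eq ?_)
      have : nd i j = (j - (i + 1)) + 1 := by unfold nd; omega
      rw [this, hABe, pow_succ]
      ring
  -- duality
  have dual : ∀ (Q : H → H) i (c : ℝ), 0 ≤ c → i < m → (∀ y z, ⟪Q y, z⟫_ℝ = ⟪y, Q z⟫_ℝ) →
      (∀ y, Q (Q y) = Q y) → (∀ y, ‖T i (Q y)‖ ≤ c * ‖Q y‖) → ∀ y, ‖Q (T i y)‖ ≤ c * ‖y‖ := by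
    intro Q i c hc0 hi hs hi2 hq y
    set w := Q (T i y) with hw
    have hQw : Q w = w := hi2 _
    have h3 : ‖w‖ ^ 2 ≤ c * ‖w‖ * ‖y‖ := by
      have : ‖w‖ ^ 2 = - ⟪T i w, y⟫_ℝ := by
        rw [anti, neg_neg, ← real_inner_self_eq_norm_sq]
        calc ⟪w, w⟫_ℝ = ⟪w, Q (T i y)⟫_ℝ := rfl
          _ = ⟪Q w, T i y⟫_ℝ := (hs _ _).symm
          _ = _ := by rw [hQw]
      rw [this]
      calc - ⟪T i w, y⟫_ℝ ≤ ‖T i w‖ * ‖y‖ := by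
            rw [← inner_neg_left, ← norm_neg (T i w)]; exact real_inner_le_norm _ _
        _ ≤ _ := by
            gcongr
            have := hq w
            rwa [hQw] at this
    rcases eq_or_lt_of_le (norm_nonneg w) with h | h
    · rw [← h]; positivity
    · nlinarith
  have hmin : ∀ (p q : ℕ) (X c : ℝ), 0 ≤ c → X ≤ c * (μ ^ 2) ^ p → X ≤ c * (μ ^ 2) ^ q →
      X ≤ c * μ ^ p * μ ^ q := by
    intro p q X c hc hp hq
    rcases le_total p q with h | h
    · refine hq.trans ?_
      rw [mul_assoc, ← pow_mul, ← pow_add]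
      exact mul_le_mul_of_nonneg_left (pow_le_pow_of_le_one h0.le h1.le (by omega)) hc
    · refine hp.trans ?_
      rw [mul_assoc, ← pow_mul, ← pow_add]
      exact mul_le_mul_of_nonneg_left (pow_le_pow_of_le_one h0.le h1.le (by omega)) hc
  -- the general two-sided bound
  have two : ∀ (Q : H → H) i j (d : ℕ), i < m → (∀ y z, ⟪Q y, z⟫_ℝ = ⟪y, Q z⟫_ℝ) →
      (∀ y, Q (Q y) = Q y) → (∀ y, ‖Q y‖ ≤ ‖y‖) → (∀ y, ‖T i (Q y)‖ ≤ B * (μ ^ 2) ^ d * ‖Q y‖) →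
      ‖Q (T i (P j x - P (j+1) x))‖ ≤ B * μ ^ d * μ ^ nd i j * a j := by
    intro Q i j d hi hs hi2 hn hq
    have h3 := dual Q i _ (by positivity) hi hs hi2 hq (P j x - P (j+1) x)
    have h4 := (hn _).trans (hTD i j x hi)
    have := hmin d (nd i j) _ (B * a j) (by positivity) (h3.trans (le_of_eq (by ring)))
      (h4.trans (le_of_eq (by ring)))
    linarith
  have hTx : ∀ i, T i x = ∑ j ∈ Finset.range (m + 2), T i (P j x - P (j+1) x) := by
    intro i
    rw [← map_sum, hP.sum_delta]
  have hsum : ∑ j ∈ Finset.range (m + 2), a j ^ 2 = ‖x‖ ^ 2 := hP.sum_delta_sq x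
  constructor
  · rw [← hP.sum_delta_sq, ← hsum]
    refine schur_sum2 h0 h1 hB0 (Finset.range m) _ _ a _ (fun k _ => norm_nonneg _) ?_
    intro l _
    have e : P l (∑ i ∈ Finset.range m, T i x) - P (l + 1) (∑ i ∈ Finset.range m, T i x) =
        ∑ i ∈ Finset.range m, ∑ j ∈ Finset.range (m + 2),
          (P l (T i (P j x - P (j+1) x)) - P (l+1) (T i (P j x - P (j+1) x))) := by
      simp only [Finset.sum_sub_distrib, ← map_sum, ← hTx]
    rw [e]
    refine (norm_sum_le _ _).trans (Finset.sum_le_sum fun i hi => ?_)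
    refine (norm_sum_le _ _).trans (Finset.sum_le_sum fun j hj => ?_)
    refine two (fun y => P l y - P (l+1) y) i j (nd l i) (Finset.mem_range.1 hi) ?_ ?_ ?_ ?_
    · intro y z; simp only [inner_sub_left, inner_sub_right, hP.sa]
    · intro y
      simp only [map_sub, hP.nest _ _ _ (le_refl l), hP.nest _ _ _ (Nat.le_succ l),
        hP.nest _ _ _ (le_refl (l+1)), hP.nest' _ _ _ (Nat.le_succ l)]
      simp
    · intro y
      have h := hP.delta_inner l y
      have h' := real_inner_le_norm (P l y - P (l+1) y) y
      nlinarith [norm_nonneg (P l y - P (l+1) y), norm_nonneg y]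
    · intro y
      have := hTD i l y (Finset.mem_range.1 hi)
      rwa [nd_comm] at this
  · rw [← hsum]
    refine schur_sum2 h0 h1 hB0 (Finset.range m) _ _ a _ (fun k _ => norm_nonneg _) ?_
    intro k hk
    have hk' : k ≤ m := Nat.lt_succ_iff.1 (Finset.mem_range.1 hk)
    have e : ∑ i ∈ Finset.Ico k m, T i x - P (k + 1) (∑ i ∈ Finset.range m, T i x) =
        ∑ i ∈ Finset.range m, ((if k ≤ i then T i x else 0) - P (k+1) (T i x)) := by
      rw [Finset.sum_sub_distrib, map_sum, ← Finset.sum_filter]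
      congr 2
      ext i; simp; omega
    rw [e]
    refine (norm_sum_le _ _).trans (Finset.sum_le_sum fun i hi => ?_)
    have hi' := Finset.mem_range.1 hi
    by_cases hki : k ≤ i
    · have e2 : (if k ≤ i then T i x else 0) - P (k+1) (T i x) =
          ∑ j ∈ Finset.range (m + 2), (T i (P j x - P (j+1) x) -
            P (k+1) (T i (P j x - P (j+1) x))) := by
        rw [if_pos hki, Finset.sum_sub_distrib, ← map_sum (P (k+1)), ← hTx]
      rw [e2]
      refine (norm_sum_le _ _).trans (Finset.sum_le_sum fun j hj => ?_)
      refine two (fun y => y - P (k+1) y) i j (nd k i) hi' ?_ ?_ ?_ ?_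
      · intro y z; simp only [inner_sub_left, inner_sub_right, hP.sa]
      · intro y; simp only [map_sub, hP.nest _ _ _ le_rfl]; simp
      · exact hP.norm_sub_le _
      · intro y
        have h6 := hf i (k+1) (y - P (k+1) y) hi' (by omega)
        have e3 : (y - P (k+1) y) - P (k+1) (y - P (k+1) y) = y - P (k+1) y := by
          simp only [map_sub, hP.nest _ _ _ le_rfl]; simp
        rw [e3] at h6
        refine h6.trans ?_
        have : i + 1 - (k + 1) = nd k i := by unfold nd; omega
        rw [this]
        gcongr
    · have e2 : (if k ≤ i then T i x else 0) - P (k+1) (T i x) =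
          - ∑ j ∈ Finset.range (m + 2), P (k+1) (T i (P j x - P (j+1) x)) := by
        rw [if_neg hki, ← map_sum (P (k+1)), ← hTx, zero_sub]
      rw [e2, norm_neg]
      refine (norm_sum_le _ _).trans (Finset.sum_le_sum fun j hj => ?_)
      refine two (fun y => P (k+1) y) i j (nd k i) hi' ?_ ?_ ?_ ?_
      · intro y z; exact hP.sa _ _ _
      · intro y; exact hP.nest _ _ _ le_rfl
      · exact hP.norm_le _
      · intro y
        have h6 := hc i (k+1) (P (k+1) y) hi' (by omega)
        rw [hP.nest _ _ _ le_rfl] at h6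
        refine h6.trans ?_
        have : k + 1 - (i + 1) = nd k i := by unfold nd; omega
        rw [this]
        gcongr

end ProjChain
end hilb

/-! ### Part E: martingale variation via greedy jumps -/

/-- greedy reference sequence -/
def grd (l : ℝ) (a : ℕ → ℝ) : ℕ → ℝ
  | 0 => a 0
  | (t + 1) => if l ≤ |a (t + 1) - grd l a t| then a (t + 1) else grd l a t

/-- greedy jump indicator -/
def jmp (l : ℝ) (a : ℕ → ℝ) (t : ℕ) : ℕ := if l ≤ |a (t + 1) - grd l a t| then 1 else 0

/-- number of greedy jumps -/
def njmp (l : ℝ) (a : ℕ → ℝ) (m : ℕ) : ℕ := ∑ t ∈ Finset.range m, jmp l a t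

theorem grd_close {l : ℝ} (hl : 0 < l) (a : ℕ → ℝ) (t : ℕ) : |a t - grd l a t| < l := by
  cases t with
  | zero => simpa [grd] using hl
  | succ t =>
    rw [grd]
    split_ifs with h
    · simpa using hl
    · exact not_le.1 h

theorem grd_eq_of_no_jmp {l : ℝ} (a : ℕ → ℝ) {t t' : ℕ} (h : t ≤ t')
    (h0 : ∑ s ∈ Finset.Ico t t', jmp l a s = 0) : grd l a t' = grd l a t := by
  induction t', h using Nat.le_induction with
  | base => rfl
  | succ k hk ih =>
    rw [Finset.sum_Ico_succ_top hk] at h0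
    have h1 : jmp l a k = 0 := by omega
    rw [← ih (by omega), grd]
    unfold jmp at h1
    split_ifs at h1 with h2
    rw [if_neg h2]

theorem jump_count {l : ℝ} (hl : 0 < l) (a : ℕ → ℝ) {t t' : ℕ} (h : t ≤ t') :
    (if 2 * l ≤ |a t' - a t| then 1 else 0) ≤ ∑ s ∈ Finset.Ico t t', jmp l a s := by
  split_ifs with h1
  · by_contra hcon
    have h0 : ∑ s ∈ Finset.Ico t t', jmp l a s = 0 := by omega
    have e := grd_eq_of_no_jmp a h h0
    have h2 := grd_close hl a t
    have h3 := grd_close hl a t'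
    rw [e] at h3
    have : |a t' - a t| < 2 * l := by
      rw [abs_lt] at *
      constructor <;> linarith [h2.1, h2.2, h3.1, h3.2]
    linarith
  · exact Nat.zero_le _

theorem jump_count_sum {l : ℝ} (hl : 0 < l) (a : ℕ → ℝ) {m : ℕ} (N : ℕ) {u : ℕ → ℕ}
    (hu : Monotone u) (hm : ∀ i, u i ≤ m) :
    ∑ i ∈ Finset.range N, (if 2 * l ≤ |a (u (i + 1)) - a (u i)| then 1 else 0) ≤ njmp l a m := by
  have h1 : ∑ i ∈ Finset.range N, (if 2 * l ≤ |a (u (i + 1)) - a (u i)| then 1 else 0) ≤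
      ∑ s ∈ Finset.Ico (u 0) (u N), jmp l a s := by
    induction N with
    | zero => simp
    | succ N ih =>
      rw [Finset.sum_range_succ, ← Finset.sum_Ico_consecutive _ (hu (Nat.zero_le N))
        (hu (Nat.le_succ N))]
      exact add_le_add ih (jump_count hl a (hu (Nat.le_succ N)))
  refine h1.trans (Finset.sum_le_sum_of_subset ?_)
  intro s hs
  simp only [Finset.mem_Ico, Finset.mem_range] at *
  have := hm N
  omega

theorem jump_count_sum' {l : ℝ} (hl : 0 < l) (a : ℕ → ℝ) {m : ℕ} (N : ℕ) {u : ℕ → ℕ}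
    (hu : Monotone u) (hm : ∀ i, u i ≤ m) :
    ∑ i ∈ Finset.range N, (if 2 * l ≤ |a (u (i + 1)) - a (u i)| then (1 : ℝ≥0∞) else 0) ≤
      (njmp l a m : ℝ≥0∞) := by
  have := jump_count_sum hl a N hu hm
  have h2 : ((∑ i ∈ Finset.range N, (if 2 * l ≤ |a (u (i + 1)) - a (u i)| then 1 else 0) : ℕ) :
    ℝ≥0∞) ≤ (njmp l a m : ℝ≥0∞) := by exact_mod_cast this
  refine le_trans (le_of_eq ?_) h2
  push_cast
  rfl

theorem pv_path_le {ρ al : ℝ} (hρ : 1 ≤ ρ) (hal : 0 < al) (a : ℕ → ℝ) (m : ℕ) :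
    pv ρ a (Iic m) ≤ ENNReal.ofReal al +
      ENNReal.ofReal (al ^ (1 - ρ)) * (∑' i : ℕ, ENNReal.ofReal ((4 * (al * (1/2) ^ (i + 1))) ^ ρ) *
        (njmp (al * (1/2) ^ (i + 1)) a m : ℝ≥0∞)) +
      ∑' i : ℕ, ENNReal.ofReal (4 * (al * 2 ^ i)) * (njmp (al * 2 ^ i) a m : ℝ≥0∞) := by
  have hρ0 : 0 < ρ := by linarith
  refine pv_le fun N u hu hs => ?_
  have hm : ∀ i, u i ≤ m := hs
  set d : ℕ → ℝ := fun i => a (u (i + 1)) - a (u i) with hd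
  set f : ℕ → ℝ≥0∞ := fun i => if |d i| < 2 * al then ‖d i‖ₑ else 0 with hf
  set g : ℕ → ℝ≥0∞ := fun i => if |d i| < 2 * al then 0 else ‖d i‖ₑ with hg
  have e : ∀ i, ‖a (u (i + 1)) - a (u i)‖ₑ = f i + g i := by
    intro i
    simp only [hf, hg]
    split_ifs <;> simp [hd]
  simp only [e]
  refine (ENNReal.Lp_add_le _ _ _ hρ).trans (add_le_add ?_ ?_)
  · -- small increments
    set S := ∑ i ∈ Finset.range N, f i ^ ρ with hS
    have h1 : S ≤ ∑' i : ℕ, ENNReal.ofReal ((4 * (al * (1/2) ^ (i + 1))) ^ ρ) *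
        (njmp (al * (1/2) ^ (i + 1)) a m : ℝ≥0∞) := by
      calc S ≤ ∑ j ∈ Finset.range N, ∑' i : ℕ, ENNReal.ofReal ((4 * (al * (1/2) ^ (i + 1))) ^ ρ) *
            (if 2 * (al * (1/2) ^ (i + 1)) ≤ |d j| then (1 : ℝ≥0∞) else 0) := by
            refine Finset.sum_le_sum fun j _ => ?_
            simp only [hf]
            split_ifs with hlt
            · rcases eq_or_ne (d j) 0 with h0 | h0
              · simp [h0, hρ0]
              have hpos : 0 < |d j| := abs_pos.2 h0
              obtain ⟨k, hk1, hk2⟩ := exists_nat_pow_near_of_lt_one (x := |d j| / (2 * al))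
                (y := 1/2) (by positivity) (by rw [div_le_one (by positivity)]; exact hlt.le)
                (by norm_num) (by norm_num)
              rw [lt_div_iff₀ (by positivity)] at hk1
              rw [div_le_iff₀ (by positivity)] at hk2
              refine le_trans ?_ (ENNReal.le_tsum k)
              rw [if_pos (by linarith), mul_one, ← ENNReal.ofReal_rpow_of_pos (by positivity)]
              refine ENNReal.rpow_le_rpow ?_ hρ0.le
              rw [← ofReal_norm, Real.norm_eq_abs]
              refine ENNReal.ofReal_le_ofReal ?_
              rw [pow_succ]; linarith
            · simp [hρ0]
        _ = ∑' i : ℕ, ENNReal.ofReal ((4 * (al * (1/2) ^ (i + 1))) ^ ρ) *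
            ∑ j ∈ Finset.range N,
              (if 2 * (al * (1/2) ^ (i + 1)) ≤ |d j| then (1 : ℝ≥0∞) else 0) := by
            rw [← Summable.tsum_finsetSum (fun _ _ => ENNReal.summable)]
            simp only [Finset.mul_sum]
        _ ≤ _ := by
            refine ENNReal.tsum_le_tsum fun i => ?_
            gcongr
            exact jump_count_sum' (by positivity) a N hu hm
    refine le_trans ?_ (add_le_add le_rfl (mul_le_mul_right h1 _))
    -- x ≤ al + al^(1-ρ) x^ρ
    set x := S ^ (1 / ρ) with hx
    have hxS : S = x ^ ρ := by rw [hx, ← ENNReal.rpow_mul]; simp [hρ0.ne']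
    rw [hxS]
    rcases le_total x (ENNReal.ofReal al) with h | h
    · exact h.trans le_self_add
    · refine le_trans ?_ le_add_self
      have e1 : x ^ ρ = x * x ^ (ρ - 1) := by
        have := ENNReal.rpow_add_of_nonneg (x := x) 1 (ρ - 1) zero_le_one (by linarith)
        rw [ENNReal.rpow_one] at this
        rw [← this]
        congr 1; ring
      rw [e1]
      calc x = ENNReal.ofReal (al ^ (1 - ρ)) * (x * ENNReal.ofReal al ^ (ρ - 1)) := by
            rw [ENNReal.ofReal_rpow_of_pos hal, mul_comm x, ← mul_assoc,
              ← ENNReal.ofReal_mul (by positivity), ← Real.rpow_add hal]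
            simp
        _ ≤ _ := by
            gcongr
  · have h1 := sum_rpow_le_rpow (Finset.range N) g (p := 1) (q := ρ) one_pos hρ
    refine h1.trans ?_
    simp only [ENNReal.rpow_one, div_one]
    calc _ ≤ ∑ j ∈ Finset.range N, ∑' i : ℕ, ENNReal.ofReal (4 * (al * 2 ^ i)) *
            (if 2 * (al * 2 ^ i) ≤ |d j| then (1 : ℝ≥0∞) else 0) := by
            refine Finset.sum_le_sum fun j _ => ?_
            simp only [hg]
            split_ifs with hlt
            · exact zero_le
            · push Not at hlt
              obtain ⟨k, hk1, hk2⟩ := exists_nat_pow_near (x := |d j| / (2 * al))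
                (y := 2) (by rw [one_le_div (by positivity)]; exact hlt) (by norm_num)
              rw [le_div_iff₀ (by positivity)] at hk1
              rw [div_lt_iff₀ (by positivity)] at hk2
              refine le_trans ?_ (ENNReal.le_tsum k)
              rw [if_pos (by linarith), mul_one]
              rw [← ofReal_norm, Real.norm_eq_abs]
              refine ENNReal.ofReal_le_ofReal ?_
              rw [pow_succ] at hk2; linarith
        _ = ∑' i : ℕ, ENNReal.ofReal (4 * (al * 2 ^ i)) *
            ∑ j ∈ Finset.range N,
              (if 2 * (al * 2 ^ i) ≤ |d j| then (1 : ℝ≥0∞) else 0) := by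
            rw [← Summable.tsum_finsetSum (fun _ _ => ENNReal.summable)]
            simp only [Finset.mul_sum]
        _ ≤ _ := by
            refine ENNReal.tsum_le_tsum fun i => ?_
            gcongr
            exact jump_count_sum' (by positivity) a N hu hm

theorem pv_reverse (p : ℝ) (a : ℕ → ℝ) (m : ℕ) :
    pv p (fun k => a (m - k)) (Iic m) ≤ pv p a (Iic m) := by
  refine pv_le fun N u hu hs => ?_
  have := le_pv p a (s := Iic m) N (u := fun i => m - u (N - i))
    (fun i j hij => Nat.sub_le_sub_left (hu (Nat.sub_le_sub_left hij N)) m)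
    (fun i => Nat.sub_le _ _)
  refine le_trans (le_of_eq ?_) this
  congr 1
  rw [← Finset.sum_range_reflect]
  refine Finset.sum_congr rfl fun i hi => ?_
  have hi' := Finset.mem_range.1 hi
  rw [← enorm_neg, neg_sub, show N - 1 - i + 1 = N - i by omega, show N - 1 - i = N - (i + 1) by omega]

section mart
variable {Ω : Type*} {m0 : MeasurableSpace Ω} {μ : Measure Ω}

/-- square-integrable (reverse-free) martingale closed by `g` -/
structure L2Mart (ℱ : ℕ → MeasurableSpace Ω) (b : ℕ → Ω → ℝ) (g : Ω → ℝ) (μ : Measure Ω) :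
    Prop where
  mono : Monotone ℱ
  le : ∀ t, ℱ t ≤ m0
  meas : ∀ t, StronglyMeasurable[ℱ t] (b t)
  mem : ∀ t, MemLp (b t) 2 μ
  memg : MemLp g 2 μ
  orth : ∀ t (d : Ω → ℝ), StronglyMeasurable[ℱ t] d → MemLp d 2 μ → ∫ x, (g x - b t x) * d x ∂μ = 0

variable {ℱ : ℕ → MeasurableSpace Ω} {b : ℕ → Ω → ℝ} {g : Ω → ℝ}

theorem L2Mart.meas_grd (h : L2Mart ℱ b g μ) (l : ℝ) (t : ℕ) :
    StronglyMeasurable[ℱ t] (fun x => grd l (fun s => b s x) t) ∧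
    MemLp (fun x => grd l (fun s => b s x) t) 2 μ := by
  induction t with
  | zero => exact ⟨h.meas 0, h.mem 0⟩
  | succ t ih =>
    have hs : StronglyMeasurable[ℱ (t+1)] (fun x => grd l (fun s => b s x) t) :=
      ih.1.mono (h.mono (Nat.le_succ t))
    have hset : MeasurableSet[ℱ (t+1)] {x | l ≤ |b (t+1) x - grd l (fun s => b s x) t|} := by
      have : Measurable[ℱ (t+1)] fun x => |b (t+1) x - grd l (fun s => b s x) t| := by
        have := ((h.meas (t+1)).sub hs).norm.measurable
        simpa [Real.norm_eq_abs] using this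
      exact @measurableSet_le _ _ _ _ _ (ℱ (t+1)) _ _ _ _ _ measurable_const this
    have e : (fun x => grd l (fun s => b s x) (t+1)) =
        ({x | l ≤ |b (t+1) x - grd l (fun s => b s x) t|}.piecewise (b (t+1))
          (fun x => grd l (fun s => b s x) t)) := by
      ext x
      rw [grd]
      simp only [Set.piecewise, Set.mem_ofPred_eq]
    constructor
    · rw [e]
      classical
      convert StronglyMeasurable.piecewise hset (h.meas (t+1)) hs
    · rw [e]
      classical
      convert MemLp.piecewise (h.le _ _ hset) ((h.mem (t+1)).restrict _) (ih.2.restrict _)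

theorem L2Mart.meas_njmp (h : L2Mart ℱ b g μ) (l : ℝ) (m : ℕ) :
    Measurable (fun x => (njmp l (fun s => b s x) m : ℝ≥0∞)) := by
  unfold njmp
  push_cast
  refine Finset.measurable_sum _ fun t _ => ?_
  unfold jmp
  push_cast
  refine Measurable.ite ?_ measurable_const measurable_const
  have h1 : Measurable (b (t+1)) := ((h.meas (t+1)).mono (h.le _)).measurable
  have h2 : Measurable (fun x => grd l (fun s => b s x) t) :=
    ((h.meas_grd l t).1.mono (h.le _)).measurable
  exact measurableSet_le measurable_const ((h1.sub h2).abs)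

theorem L2Mart.energy (h : L2Mart ℱ b g μ) {l : ℝ} (hl : 0 < l) (m : ℕ) :
    ∫⁻ x, (njmp l (fun s => b s x) m : ℝ≥0∞) ∂μ ≤
      ENNReal.ofReal (l ^ (-2 : ℤ) * ∫ x, g x ^ 2 ∂μ) := by
  set c : ℕ → Ω → ℝ := fun t x => grd l (fun s => b s x) t with hc
  set d : ℕ → Ω → ℝ := fun t x => c (t+1) x - c t x with hd
  have hcm : ∀ t, MemLp (c t) 2 μ := fun t => (h.meas_grd l t).2
  have hcs : ∀ t, StronglyMeasurable[ℱ t] (c t) := fun t => (h.meas_grd l t).1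
  have hdm : ∀ t, MemLp (d t) 2 μ := fun t => (hcm (t+1)).sub (hcm t)
  have hds : ∀ t, StronglyMeasurable[ℱ (t+1)] (d t) := fun t =>
    (hcs (t+1)).sub ((hcs t).mono (h.mono (Nat.le_succ t)))
  -- pointwise
  have hp1 : ∀ t x, (g x - c (t+1) x) * d t x = (g x - b (t+1) x) * d t x := by
    intro t x
    simp only [hd, hc, grd]
    split_ifs <;> ring
  have hp2 : ∀ t x, l ^ 2 * (jmp l (fun s => b s x) t : ℝ) ≤ d t x ^ 2 := by
    intro t x
    simp only [hd, hc, grd, jmp]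
    split_ifs with h1
    · rw [← sq_abs (b (t+1) x - _)]
      have := pow_le_pow_left₀ hl.le h1 2
      simpa using this
    · simp
  have hI : ∀ t, Integrable (fun x => (g x - c t x) ^ 2) μ := fun t =>
    (h.memg.sub (hcm t)).integrable_sq
  have hdI : ∀ t, Integrable (fun x => d t x ^ 2) μ := fun t => (hdm t).integrable_sq
  have hstep : ∀ t, ∫ x, d t x ^ 2 ∂μ =
      ∫ x, (g x - c t x) ^ 2 ∂μ - ∫ x, (g x - c (t+1) x) ^ 2 ∂μ := by
    intro t
    have h3 : ∫ x, (g x - c (t+1) x) * d t x ∂μ = 0 := by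
      simp only [hp1]
      exact h.orth (t+1) _ (hds t) (hdm t)
    have h4 : Integrable (fun x => (g x - c (t+1) x) * d t x) μ :=
      (h.memg.sub (hcm (t+1))).integrable_mul (hdm t)
    have h5 : ∀ x, (g x - c t x) ^ 2 = (g x - c (t+1) x) ^ 2 + 2 * ((g x - c (t+1) x) * d t x) +
        d t x ^ 2 := by
      intro x; simp only [hd]; ring
    simp only [h5]
    have h6 : Integrable (fun x => (g x - c (t+1) x) ^ 2 + 2 * ((g x - c (t+1) x) * d t x)) μ :=
      (hI (t+1)).add (h4.const_mul 2)
    rw [integral_add h6 (hdI t),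
      integral_add (hI (t+1)) (h4.const_mul 2), integral_const_mul, h3]
    ring
  have h0 : ∫ x, (g x - c 0 x) ^ 2 ∂μ ≤ ∫ x, g x ^ 2 ∂μ := by
    have h3 : ∫ x, (g x - b 0 x) * b 0 x ∂μ = 0 := h.orth 0 _ (h.meas 0) (h.mem 0)
    have h4 : Integrable (fun x => (g x - b 0 x) * b 0 x) μ :=
      (h.memg.sub (h.mem 0)).integrable_mul (h.mem 0)
    have h5 : ∀ x, g x ^ 2 = (g x - c 0 x) ^ 2 + 2 * ((g x - b 0 x) * b 0 x) + b 0 x ^ 2 := by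
      intro x; simp only [hc, grd]; ring
    have h6 : 0 ≤ ∫ x, b 0 x ^ 2 ∂μ := integral_nonneg fun x => sq_nonneg _
    simp only [h5]
    have h7 : Integrable (fun x => (g x - c 0 x) ^ 2 + 2 * ((g x - b 0 x) * b 0 x)) μ :=
      (hI 0).add (h4.const_mul 2)
    rw [integral_add h7 (h.mem 0).integrable_sq,
      integral_add (hI 0) (h4.const_mul 2), integral_const_mul, h3]
    linarith
  have hsum : ∫ x, ∑ t ∈ Finset.range m, d t x ^ 2 ∂μ ≤ ∫ x, g x ^ 2 ∂μ := by
    rw [integral_finsetSum _ (fun t _ => hdI t)]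
    simp only [hstep]
    rw [Finset.sum_range_sub']
    have : 0 ≤ ∫ x, (g x - c m x) ^ 2 ∂μ := integral_nonneg fun x => sq_nonneg _
    linarith
  calc ∫⁻ x, (njmp l (fun s => b s x) m : ℝ≥0∞) ∂μ
      ≤ ∫⁻ x, ENNReal.ofReal (l ^ (-2 : ℤ) * ∑ t ∈ Finset.range m, d t x ^ 2) ∂μ := by
        refine lintegral_mono fun x => ?_
        rw [← ENNReal.ofReal_natCast]
        refine ENNReal.ofReal_le_ofReal ?_
        rw [zpow_neg, ← div_eq_inv_mul, le_div_iff₀ (by positivity), mul_comm]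
        unfold njmp
        push_cast
        rw [Finset.mul_sum]
        exact Finset.sum_le_sum fun t _ => by exact_mod_cast hp2 t x
    _ = ENNReal.ofReal (l ^ (-2 : ℤ) * ∫ x, ∑ t ∈ Finset.range m, d t x ^ 2 ∂μ) := by
        rw [← integral_const_mul, ofReal_integral_eq_lintegral_ofReal]
        · exact (integrable_finsetSum _ fun t _ => hdI t).const_mul _
        · exact Eventually.of_forall fun x => by
            have : 0 ≤ ∑ t ∈ Finset.range m, d t x ^ 2 := Finset.sum_nonneg fun t _ => sq_nonneg _
            simp only [Pi.zero_apply]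
            positivity
    _ ≤ _ := by gcongr

/-- The constant in the integrated martingale estimate. -/
def martConst (ρ : ℝ) : ℝ :=
  4 ^ ρ * (∑' i : ℕ, ((1/2 : ℝ) ^ (ρ - 2)) ^ (i + 1)) + 4 * ∑' i : ℕ, (1/2 : ℝ) ^ i

theorem martConst_nonneg (ρ : ℝ) : 0 ≤ martConst ρ := by
  unfold martConst
  have : 0 ≤ ∑' i : ℕ, ((1/2 : ℝ) ^ (ρ - 2)) ^ (i + 1) := tsum_nonneg fun i => by positivity
  have : 0 ≤ ∑' i : ℕ, (1/2 : ℝ) ^ i := tsum_nonneg fun i => by positivity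
  positivity

theorem L2Mart.variation (h : L2Mart ℱ b g μ) {ρ al : ℝ} (hρ : 2 < ρ) (hal : 0 < al) (m : ℕ) :
    ∃ Ψ : Ω → ℝ≥0∞, Measurable Ψ ∧
      (∀ x, pv ρ (fun k => b k x) (Iic m) ≤ ENNReal.ofReal al + Ψ x) ∧
      ∫⁻ x, Ψ x ∂μ ≤ ENNReal.ofReal (martConst ρ * al⁻¹ * ∫ x, g x ^ 2 ∂μ) := by
  set I := ∫ x, g x ^ 2 ∂μ with hI
  have hI0 : 0 ≤ I := integral_nonneg fun x => sq_nonneg _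
  refine ⟨fun x => ENNReal.ofReal (al ^ (1 - ρ)) *
      (∑' i : ℕ, ENNReal.ofReal ((4 * (al * (1/2) ^ (i + 1))) ^ ρ) *
        (njmp (al * (1/2) ^ (i + 1)) (fun k => b k x) m : ℝ≥0∞)) +
      ∑' i : ℕ, ENNReal.ofReal (4 * (al * 2 ^ i)) *
        (njmp (al * 2 ^ i) (fun k => b k x) m : ℝ≥0∞), ?_, ?_, ?_⟩
  · refine Measurable.add (Measurable.const_mul (Measurable.tsum fun i =>
      (h.meas_njmp _ m).const_mul _) _) (Measurable.tsum fun i => (h.meas_njmp _ m).const_mul _)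
  · intro x
    rw [← add_assoc]
    exact pv_path_le (by linarith) hal _ m
  · rw [lintegral_add_right _ (Measurable.tsum fun i => (h.meas_njmp _ m).const_mul _),
      lintegral_const_mul _ (Measurable.tsum fun i => (h.meas_njmp _ m).const_mul _),
      lintegral_tsum (fun i => ((h.meas_njmp _ m).const_mul _).aemeasurable),
      lintegral_tsum (fun i => ((h.meas_njmp _ m).const_mul _).aemeasurable)]
    have q0 : (0:ℝ) < (1/2 : ℝ) ^ (ρ - 2) := by positivity
    have q1 : (1/2 : ℝ) ^ (ρ - 2) < 1 := Real.rpow_lt_one (by norm_num) (by norm_num) (by linarith)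
    have s1 : Summable fun i : ℕ => ((1/2 : ℝ) ^ (ρ - 2)) ^ (i + 1) :=
      (summable_nat_add_iff 1).2 (summable_geometric_of_lt_one q0.le q1)
    have s2 : Summable fun i : ℕ => (1/2 : ℝ) ^ i := summable_geometric_two
    have e1 : ENNReal.ofReal (al ^ (1 - ρ)) * (∑' i : ℕ, ∫⁻ x,
        ENNReal.ofReal ((4 * (al * (1/2) ^ (i + 1))) ^ ρ) *
        (njmp (al * (1/2) ^ (i + 1)) (fun k => b k x) m : ℝ≥0∞) ∂μ) ≤
        ENNReal.ofReal (4 ^ ρ * (∑' i : ℕ, ((1/2 : ℝ) ^ (ρ - 2)) ^ (i + 1)) * al⁻¹ * I) := by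
      have : ∀ i : ℕ, ∫⁻ x, ENNReal.ofReal ((4 * (al * (1/2) ^ (i + 1))) ^ ρ) *
        (njmp (al * (1/2) ^ (i + 1)) (fun k => b k x) m : ℝ≥0∞) ∂μ ≤
        ENNReal.ofReal ((4 ^ ρ * al ^ (ρ - 2) * I) * ((1/2 : ℝ) ^ (ρ - 2)) ^ (i + 1)) := by
        intro i
        rw [lintegral_const_mul _ (h.meas_njmp _ m)]
        refine (mul_le_mul_right (h.energy (by positivity) m) _).trans ?_
        rw [← ENNReal.ofReal_mul (by positivity)]
        refine ENNReal.ofReal_le_ofReal (le_of_eq ?_)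
        have hx : (0:ℝ) < al * (1/2) ^ (i+1) := by positivity
        rw [Real.mul_rpow (by norm_num) hx.le, zpow_neg]
        have e2 : (al * (1/2) ^ (i+1)) ^ ρ = (al * (1/2:ℝ) ^ (i+1)) ^ (ρ - 2) *
            (al * (1/2) ^ (i+1)) ^ (2:ℤ) := by
          rw [← Real.rpow_intCast, ← Real.rpow_add hx]; congr 1; push_cast; ring
        have e3 : ((1/2 : ℝ) ^ (i+1)) ^ (ρ - 2) = ((1/2 : ℝ) ^ (ρ - 2)) ^ (i + 1) := by
          rw [← Real.rpow_natCast, ← Real.rpow_natCast, ← Real.rpow_mul (by norm_num),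
            ← Real.rpow_mul (by norm_num), mul_comm]
        rw [e2, Real.mul_rpow hal.le (by positivity), e3]
        have : (al * (1/2) ^ (i+1)) ^ (2:ℤ) ≠ 0 := by positivity
        rw [← hI]
        field_simp
      refine (mul_le_mul_right (ENNReal.tsum_le_tsum this) _).trans ?_
      rw [← ENNReal.ofReal_tsum_of_nonneg (fun i => by positivity) (s1.mul_left _),
        tsum_mul_left, ← ENNReal.ofReal_mul (by positivity)]
      refine ENNReal.ofReal_le_ofReal (le_of_eq ?_)
      have : al ^ (1 - ρ) * al ^ (ρ - 2) = al⁻¹ := by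
        rw [← Real.rpow_add hal, ← Real.rpow_neg_one]; congr 1; ring
      rw [← this]; ring
    have e2 : (∑' i : ℕ, ∫⁻ x, ENNReal.ofReal (4 * (al * 2 ^ i)) *
        (njmp (al * 2 ^ i) (fun k => b k x) m : ℝ≥0∞) ∂μ) ≤
        ENNReal.ofReal (4 * (∑' i : ℕ, (1/2 : ℝ) ^ i) * al⁻¹ * I) := by
      have : ∀ i : ℕ, ∫⁻ x, ENNReal.ofReal (4 * (al * 2 ^ i)) *
        (njmp (al * 2 ^ i) (fun k => b k x) m : ℝ≥0∞) ∂μ ≤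
        ENNReal.ofReal ((4 * al⁻¹ * I) * (1/2 : ℝ) ^ i) := by
        intro i
        rw [lintegral_const_mul _ (h.meas_njmp _ m)]
        refine (mul_le_mul_right (h.energy (by positivity) m) _).trans ?_
        rw [← ENNReal.ofReal_mul (by positivity)]
        refine ENNReal.ofReal_le_ofReal (le_of_eq ?_)
        rw [zpow_neg, one_div, inv_pow]
        have : (2:ℝ) ^ i ≠ 0 := by positivity
        field_simp
        norm_cast
      refine (ENNReal.tsum_le_tsum this).trans ?_
      rw [← ENNReal.ofReal_tsum_of_nonneg (fun i => by positivity) (s2.mul_left _),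
        tsum_mul_left]
      refine ENNReal.ofReal_le_ofReal (le_of_eq ?_)
      ring
    refine (add_le_add e1 e2).trans ?_
    have t1 : 0 ≤ ∑' i : ℕ, ((1/2 : ℝ) ^ (ρ - 2)) ^ (i + 1) := tsum_nonneg fun i => by positivity
    have t2 : 0 ≤ ∑' i : ℕ, (1/2 : ℝ) ^ i := tsum_nonneg fun i => by positivity
    rw [← ENNReal.ofReal_add (by positivity) (by positivity)]
    refine ENNReal.ofReal_le_ofReal (le_of_eq ?_)
    unfold martConst
    ring

end mart

/-! ### Part B: the kernel, and the core lemma -/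

abbrev EE (n : ℕ) := EuclideanSpace ℝ (Fin n)

/-- Riesz kernel -/
def Kr {n : ℕ} (ℓ : Fin n) (z : EE n) : ℝ := z ℓ / ‖z‖ ^ (n + 1)

section kernel
variable {n : ℕ} (ℓ : Fin n)

theorem abs_coord_le (z : EE n) : |z ℓ| ≤ ‖z‖ := by
  have := PiLp.norm_apply_le z ℓ
  simpa using this

theorem Kr_neg (z : EE n) : Kr ℓ (-z) = - Kr ℓ z := by
  simp [Kr, neg_div]

theorem Kr_meas : Measurable (Kr ℓ) := by
  unfold Kr
  have : Measurable fun z : EE n => z ℓ := by fun_prop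
  exact this.div (measurable_norm.pow_const _)

theorem Kr_abs_le (z : EE n) : |Kr ℓ z| ≤ (‖z‖ ^ n)⁻¹ := by
  rcases eq_or_ne z 0 with rfl | hz
  · simp [Kr]
  have h := norm_pos_iff.2 hz
  rw [Kr, abs_div, abs_of_pos (by positivity : 0 < ‖z‖ ^ (n+1)), div_le_iff₀ (by positivity), pow_succ]
  have := abs_coord_le ℓ z
  field_simp
  exact this

theorem abs_pow_sub_le {a b A : ℝ} (ha : 0 ≤ a) (hb : 0 ≤ b) (haA : a ≤ A) (hbA : b ≤ A) (N : ℕ) :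
    |a ^ (N+1) - b ^ (N+1)| ≤ |a - b| * ((N+1) * A ^ N) := by
  induction N with
  | zero => simp
  | succ N ih =>
    have e : a ^ (N+1+1) - b ^ (N+1+1) = a * (a^(N+1) - b^(N+1)) + (a - b) * b ^ (N+1) := by ring
    have hA : 0 ≤ A := ha.trans haA
    calc |a ^ (N+1+1) - b ^ (N+1+1)| ≤ |a * (a^(N+1) - b^(N+1))| + |(a - b) * b ^ (N+1)| := by
          rw [e]; exact abs_add_le _ _
      _ = a * |a^(N+1) - b^(N+1)| + |a - b| * b^(N+1) := by
          rw [abs_mul, abs_mul, abs_of_nonneg ha, abs_of_nonneg (by positivity : 0 ≤ b^(N+1))]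
      _ ≤ A * (|a - b| * ((N+1) * A ^ N)) + |a - b| * A^(N+1) := by
          gcongr
      _ = _ := by push_cast; ring

/-- smoothness constant -/
def cK (n : ℕ) : ℝ := 1 + (n + 1) * 4 ^ n

theorem cK_pos (n : ℕ) : 0 < cK n := by unfold cK; positivity

theorem Kr_sub_le {z w : EE n} (hz : z ≠ 0) (h : ‖z - w‖ ≤ ‖z‖ / 2) :
    |Kr ℓ z - Kr ℓ w| ≤ cK n * ‖z - w‖ / ‖z‖ ^ (n + 1) := by
  have ha := norm_pos_iff.2 hz
  set a := ‖z‖ with hadef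
  set b := ‖w‖ with hbdef
  have hab : |a - b| ≤ ‖z - w‖ := abs_norm_sub_norm_le z w
  have hb1 : a / 2 ≤ b := by have := (abs_le.1 (hab.trans h)).2; linarith
  have hb2 : b ≤ 2 * a := by have := (abs_le.1 (hab.trans h)).1; linarith
  have hb : 0 < b := by linarith
  have hwl : |w ℓ| ≤ b := abs_coord_le ℓ w
  have hzw : |z ℓ - w ℓ| ≤ ‖z - w‖ := by
    have := abs_coord_le ℓ (z - w)
    simpa using this
  have e : Kr ℓ z - Kr ℓ w = (z ℓ - w ℓ) / a ^ (n+1) +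
      w ℓ * (b ^ (n+1) - a ^ (n+1)) / (a ^ (n+1) * b ^ (n+1)) := by
    unfold Kr
    rw [← hadef, ← hbdef]
    field_simp
    ring
  have h1 : |(z ℓ - w ℓ) / a ^ (n+1)| ≤ ‖z - w‖ / a ^ (n+1) := by
    rw [abs_div, abs_of_pos (by positivity : 0 < a ^ (n+1))]
    gcongr
  have h2 : |w ℓ * (b ^ (n+1) - a ^ (n+1)) / (a ^ (n+1) * b ^ (n+1))| ≤
      ((n+1) * 4^n) * ‖z - w‖ / a ^ (n+1) := by
    have hp := abs_pow_sub_le hb.le ha.le hb2 (by linarith) n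
    rw [abs_div, abs_mul, abs_of_pos (by positivity : 0 < a ^ (n+1) * b ^ (n+1)),
      div_le_div_iff₀ (by positivity) (by positivity)]
    have hb3 : (2 * a) ^ n ≤ 4 ^ n * b ^ n := by
      rw [← mul_pow]; exact pow_le_pow_left₀ (by positivity) (by linarith) n
    calc |w ℓ| * |b ^ (n+1) - a ^ (n+1)| * a ^ (n+1)
        ≤ b * (‖z - w‖ * ((n+1) * (4 ^ n * b ^ n))) * a ^ (n+1) := by
          gcongr
          refine hp.trans ?_
          rw [abs_sub_comm]
          gcongr
      _ = (n + 1) * 4 ^ n * ‖z - w‖ * (a ^ (n + 1) * b ^ (n + 1)) := by ring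
  rw [e]
  refine (abs_add_le _ _).trans ((add_le_add h1 h2).trans (le_of_eq ?_))
  unfold cK; ring

end kernel

section vol
variable {n : ℕ}

/-- volume of the unit ball -/
def om (n : ℕ) : ℝ := (volume (Metric.ball (0 : EE n) 1)).toReal

theorem om_pos (n : ℕ) : 0 < om n :=
  ENNReal.toReal_pos (Metric.measure_ball_pos _ _ one_pos).ne' measure_ball_lt_top.ne

theorem vol_ball (x : EE n) {r : ℝ} (hr : 0 < r) :
    volume (Metric.ball x r) = ENNReal.ofReal (om n * r ^ n) := by
  rw [Measure.addHaar_ball_of_pos _ _ hr, mul_comm (om n), ENNReal.ofReal_mul (by positivity), om,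
    ENNReal.ofReal_toReal measure_ball_lt_top.ne]
  simp

theorem vol_shell [NeZero n] (x : EE n) {a b : ℝ} (ha : 0 < a) (hab : a ≤ b) :
    volume {y : EE n | a ≤ ‖x - y‖ ∧ ‖x - y‖ < b} ≤
      ENNReal.ofReal (om n * (n * (b - a) * b ^ (n - 1))) := by
  have e : {y : EE n | a ≤ ‖x - y‖ ∧ ‖x - y‖ < b} = Metric.ball x b \ Metric.ball x a := by
    ext y
    simp only [mem_ofPred_eq, Set.mem_sdiff, Metric.mem_ball, dist_comm y x, dist_eq_norm, not_lt]
    tauto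
  rw [e, measure_sdiff (Metric.ball_subset_ball hab) measurableSet_ball.nullMeasurableSet
    measure_ball_lt_top.ne, vol_ball _ ha, vol_ball _ (ha.trans_le hab),
    ← ENNReal.ofReal_sub _ (by have := om_pos n; positivity)]
  refine ENNReal.ofReal_le_ofReal ?_
  rw [← mul_sub]
  have := om_pos n
  gcongr
  obtain ⟨k, rfl⟩ : ∃ k, n = k + 1 := ⟨n - 1, (Nat.succ_pred_eq_of_ne_zero (NeZero.ne n)).symm⟩
  have := abs_pow_sub_le (ha.le.trans hab) ha.le le_rfl hab k
  rw [abs_of_nonneg (sub_nonneg.2 hab)] at this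
  refine (le_abs_self _).trans (this.trans (le_of_eq ?_))
  rw [Nat.add_sub_cancel]
  push_cast
  ring

theorem lintegral_cs {α : Type*} [MeasurableSpace α] (μ : Measure α) {f g : α → ℝ≥0∞}
    (hf : AEMeasurable f μ) (hg : AEMeasurable g μ) :
    (∫⁻ a, f a * g a ∂μ) ^ 2 ≤ (∫⁻ a, f a ^ 2 ∂μ) * ∫⁻ a, g a ^ 2 ∂μ := by
  have h := ENNReal.lintegral_mul_le_Lp_mul_Lq μ (Real.HolderConjugate.two_two) hf hg
  simp only [Pi.mul_apply, ENNReal.rpow_two] at h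
  refine (pow_le_pow_left' h 2).trans (le_of_eq ?_)
  rw [mul_pow, ← ENNReal.rpow_natCast, ← ENNReal.rpow_natCast, ← ENNReal.rpow_mul,
    ← ENNReal.rpow_mul]
  norm_num

/-- dyadic tail bound -/
theorem tail_le (x : EE n) {R : ℝ} (hR : 0 < R) (φ : EE n → ℝ≥0∞) :
    ∫⁻ y in {y | R ≤ ‖x - y‖}, φ y * ENNReal.ofReal (‖x - y‖ ^ (n+1))⁻¹ ≤
      ∑' k : ℕ, ENNReal.ofReal ((2 ^ k * R) ^ (n+1))⁻¹ * ∫⁻ y in Metric.ball x (2 ^ (k+1) * R), φ y := by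
  have hm : Measurable fun y : EE n => ‖x - y‖ := by fun_prop
  have hcov : {y : EE n | R ≤ ‖x - y‖} ⊆
      ⋃ k : ℕ, {y | 2 ^ k * R ≤ ‖x - y‖ ∧ ‖x - y‖ < 2 ^ (k+1) * R} := by
    intro y hy
    obtain ⟨k, h1, h2⟩ := exists_nat_pow_near (x := ‖x - y‖ / R) (y := 2)
      (by rw [one_le_div hR]; exact hy) (by norm_num)
    rw [le_div_iff₀ hR] at h1
    rw [div_lt_iff₀ hR] at h2
    exact mem_iUnion.2 ⟨k, h1, h2⟩
  refine (lintegral_mono_set hcov).trans ((lintegral_iUnion_le _ _).trans ?_)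
  refine ENNReal.tsum_le_tsum fun k => ?_
  have hms : MeasurableSet {y : EE n | 2 ^ k * R ≤ ‖x - y‖ ∧ ‖x - y‖ < 2 ^ (k+1) * R} :=
    (measurableSet_le measurable_const hm).inter (measurableSet_lt hm measurable_const)
  calc _ ≤ ∫⁻ y in {y : EE n | 2 ^ k * R ≤ ‖x - y‖ ∧ ‖x - y‖ < 2 ^ (k+1) * R},
        ENNReal.ofReal ((2 ^ k * R) ^ (n+1))⁻¹ * φ y := by
        refine setLIntegral_mono' hms fun y hy => ?_
        rw [mul_comm]
        gcongr
        exact hy.1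
    _ = ENNReal.ofReal ((2 ^ k * R) ^ (n+1))⁻¹ *
        ∫⁻ y in {y : EE n | 2 ^ k * R ≤ ‖x - y‖ ∧ ‖x - y‖ < 2 ^ (k+1) * R}, φ y :=
        lintegral_const_mul' _ _ ENNReal.ofReal_ne_top
    _ ≤ _ := by
        gcongr
        intro y hy
        rw [Metric.mem_ball, dist_comm, dist_eq_norm]
        exact hy.2

theorem tail_one_le (x : EE n) {R : ℝ} (hR : 0 < R) :
    ∫⁻ y in {y | R ≤ ‖x - y‖}, ENNReal.ofReal (‖x - y‖ ^ (n+1))⁻¹ ≤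
      ENNReal.ofReal (om n * 2 ^ (n+1) * R⁻¹) := by
  have h := tail_le x hR (fun _ => 1)
  simp only [one_mul] at h
  refine h.trans ?_
  have hom := om_pos n
  have : ∀ k : ℕ, ENNReal.ofReal ((2 ^ k * R) ^ (n+1))⁻¹ *
      ∫⁻ y in Metric.ball x (2 ^ (k+1) * R), 1 = ENNReal.ofReal ((om n * 2 ^ n * R⁻¹) * (1/2) ^ k) := by
    intro k
    rw [setLIntegral_one, vol_ball _ (by positivity), ← ENNReal.ofReal_mul (by positivity)]
    congr 1
    rw [pow_succ, mul_pow, mul_pow, pow_succ, mul_pow]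
    have : (2:ℝ) ^ k ≠ 0 := by positivity
    simp only [one_div, inv_pow]
    field_simp
  simp only [this]
  rw [← ENNReal.ofReal_tsum_of_nonneg (fun k => by positivity)
    (summable_geometric_two.mul_left _), tsum_mul_left, tsum_geometric_two]
  refine ENNReal.ofReal_le_ofReal (le_of_eq ?_)
  ring

end vol

section misc

theorem add_sq_le4 (a b : ℝ≥0∞) : (a + b) ^ 2 ≤ 4 * (a ^ 2 + b ^ 2) := by
  rcases le_total a b with h | h
  · calc (a + b) ^ 2 ≤ (b + b) ^ 2 := by gcongr
      _ = 4 * b ^ 2 := by ring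
      _ ≤ _ := by gcongr; exact le_add_self
  · calc (a + b) ^ 2 ≤ (a + a) ^ 2 := by gcongr
      _ = 4 * a ^ 2 := by ring
      _ ≤ _ := by gcongr; exact le_self_add

variable {α : Type*} [MeasurableSpace α] {μ : Measure α}

theorem lintegral_cs_w {f w : α → ℝ≥0∞} (hf : AEMeasurable f μ) (hw : AEMeasurable w μ) :
    (∫⁻ a, f a * w a ∂μ) ^ 2 ≤ (∫⁻ a, f a ^ 2 * w a ∂μ) * ∫⁻ a, w a ∂μ := by
  have h := lintegral_cs μ (hf.mul (hw.pow_const (1/2 : ℝ))) (hw.pow_const (1/2 : ℝ))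
  have e : ∀ a, (w a ^ (1/2 : ℝ)) ^ 2 = w a := by
    intro a
    rw [← ENNReal.rpow_natCast, ← ENNReal.rpow_mul]; norm_num
  have e2 : ∀ a, f a * w a ^ (1/2 : ℝ) * w a ^ (1/2 : ℝ) = f a * w a := by
    intro a
    rw [mul_assoc, ← sq, e]
  simp only [Pi.mul_apply, e2, mul_pow, e] at h
  exact h

theorem pv_int {q : α → ℝ} (hq : Integrable q μ) {v : α → ℝ} (hv : Measurable v) (s : Set ℝ) :
    pv 1 (fun ε => ∫ y in {y | v y ≤ ε}, q y ∂μ) s ≤ ∫⁻ y, ‖q y‖ₑ ∂μ := by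
  refine pv_le' one_pos fun N u hu _ => ?_
  simp only [ENNReal.rpow_one]
  have hm : ∀ c, MeasurableSet {y | v y ≤ c} := fun c => measurableSet_le hv measurable_const
  refine le_trans ?_ (setLIntegral_le_lintegral {y | v y ≤ u N} _)
  induction N with
  | zero => simp
  | succ N ih =>
    rw [Finset.sum_range_succ]
    have hsub : {y | v y ≤ u N} ⊆ {y | v y ≤ u (N+1)} := fun y hy =>
      le_trans hy (hu (Nat.le_succ N))
    have e : (∫ y in {y | v y ≤ u (N+1)}, q y ∂μ) - ∫ y in {y | v y ≤ u N}, q y ∂μ =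
        ∫ y in {y | v y ≤ u (N+1)} \ {y | v y ≤ u N}, q y ∂μ := by
      rw [setIntegral_sdiff (hm _) hq.integrableOn hsub]
    rw [e]
    have e2 : ∫⁻ y in {y | v y ≤ u (N+1)}, ‖q y‖ₑ ∂μ = (∫⁻ y in {y | v y ≤ u N}, ‖q y‖ₑ ∂μ) +
        ∫⁻ y in {y | v y ≤ u (N+1)} \ {y | v y ≤ u N}, ‖q y‖ₑ ∂μ := by
      rw [← lintegral_union ((hm _).diff (hm _)) disjoint_sdiff_right, union_sdiff_cancel hsub]
    rw [e2]
    exact add_le_add ih (enorm_integral_le_lintegral_enorm _)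

end misc

section core
variable {n : ℕ} (ℓ : Fin n)

theorem Kh_le {w : EE n} {t c : ℝ} (hc : 0 < c) (hw : t ≠ 0 → c ≤ ‖w‖) :
    ‖Kr ℓ w * t‖ ≤ (c ^ n)⁻¹ * ‖t‖ := by
  rcases eq_or_ne t 0 with h | h
  · simp [h]
  rw [norm_mul, Real.norm_eq_abs]
  gcongr
  refine (Kr_abs_le ℓ w).trans ?_
  have := hw h
  gcongr

theorem Kh_integrable {h : EE n → ℝ} (hi : Integrable h) {w : EE n → EE n} (hw : Measurable w)
    {c : ℝ} (hc : 0 < c) (hs : ∀ y, h y ≠ 0 → c ≤ ‖w y‖) :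
    Integrable (fun y => Kr ℓ (w y) * h y) := by
  refine Integrable.mono' (hi.norm.const_mul ((c ^ n)⁻¹))
    (((Kr_meas ℓ).comp hw).aestronglyMeasurable.mul hi.aestronglyMeasurable) ?_
  exact Eventually.of_forall fun y => Kh_le ℓ hc (hs y)

/-- shell constant -/
def cS (n : ℕ) : ℝ := om n * n * 3 * 3 ^ (n - 1)

theorem cS_nonneg (n : ℕ) : 0 ≤ cS n := by unfold cS; have := om_pos n; positivity

theorem shell_cs {x : EE n} {r : ℝ} (hr : 0 < r) {h : EE n → ℝ} (hi : Integrable h)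
    (hsup : ∀ y, ‖x - y‖ < 4 * r → h y = 0) (m : ℤ) :
    (∫⁻ y in {y | m - 1 ≤ ⌊‖x - y‖ / r⌋ ∧ ⌊‖x - y‖ / r⌋ ≤ m + 1}, ‖Kr ℓ (x - y) * h y‖ₑ) ^ 2 ≤
      ENNReal.ofReal (cS n * r) *
      ∫⁻ y in {y | m - 1 ≤ ⌊‖x - y‖ / r⌋ ∧ ⌊‖x - y‖ / r⌋ ≤ m + 1},
        ‖h y‖ₑ ^ 2 * ENNReal.ofReal (‖x - y‖ ^ (n+1))⁻¹ := by
  have : NeZero n := ⟨fun h => by subst h; exact ℓ.elim0⟩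
  set S := {y : EE n | m - 1 ≤ ⌊‖x - y‖ / r⌋ ∧ ⌊‖x - y‖ / r⌋ ≤ m + 1} with hS
  have hu : Measurable fun y : EE n => ‖x - y‖ := by fun_prop
  have hSm : MeasurableSet S := by
    have : Measurable fun y : EE n => ⌊‖x - y‖ / r⌋ := (hu.div_const r).floor
    exact (measurableSet_le measurable_const this).inter (measurableSet_le this measurable_const)
  have hSu : ∀ y ∈ S, ((m:ℝ) - 1) * r ≤ ‖x - y‖ ∧ ‖x - y‖ < (m + 2) * r := by
    intro y hy
    obtain ⟨h1, h2⟩ := hy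
    rw [Int.le_floor, le_div_iff₀ hr] at h1
    have h3 := Int.floor_lt.1 (lt_of_le_of_lt h2 (show m + 1 < m + 2 by lia))
    rw [div_lt_iff₀ hr] at h3
    push_cast at h1 h3
    exact ⟨h1, h3⟩
  rcases le_or_gt m 2 with hm | hm
  · have : ∫⁻ y in S, ‖Kr ℓ (x - y) * h y‖ₑ = 0 := by
      rw [setLIntegral_congr_fun hSm (g := fun _ => 0)]
      · simp
      · intro y hy
        have h1 := (hSu y hy).2
        have : h y = 0 := by
          apply hsup
          have : (m:ℝ) ≤ 2 := by exact_mod_cast hm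
          nlinarith
        simp [this]
    rw [this]
    simp
  have hm3 : (3:ℝ) ≤ m := by exact_mod_cast hm
  have hvol : volume S ≤ ENNReal.ofReal (om n * (n * (3 * r) * ((m + 2) * r) ^ (n - 1))) := by
    have := vol_shell x (a := (m - 1) * r) (b := (m + 2) * r) (by nlinarith) (by nlinarith)
    refine (measure_mono hSu).trans (this.trans (le_of_eq ?_))
    congr 5; ring
  have hcs := lintegral_cs (volume.restrict S) (f := fun y => ‖Kr ℓ (x - y) * h y‖ₑ)
    (g := fun _ => 1) (by
      refine AEMeasurable.enorm ?_
      refine AEMeasurable.mul ?_ hi.aestronglyMeasurable.aemeasurable.restrict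
      exact ((Kr_meas ℓ).comp (by fun_prop)).aemeasurable) aemeasurable_const
  simp only [mul_one, one_pow, lintegral_const, Measure.restrict_apply_univ, one_mul] at hcs
  refine hcs.trans ?_
  rw [mul_comm, ← lintegral_const_mul' _ _ ENNReal.ofReal_ne_top]
  by_cases hfin : volume S = ∞
  · exact absurd (hvol.trans_lt ENNReal.ofReal_lt_top) (by simp [hfin])
  rw [← lintegral_const_mul' _ _ hfin]
  refine setLIntegral_mono' hSm fun y hy => ?_
  obtain ⟨h1, h2⟩ := hSu y hy
  have hupos : 0 < ‖x - y‖ := lt_of_lt_of_le (by nlinarith) h1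
  have hK : ‖Kr ℓ (x - y)‖ₑ ^ 2 ≤ ENNReal.ofReal ((‖x - y‖ ^ n)⁻¹ ^ 2) := by
    rw [ENNReal.ofReal_pow (by positivity)]
    gcongr
    rw [← ofReal_norm, Real.norm_eq_abs]
    exact ENNReal.ofReal_le_ofReal (Kr_abs_le ℓ _)
  have hfinal : volume S * ENNReal.ofReal ((‖x - y‖ ^ n)⁻¹ ^ 2) ≤
      ENNReal.ofReal (cS n * r) * ENNReal.ofReal (‖x - y‖ ^ (n+1))⁻¹ := by
    refine (mul_le_mul_left hvol _).trans ?_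
    have hom := om_pos n
    rw [← ENNReal.ofReal_mul (by
        have : (0:ℝ) ≤ (m + 2) * r := by nlinarith
        positivity), ← ENNReal.ofReal_mul (mul_nonneg (cS_nonneg n) hr.le)]
    refine ENNReal.ofReal_le_ofReal ?_
    have hb : ((m:ℝ) + 2) * r ≤ 3 * ‖x - y‖ := by nlinarith
    have hb' : (((m:ℝ) + 2) * r) ^ (n-1) ≤ 3 ^ (n-1) * ‖x - y‖ ^ (n-1) := by
      rw [← mul_pow]
      exact pow_le_pow_left₀ (by nlinarith) hb _
    have e : ‖x - y‖ ^ (n-1) * ((‖x - y‖ ^ n)⁻¹ ^ 2) = (‖x - y‖ ^ (n+1))⁻¹ := by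
      obtain ⟨k, rfl⟩ : ∃ k, n = k + 1 :=
        ⟨n - 1, (Nat.succ_pred_eq_of_ne_zero (NeZero.ne n)).symm⟩
      rw [Nat.add_sub_cancel]
      field_simp
      ring
    calc om n * (n * (3 * r) * ((m + 2) * r) ^ (n - 1)) * ((‖x - y‖ ^ n)⁻¹ ^ 2)
        ≤ om n * (n * (3 * r) * (3 ^ (n-1) * ‖x - y‖ ^ (n-1))) * ((‖x - y‖ ^ n)⁻¹ ^ 2) := by
          gcongr
      _ = om n * (n * (3 * r) * 3 ^ (n-1)) * (‖x - y‖ ^ (n-1) * ((‖x - y‖ ^ n)⁻¹ ^ 2)) := by ring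
      _ = _ := by rw [e]; unfold cS; ring
  calc volume S * ‖Kr ℓ (x - y) * h y‖ₑ ^ 2
      = volume S * ‖Kr ℓ (x - y)‖ₑ ^ 2 * ‖h y‖ₑ ^ 2 := by rw [enorm_mul, mul_pow, mul_assoc]
    _ ≤ volume S * ENNReal.ofReal ((‖x - y‖ ^ n)⁻¹ ^ 2) * ‖h y‖ₑ ^ 2 := by gcongr
    _ ≤ ENNReal.ofReal (cS n * r) * ENNReal.ofReal (‖x - y‖ ^ (n+1))⁻¹ * ‖h y‖ₑ ^ 2 := by gcongr
    _ = _ := by ring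

theorem shell_overlap (u : EE n → ℝ) (hu : Measurable u) (φ : EE n → ℝ≥0∞) :
    ∑' m : ℤ, ∫⁻ y in {y | m - 1 ≤ ⌊u y⌋ ∧ ⌊u y⌋ ≤ m + 1}, φ y ≤ 3 * ∫⁻ y, φ y := by
  set T : ℤ → Set (EE n) := fun m => {y | ⌊u y⌋ = m} with hT
  have hTm : ∀ m, MeasurableSet (T m) := fun m =>
    measurableSet_eq_fun hu.floor measurable_const
  have hsum : ∑' m, ∫⁻ y in T m, φ y ≤ ∫⁻ y, φ y := by
    rw [← lintegral_iUnion hTm]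
    · exact setLIntegral_le_lintegral _ _
    · intro i j hij
      rw [Function.onFun, Set.disjoint_left]
      intro y h1 h2
      exact hij (h1.symm.trans h2)
  have h1 : ∀ m : ℤ, ∫⁻ y in {y | m - 1 ≤ ⌊u y⌋ ∧ ⌊u y⌋ ≤ m + 1}, φ y ≤
      (∫⁻ y in T (m - 1), φ y) + (∫⁻ y in T m, φ y) + ∫⁻ y in T (m + 1), φ y := by
    intro m
    refine le_trans (lintegral_mono_set (t := (T (m-1) ∪ T m) ∪ T (m+1)) ?_) ?_
    · rintro y ⟨h1, h2⟩
      simp only [hT, mem_union, mem_ofPred_eq]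
      omega
    · refine (lintegral_union_le _ _ _).trans (add_le_add (lintegral_union_le _ _ _) le_rfl)
  refine (ENNReal.tsum_le_tsum h1).trans ?_
  rw [ENNReal.tsum_add, ENNReal.tsum_add]
  have e1 : ∑' m : ℤ, ∫⁻ y in T (m - 1), φ y = ∑' m : ℤ, ∫⁻ y in T m, φ y :=
    (Equiv.subRight (1:ℤ)).tsum_eq (fun m => ∫⁻ y in T m, φ y)
  have e2 : ∑' m : ℤ, ∫⁻ y in T (m + 1), φ y = ∑' m : ℤ, ∫⁻ y in T m, φ y :=
    (Equiv.addRight (1:ℤ)).tsum_eq (fun m => ∫⁻ y in T m, φ y)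
  rw [e1, e2]
  calc _ = 3 * ∑' m : ℤ, ∫⁻ y in T m, φ y := by ring
    _ ≤ _ := by gcongr

/-- shell part of the core lemma -/
theorem core_shell {x : EE n} {r : ℝ} (hr : 0 < r) {h : EE n → ℝ} (hi : Integrable h)
    (hsup : ∀ y, ‖x - y‖ < 4 * r → h y = 0) {v : EE n → ℝ} (hv : Measurable v)
    (hvu : ∀ y, h y ≠ 0 → |‖x - y‖ - v y| ≤ r) :
    pv 2 (fun ε => (∫ y in {y | ‖x - y‖ ≤ ε}, Kr ℓ (x - y) * h y) -
      ∫ y in {y | v y ≤ ε}, Kr ℓ (x - y) * h y) univ ^ 2 ≤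
      ENNReal.ofReal (108 * cS n * r) *
      ∫⁻ y, ‖h y‖ₑ ^ 2 * ENNReal.ofReal (‖x - y‖ ^ (n+1))⁻¹ := by
  have hu : Measurable fun y : EE n => ‖x - y‖ := by fun_prop
  set g : EE n → ℝ := fun y => Kr ℓ (x - y) * h y with hg
  have hgi : Integrable g := Kh_integrable ℓ hi (by fun_prop) (by positivity : 0 < 4 * r)
    fun y hy => by by_contra hc; exact hy (hsup y (not_le.1 hc))
  set S : ℤ → Set (EE n) := fun m => {y | m - 1 ≤ ⌊‖x - y‖ / r⌋ ∧ ⌊‖x - y‖ / r⌋ ≤ m + 1} with hS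
  have hSm : ∀ m, MeasurableSet (S m) := by
    intro m
    have : Measurable fun y : EE n => ⌊‖x - y‖ / r⌋ := (hu.div_const r).floor
    exact (measurableSet_le measurable_const this).inter (measurableSet_le this measurable_const)
  set b : ℤ → ℝ≥0∞ := fun m => 2 * ∫⁻ y in S m, ‖g y‖ₑ with hb
  set D : ℝ → ℝ := fun ε => (∫ y in {y | ‖x - y‖ ≤ ε}, g y) - ∫ y in {y | v y ≤ ε}, g y with hD
  have hmu : ∀ c, MeasurableSet {y : EE n | ‖x - y‖ ≤ c} := fun c =>
    measurableSet_le hu measurable_const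
  have hmv : ∀ c, MeasurableSet {y | v y ≤ c} := fun c => measurableSet_le hv measurable_const
  have hloc : ∀ ε, D ε = (∫ y in {y | ‖x - y‖ ≤ ε}, g y ∂(volume.restrict (S ⌊ε / r⌋))) -
      ∫ y in {y | v y ≤ ε}, g y ∂(volume.restrict (S ⌊ε / r⌋)) := by
    intro ε
    have hgS : Integrable g (volume.restrict (S ⌊ε / r⌋)) := hgi.restrict
    rw [hD]
    simp only
    rw [← integral_indicator (hmu ε), ← integral_indicator (hmv ε),
      ← integral_indicator (hmu ε), ← integral_indicator (hmv ε),
      ← integral_sub (hgi.indicator (hmu ε)) (hgi.indicator (hmv ε)),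
      ← integral_sub (hgS.indicator (hmu ε)) (hgS.indicator (hmv ε))]
    symm
    refine setIntegral_eq_integral_of_forall_compl_eq_zero fun y hy => ?_
    by_cases h0 : h y = 0
    · have : g y = 0 := by simp [hg, h0]
      simp [indicator, this]
    have h1 := abs_le.1 (hvu y h0)
    have hiff : ‖x - y‖ ≤ ε ↔ v y ≤ ε := by
      have hf1 := Int.floor_le (ε / r)
      have hf2 := Int.lt_floor_add_one (ε / r)
      rw [le_div_iff₀ hr] at hf1
      rw [div_lt_iff₀ hr] at hf2
      by_contra hcon
      apply hy
      have hlow : ε - r < ‖x - y‖ := by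
        by_contra hc
        apply hcon
        constructor <;> intro <;> linarith [h1.1, h1.2]
      have hup : ‖x - y‖ ≤ ε + r := by
        by_contra hc
        apply hcon
        constructor <;> intro <;> linarith [h1.1, h1.2]
      constructor
      · rw [Int.le_floor, le_div_iff₀ hr]
        push_cast
        linarith
      · rw [← Int.lt_add_one_iff, Int.floor_lt, div_lt_iff₀ hr]
        push_cast
        linarith
    by_cases h2 : ‖x - y‖ ≤ ε
    · simp [indicator, h2, hiff.1 h2]
    · have h3 : ¬ v y ≤ ε := fun h3 => h2 (hiff.2 h3)
      simp [indicator, h2, h3]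
  have hcell := pv_cells (p := 2) two_pos D univ (fun ε => ⌊ε / r⌋)
    (fun a _ b _ hab => Int.floor_le_floor (by gcongr)) b ?_ ?_
  · rw [ENNReal.rpow_two] at hcell
    refine hcell.trans ?_
    have h3 : ∀ m, b m ^ (2:ℝ) ≤ ENNReal.ofReal (4 * cS n * r) * ∫⁻ y in S m, ‖h y‖ₑ ^ 2 *
        ENNReal.ofReal (‖x - y‖ ^ (n+1))⁻¹ := by
      intro m
      rw [ENNReal.rpow_two, hb]
      simp only
      rw [mul_pow]
      refine (mul_le_mul_right (shell_cs ℓ hr hi hsup m) _).trans (le_of_eq ?_)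
      rw [← mul_assoc]
      congr 1
      rw [mul_assoc 4, ENNReal.ofReal_mul (by norm_num : (0:ℝ) ≤ 4)]
      norm_num
    refine (mul_le_mul_right (ENNReal.tsum_le_tsum h3) _).trans ?_
    rw [ENNReal.tsum_mul_left]
    refine (mul_le_mul_right (mul_le_mul_right (shell_overlap _ (hu.div_const r) _) _) _).trans
      (le_of_eq ?_)
    have : (3 : ℝ≥0∞) = ENNReal.ofReal 3 := by norm_num
    have hc := cS_nonneg n
    rw [← mul_assoc, ← mul_assoc, this, ← ENNReal.ofReal_mul (by positivity),
      ← ENNReal.ofReal_mul (by positivity)]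
    congr 2
    norm_num
    ring
  · intro m
    refine (pv_anti_exp one_pos one_le_two _ _).trans ?_
    have hgS : Integrable g (volume.restrict (S m)) := hgi.restrict
    have e : pv 1 D {t ∈ univ | ⌊t / r⌋ = m} = pv 1 (fun ε =>
      (∫ y in {y | ‖x - y‖ ≤ ε}, g y ∂(volume.restrict (S m))) -
      ∫ y in {y | v y ≤ ε}, g y ∂(volume.restrict (S m))) {t ∈ univ | ⌊t / r⌋ = m} := by
      refine pv_congr fun t ht t' ht' _ => ?_
      have h1 := ht.2
      have h2 := ht'.2
      rw [hloc t, hloc t', h1, h2]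
    rw [e]
    refine (pv_sub_le le_rfl _ _ _).trans ((add_le_add (pv_int hgS hu _) (pv_int hgS hv _)).trans ?_)
    simp only [hb]
    rw [two_mul]
  · intro t _
    have hgS : Integrable g (volume.restrict (S ⌊t / r⌋)) := hgi.restrict
    rw [hloc t, sub_eq_add_neg]
    refine (enorm_add_le _ _).trans ?_
    rw [enorm_neg, hb]
    simp only
    rw [two_mul]
    exact add_le_add ((enorm_integral_le_lintegral_enorm _).trans (setLIntegral_le_lintegral _ _))
      ((enorm_integral_le_lintegral_enorm _).trans (setLIntegral_le_lintegral _ _))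

/-- constant of the core lemma -/
def cC (n : ℕ) : ℝ := 4 * (108 * cS n + cK n ^ 2 * (om n * 2 ^ (n+1)))

theorem cC_nonneg (n : ℕ) : 0 ≤ cC n := by
  unfold cC; have := om_pos n; have := cS_nonneg n; have := cK_pos n; positivity

theorem core {x : EE n} {r : ℝ} (hr : 0 < r) {h : EE n → ℝ} (hi : Integrable h)
    (hsup : ∀ y, ‖x - y‖ < 4 * r → h y = 0) {z : EE n → EE n} (hz : Measurable z)
    (hzx : ∀ y, h y ≠ 0 → ‖x - y - z y‖ ≤ r) :
    pv 2 (fun ε => (∫ y in {y | ‖x - y‖ ≤ ε}, Kr ℓ (x - y) * h y) -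
      ∫ y in {y | ‖z y‖ ≤ ε}, Kr ℓ (z y) * h y) univ ^ 2 ≤
      ENNReal.ofReal (cC n * r) *
      ∫⁻ y, ‖h y‖ₑ ^ 2 * ENNReal.ofReal (‖x - y‖ ^ (n+1))⁻¹ := by
  set J := ∫⁻ y, ‖h y‖ₑ ^ 2 * ENNReal.ofReal (‖x - y‖ ^ (n+1))⁻¹ with hJ
  have hu : Measurable fun y : EE n => ‖x - y‖ := by fun_prop
  have hne : ∀ y, h y ≠ 0 → 4 * r ≤ ‖x - y‖ := fun y hy => by
    by_contra hc; exact hy (hsup y (not_le.1 hc))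
  have hvu : ∀ y, h y ≠ 0 → |‖x - y‖ - ‖z y‖| ≤ r := fun y hy =>
    (abs_norm_sub_norm_le _ _).trans (hzx y hy)
  have hg1 : Integrable (fun y => Kr ℓ (x - y) * h y) :=
    Kh_integrable ℓ hi (by fun_prop) (by positivity : 0 < 4 * r) hne
  have hg2 : Integrable (fun y => Kr ℓ (z y) * h y) :=
    Kh_integrable ℓ hi hz hr fun y hy => by
      have h1 := (abs_le.1 (hvu y hy)).2
      have h2 := hne y hy
      linarith
  set q : EE n → ℝ := fun y => Kr ℓ (x - y) * h y - Kr ℓ (z y) * h y with hq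
  have hqi : Integrable q := hg1.sub hg2
  have e : (fun ε => (∫ y in {y | ‖x - y‖ ≤ ε}, Kr ℓ (x - y) * h y) -
      ∫ y in {y | ‖z y‖ ≤ ε}, Kr ℓ (z y) * h y) = fun ε =>
      ((∫ y in {y | ‖x - y‖ ≤ ε}, Kr ℓ (x - y) * h y) -
      ∫ y in {y | ‖z y‖ ≤ ε}, Kr ℓ (x - y) * h y) + ∫ y in {y | ‖z y‖ ≤ ε}, q y := by
    ext ε
    rw [hq, integral_sub hg1.integrableOn hg2.integrableOn]
    ring
  have h1 := core_shell ℓ hr hi hsup hz.norm hvu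
  have h2 : (∫⁻ y, ‖q y‖ₑ) ^ 2 ≤ ENNReal.ofReal (cK n ^ 2 * (om n * 2 ^ (n+1)) * r) * J := by
    have hset : MeasurableSet {y : EE n | 4 * r ≤ ‖x - y‖} := measurableSet_le measurable_const hu
    have hcKp := cK_pos n
    have hqle : ∫⁻ y, ‖q y‖ₑ ≤ ∫⁻ y in {y : EE n | 4 * r ≤ ‖x - y‖},
        ENNReal.ofReal (cK n * r) * (‖h y‖ₑ * ENNReal.ofReal (‖x - y‖ ^ (n+1))⁻¹) := by
      rw [← lintegral_indicator hset]
      refine lintegral_mono fun y => ?_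
      by_cases hy : h y = 0
      · simp [hq, hy]
      have h4 := hne y hy
      rw [indicator_of_mem (show y ∈ {y : EE n | 4 * r ≤ ‖x - y‖} from h4)]
      have h5 : q y = (Kr ℓ (x - y) - Kr ℓ (z y)) * h y := by simp only [hq]; ring
      rw [h5, enorm_mul, mul_comm ‖h y‖ₑ, ← mul_assoc]
      gcongr
      have hpos : 0 < ‖x - y‖ := by linarith
      rw [← ENNReal.ofReal_mul (by positivity), ← ofReal_norm, Real.norm_eq_abs]
      refine ENNReal.ofReal_le_ofReal ?_
      refine (Kr_sub_le ℓ (norm_pos_iff.1 hpos) ((hzx y hy).trans (by linarith))).trans ?_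
      rw [div_eq_mul_inv]
      have := hzx y hy
      gcongr
    rw [lintegral_const_mul' _ _ ENNReal.ofReal_ne_top] at hqle
    refine (pow_le_pow_left' hqle 2).trans ?_
    rw [mul_pow]
    have hcs := lintegral_cs_w (μ := volume.restrict {y : EE n | 4 * r ≤ ‖x - y‖})
      (f := fun y => ‖h y‖ₑ) (w := fun y => ENNReal.ofReal (‖x - y‖ ^ (n+1))⁻¹)
      hi.aestronglyMeasurable.aemeasurable.enorm.restrict
      ((hu.pow_const _).inv.ennreal_ofReal.aemeasurable)
    refine (mul_le_mul_right (hcs.trans (mul_le_mul' (setLIntegral_le_lintegral _ _)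
      (tail_one_le x (by positivity)))) _).trans ?_
    have hom := om_pos n
    rw [← hJ, mul_comm J, ← mul_assoc, ← ENNReal.ofReal_pow (by positivity),
      ← ENNReal.ofReal_mul (by positivity)]
    refine mul_le_mul_left (ENNReal.ofReal_le_ofReal ?_) _
    rw [show (cK n * r) ^ 2 * (om n * 2 ^ (n + 1) * (4 * r)⁻¹) =
      cK n ^ 2 * (om n * 2 ^ (n + 1)) * r * (1/4) by field_simp]
    have : 0 ≤ cK n ^ 2 * (om n * 2 ^ (n + 1)) * r := by positivity
    linarith
  rw [e]
  refine (pow_le_pow_left' (pv_add_le one_le_two _ _ _) 2).trans ((add_sq_le4 _ _).trans ?_)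
  have h3 : pv 2 (fun ε => ∫ y in {y | ‖z y‖ ≤ ε}, q y) univ ≤ ∫⁻ y, ‖q y‖ₑ :=
    (pv_anti_exp one_pos one_le_two _ _).trans (pv_int hqi hz.norm _)
  refine (mul_le_mul_right (add_le_add h1 ((pow_le_pow_left' h3 2).trans h2)) _).trans
    (le_of_eq ?_)
  have := om_pos n; have := cS_nonneg n; have := cK_pos n
  have h4 : (4 : ℝ≥0∞) = ENNReal.ofReal 4 := by norm_num
  rw [← hJ, ← add_mul, ← ENNReal.ofReal_add (by positivity) (by positivity), ← mul_assoc, h4,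
    ← ENNReal.ofReal_mul (by norm_num)]
  congr 2
  unfold cC; ring

end core

/-! ### Part C: local estimates -/

section loc
variable {n : ℕ} (ℓ : Fin n)

/-- truncated integral over the annulus `R < |x-y| ≤ ε` -/
def Fl (R : ℝ) (h : EE n → ℝ) (x : EE n) (ε : ℝ) : ℝ :=
  ∫ y in {y : EE n | R < ‖x - y‖ ∧ ‖x - y‖ ≤ ε}, Kr ℓ (x - y) * h y

theorem meas_nrm (x : EE n) : Measurable fun y : EE n => ‖x - y‖ := by fun_prop

theorem meas_ann (x : EE n) (R S : ℝ) : MeasurableSet {y : EE n | R < ‖x - y‖ ∧ ‖x - y‖ ≤ S} :=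
  (measurableSet_lt measurable_const (meas_nrm x)).inter
    (measurableSet_le (meas_nrm x) measurable_const)

theorem ann_sub_ball (x : EE n) {R S T : ℝ} (h : S < T) :
    {y : EE n | R < ‖x - y‖ ∧ ‖x - y‖ ≤ S} ⊆ Metric.ball x T := by
  intro y hy
  rw [Metric.mem_ball, dist_comm, dist_eq_norm]
  exact hy.2.trans_lt h

theorem ann_integrable {R S : ℝ} (hR : 0 < R) {h : EE n → ℝ} {x : EE n}
    (hi : IntegrableOn h {y : EE n | R < ‖x - y‖ ∧ ‖x - y‖ ≤ S}) :
    IntegrableOn (fun y => Kr ℓ (x - y) * h y) {y : EE n | R < ‖x - y‖ ∧ ‖x - y‖ ≤ S} := by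
  refine Integrable.mono' (hi.norm.const_mul ((R ^ n)⁻¹))
    (((Kr_meas ℓ).comp (by fun_prop)).aestronglyMeasurable.mul hi.aestronglyMeasurable) ?_
  filter_upwards [ae_restrict_mem (meas_ann x R S)] with y hy
  exact Kh_le ℓ hR fun _ => hy.1.le

theorem memLp_intOn {h : EE n → ℝ} (hm : MemLp h 2) (x : EE n) (r : ℝ) :
    IntegrableOn h (Metric.ball x r) := by
  have : IsFiniteMeasure (volume.restrict (Metric.ball x r)) :=
    ⟨by simpa using measure_ball_lt_top⟩
  exact (hm.restrict _).integrable one_le_two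

theorem Fl_eq {R S : ℝ} (h : EE n → ℝ) (x : EE n) {ε : ℝ} (hε : ε ≤ S) :
    Fl ℓ R h x ε = ∫ y in {y | ‖x - y‖ ≤ ε},
      ({y : EE n | R < ‖x - y‖ ∧ ‖x - y‖ ≤ S}.indicator (fun y => Kr ℓ (x - y) * h y)) y := by
  rw [setIntegral_indicator (meas_ann x R S), Fl]
  congr 2
  ext y
  simp only [mem_ofPred_eq, mem_inter_iff]
  constructor
  · rintro ⟨h1, h2⟩; exact ⟨h2, h1, h2.trans hε⟩
  · rintro ⟨h1, h2, _⟩; exact ⟨h2, h1⟩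

/-- constant of trivial estimate -/
def cT (n : ℕ) : ℝ := om n * 4 ^ n

theorem cT_pos (n : ℕ) : 0 < cT n := by unfold cT; have := om_pos n; positivity

theorem triv_est {R : ℝ} (hR : 0 < R) {h : EE n → ℝ} (hm : MemLp h 2) (x : EE n) :
    pv 1 (Fl ℓ R h x) (Icc R (2 * R)) ^ 2 ≤
      ENNReal.ofReal (cT n * (R ^ n)⁻¹) * ∫⁻ y in Metric.ball x (4 * R), ‖h y‖ₑ ^ 2 := by
  set A := {y : EE n | R < ‖x - y‖ ∧ ‖x - y‖ ≤ 2 * R} with hA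
  have hAm : MeasurableSet A := meas_ann x R (2 * R)
  have hAb : A ⊆ Metric.ball x (4 * R) := ann_sub_ball x (by linarith)
  have hI : Integrable (A.indicator (fun y => Kr ℓ (x - y) * h y)) :=
    (integrable_indicator_iff hAm).2 (ann_integrable ℓ hR ((memLp_intOn hm x (4*R)).mono_set hAb))
  have h1 : pv 1 (Fl ℓ R h x) (Icc R (2 * R)) ≤
      ∫⁻ y, ‖(A.indicator (fun y => Kr ℓ (x - y) * h y)) y‖ₑ := by
    refine le_trans (le_of_eq ?_) (pv_int hI (meas_nrm x) (Icc R (2 * R)))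
    refine pv_congr fun t ht t' ht' _ => ?_
    rw [Fl_eq ℓ h x ht.2, Fl_eq ℓ h x ht'.2]
  have h2 : ∫⁻ y, ‖(A.indicator (fun y => Kr ℓ (x - y) * h y)) y‖ₑ ≤
      ENNReal.ofReal ((R ^ n)⁻¹) * ∫⁻ y in Metric.ball x (4 * R), ‖h y‖ₑ * 1 := by
    rw [← lintegral_const_mul' _ _ ENNReal.ofReal_ne_top,
      ← lintegral_indicator measurableSet_ball]
    refine lintegral_mono fun y => ?_
    by_cases hy : y ∈ A
    · rw [indicator_of_mem hy, indicator_of_mem (hAb hy), mul_one, ← ofReal_norm, ← ofReal_norm,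
        ← ENNReal.ofReal_mul (by positivity)]
      exact ENNReal.ofReal_le_ofReal (Kh_le ℓ hR fun _ => hy.1.le)
    · simp [indicator_of_notMem hy]
  refine (pow_le_pow_left' (h1.trans h2) 2).trans ?_
  rw [mul_pow]
  have hcs := lintegral_cs (volume.restrict (Metric.ball x (4 * R))) (f := fun y => ‖h y‖ₑ)
    (g := fun _ => 1) hm.aestronglyMeasurable.aemeasurable.enorm.restrict aemeasurable_const
  refine (mul_le_mul_right hcs _).trans (le_of_eq ?_)
  simp only [one_pow, lintegral_const, Measure.restrict_apply_univ, one_mul]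
  have := om_pos n
  rw [vol_ball _ (by positivity), mul_comm (∫⁻ y in Metric.ball x (4 * R), ‖h y‖ₑ ^ 2),
    ← mul_assoc, ← ENNReal.ofReal_pow (by positivity), ← ENNReal.ofReal_mul (by positivity)]
  congr 2
  unfold cT
  rw [mul_pow]
  field_simp

/-! cubes -/

/-- index of the cube of side `d` -/
def cub (d : ℝ) (y : EE n) : Fin n → ℤ := fun i => ⌊y i / d⌋

/-- lower-left corner -/
def cor (d : ℝ) (y : EE n) : EE n := WithLp.toLp 2 fun i => d * (⌊y i / d⌋ : ℝ)

theorem cub_meas (d : ℝ) : Measurable (cub (n := n) d) := by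
  refine measurable_pi_lambda _ fun i => ?_
  have : Measurable fun y : EE n => y i / d := by fun_prop
  exact this.floor

/-- sigma algebra generated by the cubes of side `d` -/
def sig (n : ℕ) (d : ℝ) : MeasurableSpace (EE n) := MeasurableSpace.comap (cub d) ⊤

theorem sig_le (d : ℝ) : sig n d ≤ (inferInstance : MeasurableSpace (EE n)) := by
  rw [sig]
  have : (⊤ : MeasurableSpace (Fin n → ℤ)) ≤ MeasurableSpace.pi := by
    intro s _
    exact (Set.to_countable s).measurableSet
  exact (MeasurableSpace.comap_mono this).trans (cub_meas d).comap_le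

theorem sig_meas_fun {β : Type*} [MeasurableSpace β] (d : ℝ) (φ : (Fin n → ℤ) → β) :
    Measurable[sig n d] (fun y => φ (cub d y)) := by
  intro s _
  exact ⟨φ ⁻¹' s, trivial, rfl⟩

theorem sig_mono {d : ℝ} : sig n (2 * d) ≤ sig n d := by
  rintro _ ⟨t, _, rfl⟩
  have e : cub (n := n) (2 * d) = fun y => (fun k i => k i / 2 : (Fin n → ℤ) → (Fin n → ℤ)) (cub d y) := by
    ext y i
    simp only [cub]
    rw [mul_comm 2 d, ← div_div]
    have := Int.floor_div_natCast (y i / d) 2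
    push_cast at this
    exact this
  rw [e]
  exact ⟨(fun k i => k i / 2 : (Fin n → ℤ) → (Fin n → ℤ)) ⁻¹' t, trivial, rfl⟩

theorem sig_const {d : ℝ} {h : EE n → ℝ} (hh : Measurable[sig n d] h) {y y' : EE n}
    (e : cub d y = cub d y') : h y = h y' := by
  obtain ⟨t, _, ht⟩ := hh (measurableSet_singleton (h y'))
  have h1 : y' ∈ cub d ⁻¹' t := by rw [ht]; rfl
  have h2 : y ∈ cub d ⁻¹' t := by
    change cub d y ∈ t
    rw [e]; exact h1
  rw [ht] at h2
  exact h2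

theorem cor_dist {d : ℝ} (hd : 0 < d) (y : EE n) : ‖y - cor d y‖ ≤ n * d := by
  have h : ‖y - cor d y‖ ^ 2 ≤ (n * d) ^ 2 := by
    rw [EuclideanSpace.norm_sq_eq]
    calc ∑ i, ‖(y - cor d y) i‖ ^ 2 ≤ ∑ i : Fin n, d ^ 2 := by
          refine Finset.sum_le_sum fun i _ => ?_
          have e : (y - cor d y) i = d * Int.fract (y i / d) := by
            rw [PiLp.sub_apply]
            simp only [cor, Int.fract]
            field_simp
          rw [e, Real.norm_eq_abs, abs_of_nonneg (by have := Int.fract_nonneg (y i / d); positivity)]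
          have := Int.fract_lt_one (y i / d)
          have := Int.fract_nonneg (y i / d)
          refine pow_le_pow_left₀ (by positivity) ?_ 2
          nlinarith
      _ = n * d ^ 2 := by simp
      _ ≤ (n * d) ^ 2 := by
          rw [mul_pow]
          gcongr
          rcases Nat.eq_zero_or_pos n with rfl | hn
          · simp
          · have : (1:ℝ) ≤ n := by exact_mod_cast hn
            nlinarith
  exact le_of_sq_le_sq h (by positivity)

/-- orthogonality to cube functions -/
def Perp (d : ℝ) (h : EE n → ℝ) : Prop :=
  ∀ φ : EE n → ℝ, Measurable[sig n d] φ → MemLp φ 2 → ∫ y, φ y * h y = 0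

/-- constant of the fine estimate -/
def cF (n : ℕ) : ℝ := cT n * 10 * n + cC n * n * 4 ^ (n+1)

theorem cF_nonneg (n : ℕ) : 0 ≤ cF n := by
  unfold cF; have := cT_pos n; have := cC_nonneg n; positivity

theorem fine_est {R d : ℝ} (hR : 0 < R) (hd : 0 < d) {h : EE n → ℝ} (hm : MemLp h 2)
    (hp : Perp d h) (x : EE n) :
    pv 2 (Fl ℓ R h x) (Icc R (2 * R)) ^ 2 ≤
      ENNReal.ofReal (cF n * (d / R) * (R ^ n)⁻¹) * ∫⁻ y in Metric.ball x (4 * R), ‖h y‖ₑ ^ 2 := by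
  have hn : (0:ℝ) < n := by exact_mod_cast ℓ.pos
  have hcC := cC_nonneg n
  have hcT := cT_pos n
  rcases le_or_gt (R / 10) (n * d) with hdR | hdR
  · refine (pow_le_pow_left' (pv_anti_exp one_pos one_le_two _ _) 2).trans
      ((triv_est ℓ hR hm x).trans ?_)
    refine mul_le_mul_left (ENNReal.ofReal_le_ofReal ?_) _
    have h1 : 1 ≤ 10 * n * (d / R) := by
      rw [mul_div_assoc', le_div_iff₀ hR]; linarith
    gcongr
    unfold cF
    have h2 : 0 ≤ cC n * n * 4 ^ (n+1) * (d / R) := by positivity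
    nlinarith
  set δ := n * d with hδ
  have hδ0 : 0 < δ := by positivity
  set A := {y : EE n | R / 2 < ‖x - cor d y‖ ∧ ‖x - cor d y‖ ≤ 3 * R} with hA
  -- the corner as a function of the cube index
  set κ : (Fin n → ℤ) → EE n := fun k => WithLp.toLp 2 fun i => d * (k i : ℝ) with hκ
  have hcorκ : ∀ y : EE n, cor d y = κ (cub d y) := fun y => rfl
  have hcor : Measurable (cor (n := n) d) :=
    (sig_meas_fun d κ).mono (sig_le d) le_rfl
  have hAm : MeasurableSet A :=
    (measurableSet_lt measurable_const (measurable_const.sub hcor).norm).inter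
      (measurableSet_le (measurable_const.sub hcor).norm measurable_const)
  have hdist : ∀ y : EE n, |‖x - y‖ - ‖x - cor d y‖| ≤ δ := by
    intro y
    refine (abs_norm_sub_norm_le _ _).trans ?_
    rw [show x - y - (x - cor d y) = -(y - cor d y) by abel, norm_neg]
    exact cor_dist hd y
  have hAlow : ∀ y ∈ A, 4 * δ ≤ ‖x - y‖ ∧ R / 4 ≤ ‖x - y‖ ∧ ‖x - y‖ < 4 * R := by
    intro y hy
    have h1 := abs_le.1 (hdist y)
    have h2 := hy.1
    have h3 := hy.2
    refine ⟨?_, ?_, ?_⟩ <;> linarith [h1.1, h1.2]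
  have hAball : A ⊆ Metric.ball x (4 * R) := fun y hy => by
    rw [Metric.mem_ball, dist_comm, dist_eq_norm]
    exact (hAlow y hy).2.2
  set h' := A.indicator h with hh'
  have hi' : Integrable h' := (integrable_indicator_iff hAm).2
    ((memLp_intOn hm x (4*R)).mono_set hAball)
  have hcore := core ℓ (x := x) hδ0 hi' (z := fun y => x - cor d y)
    (fun y hy => by
      by_contra hc
      have : y ∈ A := by
        by_contra hA'
        exact hc (indicator_of_notMem hA' h)
      linarith [(hAlow y this).1])
    (measurable_const.sub hcor)
    (fun y _ => by
      rw [show x - y - (x - cor d y) = -(y - cor d y) by abel, norm_neg]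
      exact cor_dist hd y)
  have hzero : ∀ ε : ℝ, ∫ y in {y | ‖x - cor d y‖ ≤ ε}, Kr ℓ (x - cor d y) * h' y = 0 := by
    intro ε
    set φ0 : EE n → ℝ := fun c =>
      if ‖x - c‖ ≤ ε ∧ R / 2 < ‖x - c‖ ∧ ‖x - c‖ ≤ 3 * R then Kr ℓ (x - c) else 0 with hφ0
    have hφm : Measurable[sig n d] (fun y => φ0 (cor d y)) := sig_meas_fun d (fun k => φ0 (κ k))
    have hφb : ∀ y, ‖φ0 (cor d y)‖ ≤ (Metric.ball x (4 * R)).indicator (fun _ => ((R/2) ^ n)⁻¹) y := by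
      intro y
      simp only [hφ0]
      split_ifs with hc
      · rw [indicator_of_mem (hAball hc.2), Real.norm_eq_abs]
        refine (Kr_abs_le ℓ _).trans ?_
        have := hc.2.1.le
        gcongr
      · rw [norm_zero]
        exact indicator_nonneg (fun _ _ => by positivity) _
    have hφL : MemLp (fun y => φ0 (cor d y)) 2 := by
      refine MemLp.mono' (g := (Metric.ball x (4 * R)).indicator (fun _ => ((R/2) ^ n)⁻¹))
        (memLp_indicator_const 2 measurableSet_ball _ (Or.inr measure_ball_lt_top.ne))
        ((hφm.mono (sig_le d) le_rfl).aestronglyMeasurable) (Eventually.of_forall hφb)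
    have hs : MeasurableSet {y : EE n | ‖x - cor d y‖ ≤ ε} :=
      measurableSet_le (measurable_const.sub hcor).norm measurable_const
    rw [← hp _ hφm hφL, ← integral_indicator hs]
    congr 1
    ext y
    simp only [hh', hφ0, indicator, mem_ofPred_eq, hA]
    by_cases h1 : ‖x - cor d y‖ ≤ ε <;> by_cases h2 : R / 2 < ‖x - cor d y‖ ∧ ‖x - cor d y‖ ≤ 3 * R <;>
      simp [h1, h2]
  have hle : pv 2 (Fl ℓ R h x) (Icc R (2 * R)) ≤ pv 2 (fun ε =>
      (∫ y in {y | ‖x - y‖ ≤ ε}, Kr ℓ (x - y) * h' y) -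
      ∫ y in {y | ‖x - cor d y‖ ≤ ε}, Kr ℓ (x - cor d y) * h' y) univ := by
    refine le_trans (le_of_eq ?_) (pv_mono_set (subset_univ (Icc R (2 * R))))
    refine pv_congr fun t ht t' ht' htt => ?_
    simp only [hzero, sub_zero]
    have hg1 : Integrable (fun y => Kr ℓ (x - y) * h' y) :=
      Kh_integrable ℓ hi' (by fun_prop) (by positivity : 0 < 4 * δ) fun y hy => by
        by_contra hc
        exact hy (indicator_of_notMem (fun hA' => hc (hAlow y hA').1) h)
    have hsplit : ∀ t ∈ Icc R (2 * R), ∫ y in {y | ‖x - y‖ ≤ t}, Kr ℓ (x - y) * h' y =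
        (∫ y in {y | ‖x - y‖ ≤ R}, Kr ℓ (x - y) * h' y) + Fl ℓ R h x t := by
      intro t ht
      have e : {y : EE n | ‖x - y‖ ≤ t} = {y | ‖x - y‖ ≤ R} ∪
          {y : EE n | R < ‖x - y‖ ∧ ‖x - y‖ ≤ t} := by
        ext y
        simp only [mem_ofPred_eq, mem_union]
        constructor
        · intro h1
          rcases le_or_gt ‖x - y‖ R with h2 | h2
          · exact Or.inl h2
          · exact Or.inr ⟨h2, h1⟩
        · rintro (h1 | h1)
          · exact h1.trans ht.1
          · exact h1.2
      rw [e, setIntegral_union _ (meas_ann x R t) hg1.integrableOn hg1.integrableOn]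
      · congr 1
        refine setIntegral_congr_fun (meas_ann x R t) fun y hy => ?_
        have : y ∈ A := by
          have h1 := abs_le.1 (hdist y)
          have h2 := hy.1
          have h3 := hy.2
          have h4 := ht.2
          exact ⟨by linarith [h1.1, h1.2], by linarith [h1.1, h1.2]⟩
        simp only [hh', indicator_of_mem this]
      · rw [Set.disjoint_left]
        intro y h1 h2
        exact absurd h2.1 (not_lt.2 h1)
    rw [hsplit t ht, hsplit t' ht']
    ring
  refine (pow_le_pow_left' hle 2).trans (hcore.trans ?_)
  have hJ : ∫⁻ y, ‖h' y‖ₑ ^ 2 * ENNReal.ofReal (‖x - y‖ ^ (n+1))⁻¹ ≤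
      ENNReal.ofReal ((R/4) ^ (n+1))⁻¹ * ∫⁻ y in Metric.ball x (4 * R), ‖h y‖ₑ ^ 2 := by
    rw [← lintegral_const_mul' _ _ ENNReal.ofReal_ne_top, ← lintegral_indicator measurableSet_ball]
    refine lintegral_mono fun y => ?_
    by_cases hy : y ∈ A
    · rw [indicator_of_mem (hAball hy), hh', indicator_of_mem hy, mul_comm]
      have := (hAlow y hy).2.1
      gcongr
    · simp [hh', indicator_of_notMem hy]
  refine (mul_le_mul_right hJ _).trans ?_
  rw [← mul_assoc, ← ENNReal.ofReal_mul (by positivity)]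
  refine mul_le_mul_left (ENNReal.ofReal_le_ofReal ?_) _
  unfold cF
  calc cC n * δ * ((R / 4) ^ (n + 1))⁻¹ = (cC n * n * 4 ^ (n + 1)) * (d / R) * (R ^ n)⁻¹ := by
        rw [div_pow, hδ, pow_succ R]; field_simp
    _ ≤ _ := by
        gcongr
        have : 0 ≤ cT n * 10 * n := by positivity
        linarith

end loc

section coarse
variable {n : ℕ} (ℓ : Fin n)

theorem odd_int (x : EE n) {g : EE n → ℝ} (hg : ∀ z, g (-z) = - g z) : ∫ y, g (x - y) = 0 := by
  rw [integral_sub_left_eq_self (fun y => g y)]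
  have h := integral_neg_eq_self g (volume : Measure (EE n))
  simp only [hg, integral_neg] at h
  linarith

theorem odd_ann (x : EE n) {A : Set ℝ} (hA : MeasurableSet A) (c : ℝ) :
    ∫ y in {y : EE n | ‖x - y‖ ∈ A}, Kr ℓ (x - y) * c = 0 := by
  have hs : MeasurableSet {y : EE n | ‖x - y‖ ∈ A} := meas_nrm x hA
  rw [← integral_indicator hs]
  have := odd_int x (g := fun z => {z : EE n | ‖z‖ ∈ A}.indicator (fun z => Kr ℓ z * c) z) (by
    intro z
    by_cases hz : ‖z‖ ∈ A
    · rw [indicator_of_mem (by simpa using hz), indicator_of_mem (by simpa using hz), Kr_neg]; ring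
    · rw [indicator_of_notMem (by simpa using hz), indicator_of_notMem (by simpa using hz)]; simp)
  rw [← this]
  rfl

theorem tonelli_ball {R : ℝ} (hR : 0 < R) {w : EE n → ℝ≥0∞} (hw : Measurable w) :
    Measurable (fun x : EE n => ∫⁻ y in Metric.ball x R, w y) ∧
    ∫⁻ x : EE n, ∫⁻ y in Metric.ball x R, w y = ENNReal.ofReal (om n * R ^ n) * ∫⁻ y, w y := by
  have hS : MeasurableSet {p : EE n × EE n | dist p.2 p.1 < R} :=
    measurableSet_lt (by fun_prop) measurable_const
  have hJ : Measurable fun p : EE n × EE n =>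
      {p : EE n × EE n | dist p.2 p.1 < R}.indicator (fun p => w p.2) p :=
    (hw.comp measurable_snd).indicator hS
  have e : ∀ x : EE n, ∫⁻ y in Metric.ball x R, w y =
      ∫⁻ y, {p : EE n × EE n | dist p.2 p.1 < R}.indicator (fun p => w p.2) (x, y) := by
    intro x
    rw [← lintegral_indicator measurableSet_ball]
    rfl
  simp only [e]
  refine ⟨hJ.lintegral_prod_right', ?_⟩
  rw [lintegral_lintegral_swap hJ.aemeasurable]
  have e2 : ∀ y : EE n, ∫⁻ x, {p : EE n × EE n | dist p.2 p.1 < R}.indicator (fun p => w p.2) (x, y)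
      = ENNReal.ofReal (om n * R ^ n) * w y := by
    intro y
    have : ∀ x : EE n, {p : EE n × EE n | dist p.2 p.1 < R}.indicator (fun p => w p.2) (x, y) =
        (Metric.ball y R).indicator (fun _ => w y) x := by
      intro x
      simp only [indicator, mem_ofPred_eq, Metric.mem_ball, dist_comm]
    simp only [this]
    rw [lintegral_indicator_const measurableSet_ball, vol_ball _ hR, mul_comm]
  simp only [e2]
  rw [lintegral_const_mul _ hw]

/-- the slab -/
def slab (n : ℕ) (i : Fin n) (d β θ : ℝ) : Set (EE n) :=
  {y | β ≤ Int.fract (y i / d) ∧ Int.fract (y i / d) < β + θ}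

theorem slab_meas (i : Fin n) (d β θ : ℝ) : MeasurableSet (slab n i d β θ) := by
  have h : Measurable fun y : EE n => Int.fract (y i / d) := by
    have : Measurable fun y : EE n => y i / d := by fun_prop
    exact this.fract
  exact (measurableSet_le measurable_const h).inter (measurableSet_lt h measurable_const)

theorem slab_le (i : Fin n) {d β θ : ℝ} (hd : 0 < d) (hβ : 0 ≤ β) (hθ : 0 < θ) (hθ1 : θ ≤ 1)
    {h : EE n → ℝ} (hh : Measurable[sig n d] h) :
    ∫⁻ y in slab n i d β θ, ‖h y‖ₑ ^ 2 ≤ ENNReal.ofReal (2 * θ) * ∫⁻ y, ‖h y‖ₑ ^ 2 := by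
  classical
  have hm : Measurable h := hh.mono (sig_le d) le_rfl
  set K := ⌊1 / θ⌋₊ with hK
  have hKle : (K : ℝ) ≤ 1 / θ := Nat.floor_le (by positivity)
  have hKlt : 1 / θ < K + 1 := Nat.lt_floor_add_one _
  have h1θ : 1 ≤ 1 / θ := by rw [le_div_iff₀ hθ]; linarith
  have hK1 : (1:ℝ) ≤ K := by
    have : 1 ≤ K := Nat.le_floor (by simpa using h1θ)
    exact_mod_cast this
  have hKθ : 1 ≤ 2 * θ * K := by
    rw [div_lt_iff₀ hθ] at hKlt; nlinarith
  -- each translate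
  have htr : ∀ k ∈ Finset.range K, ∫⁻ y in slab n i d β θ, ‖h y‖ₑ ^ 2 ≤
      ∫⁻ y in slab n i d (k * θ) θ, ‖h y‖ₑ ^ 2 := by
    intro k hk
    have hk1 : ((k:ℝ) + 1) * θ ≤ 1 := by
      have : (k:ℝ) + 1 ≤ K := by exact_mod_cast Finset.mem_range.1 hk
      calc ((k:ℝ) + 1) * θ ≤ (1 / θ) * θ := by gcongr; linarith
        _ = 1 := by field_simp
    rw [← lintegral_indicator (slab_meas ..), ← lintegral_indicator (slab_meas ..)]
    set v : EE n := EuclideanSpace.single i ((k * θ - β) * d) with hv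
    rw [← lintegral_add_right_eq_self
      (fun y => (slab n i d (k * θ) θ).indicator (fun y => ‖h y‖ₑ ^ 2) y) v]
    refine lintegral_mono fun y => ?_
    by_cases hy : y ∈ slab n i d β θ
    · have hyi : (y + v) i / d = y i / d + (k * θ - β) := by
        simp [hv, add_div, hd.ne']
      have hfl : ⌊(y + v) i / d⌋ = ⌊y i / d⌋ := by
        rw [hyi, Int.floor_eq_iff]
        have h1 := Int.floor_add_fract (y i / d)
        obtain ⟨h2, h3⟩ := hy
        have : 0 ≤ k * θ := by positivity
        constructor <;> nlinarith
      have hfr : Int.fract ((y + v) i / d) = Int.fract (y i / d) + (k * θ - β) := by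
        rw [Int.fract, hfl, hyi, Int.fract]; ring
      have hmem : y + v ∈ slab n i d (k * θ) θ := by
        obtain ⟨h2, h3⟩ := hy
        constructor <;> rw [hfr] <;> linarith
      have hc : cub d (y + v) = cub d y := by
        ext j
        by_cases hj : j = i
        · subst hj; exact hfl
        · simp [cub, hv, hj]
      rw [indicator_of_mem hy, indicator_of_mem hmem, sig_const hh hc]
    · rw [indicator_of_notMem hy]; exact zero_le
  have hsum : (K : ℝ≥0∞) * ∫⁻ y in slab n i d β θ, ‖h y‖ₑ ^ 2 ≤ ∫⁻ y, ‖h y‖ₑ ^ 2 := by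
    calc (K : ℝ≥0∞) * ∫⁻ y in slab n i d β θ, ‖h y‖ₑ ^ 2
        = ∑ k ∈ Finset.range K, ∫⁻ y in slab n i d β θ, ‖h y‖ₑ ^ 2 := by simp
      _ ≤ ∑ k ∈ Finset.range K, ∫⁻ y in slab n i d (k * θ) θ, ‖h y‖ₑ ^ 2 := Finset.sum_le_sum htr
      _ = ∫⁻ y in ⋃ k ∈ Finset.range K, slab n i d (k * θ) θ, ‖h y‖ₑ ^ 2 := by
          rw [lintegral_biUnion_finset]
          · intro k _ k' _ hkk
            refine Set.disjoint_left.2 fun y hy hy' => ?_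
            rcases lt_or_gt_of_ne hkk with hlt | hlt
            · have : (k:ℝ) + 1 ≤ k' := by exact_mod_cast hlt
              have := hy.2; have := hy'.1; nlinarith
            · have : (k':ℝ) + 1 ≤ k := by exact_mod_cast hlt
              have := hy'.2; have := hy.1; nlinarith
          · intro k _; exact slab_meas ..
      _ ≤ _ := setLIntegral_le_lintegral _ _
  calc ∫⁻ y in slab n i d β θ, ‖h y‖ₑ ^ 2 = 1 * ∫⁻ y in slab n i d β θ, ‖h y‖ₑ ^ 2 := (one_mul _).symm
    _ ≤ (ENNReal.ofReal (2 * θ) * K) * ∫⁻ y in slab n i d β θ, ‖h y‖ₑ ^ 2 := by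
        refine mul_le_mul_left ?_ _
        rw [← ENNReal.ofReal_natCast, ← ENNReal.ofReal_mul (by positivity), ← ENNReal.ofReal_one]
        exact ENNReal.ofReal_le_ofReal hKθ
    _ = ENNReal.ofReal (2 * θ) * (K * ∫⁻ y in slab n i d β θ, ‖h y‖ₑ ^ 2) := by ring
    _ ≤ _ := mul_le_mul_right hsum _

/-- constant for the local square estimates -/
def cX (n : ℕ) : ℝ := (cF n + cT n * (24 * n + 6)) * om n * 4 ^ n

theorem cX_pos (n : ℕ) : 0 < cX n := by
  unfold cX; have := cT_pos n; have := cF_nonneg n; have := om_pos n; positivity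

theorem fine_phi {R d : ℝ} (hR : 0 < R) (hd : 0 < d) {h : EE n → ℝ} (hmm : Measurable h)
    (hm : MemLp h 2) (hp : Perp d h) :
    ∃ Φ : EE n → ℝ≥0∞, Measurable Φ ∧ (∀ x, pv 2 (Fl ℓ R h x) (Icc R (2 * R)) ^ 2 ≤ Φ x) ∧
      ∫⁻ x, Φ x ≤ ENNReal.ofReal (cX n * (d / R)) * ∫⁻ y, ‖h y‖ₑ ^ 2 := by
  obtain ⟨h1, h2⟩ := tonelli_ball (n := n) (by positivity : 0 < 4 * R)
    (w := fun y => ‖h y‖ₑ ^ 2) (by fun_prop)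
  have hcF := cF_nonneg n
  have hcT := cT_pos n
  have hom := om_pos n
  refine ⟨_, h1.const_mul (ENNReal.ofReal (cF n * (d / R) * (R ^ n)⁻¹)),
    fun x => fine_est ℓ hR hd hm hp x, ?_⟩
  rw [lintegral_const_mul _ h1, h2, ← mul_assoc, ← ENNReal.ofReal_mul (by positivity)]
  refine mul_le_mul_left (ENNReal.ofReal_le_ofReal ?_) _
  have : cF n * (d / R) * (R ^ n)⁻¹ * (om n * (4 * R) ^ n) = cF n * om n * 4 ^ n * (d / R) := by
    rw [mul_pow]; field_simp
  rw [this, cX]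
  gcongr
  have : 0 ≤ cT n * (24 * n + 6) := by positivity
  linarith

theorem triv_phi {R : ℝ} (hR : 0 < R) {h : EE n → ℝ} (hmm : Measurable h) (hm : MemLp h 2) :
    ∃ Φ : EE n → ℝ≥0∞, Measurable Φ ∧ (∀ x, pv 1 (Fl ℓ R h x) (Icc R (2 * R)) ^ 2 ≤ Φ x) ∧
      ∫⁻ x, Φ x ≤ ENNReal.ofReal (cT n * om n * 4 ^ n) * ∫⁻ y, ‖h y‖ₑ ^ 2 := by
  obtain ⟨h1, h2⟩ := tonelli_ball (n := n) (by positivity : 0 < 4 * R)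
    (w := fun y => ‖h y‖ₑ ^ 2) (by fun_prop)
  have hcT := cT_pos n
  have hom := om_pos n
  refine ⟨_, h1.const_mul (ENNReal.ofReal (cT n * (R ^ n)⁻¹)),
    fun x => triv_est ℓ hR hm x, ?_⟩
  rw [lintegral_const_mul _ h1, h2, ← mul_assoc, ← ENNReal.ofReal_mul (by positivity)]
  refine mul_le_mul_left (ENNReal.ofReal_le_ofReal (le_of_eq ?_)) _
  rw [mul_pow]; field_simp

theorem coarse_phi {R d : ℝ} (hR : 0 < R) (hd : 0 < d) {h : EE n → ℝ}
    (hh : Measurable[sig n d] h) (hm : MemLp h 2) :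
    ∃ Φ : EE n → ℝ≥0∞, Measurable Φ ∧ (∀ x, pv 2 (Fl ℓ R h x) (Icc R (2 * R)) ^ 2 ≤ Φ x) ∧
      ∫⁻ x, Φ x ≤ ENNReal.ofReal (cX n * (R / d)) * ∫⁻ y, ‖h y‖ₑ ^ 2 := by
  have hmm : Measurable h := hh.mono (sig_le d) le_rfl
  have hcF := cF_nonneg n
  have hcT := cT_pos n
  have hom := om_pos n
  set θ := 6 * R / d with hθ
  have hθ0 : 0 < θ := by positivity
  rcases lt_or_ge 1 θ with hθ1 | hθ1
  · obtain ⟨Φ, h1, h2, h3⟩ := triv_phi ℓ hR hmm hm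
    refine ⟨Φ, h1, fun x => (pow_le_pow_left' (pv_anti_exp one_pos one_le_two _ _) 2).trans (h2 x),
      h3.trans ?_⟩
    refine mul_le_mul_left (ENNReal.ofReal_le_ofReal ?_) _
    have h6 : 1 ≤ 6 * (R / d) := by rw [hθ] at hθ1; rw [mul_div_assoc'] ; exact hθ1.le
    calc cT n * om n * 4 ^ n = (cT n * om n * 4 ^ n) * 1 := by ring
      _ ≤ (cT n * om n * 4 ^ n) * (6 * (R / d)) := by gcongr
      _ = (cT n * 6 * om n * 4 ^ n) * (R / d) := by ring
      _ ≤ _ := by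
        rw [cX]
        gcongr
        have : 0 ≤ cT n * (24 * n) := by positivity
        linarith
  set N : Set (EE n) := ⋃ i : Fin n, (slab n i d 0 θ ∪ slab n i d (1 - θ) θ) with hN
  have hNm : MeasurableSet N :=
    MeasurableSet.iUnion fun i => (slab_meas ..).union (slab_meas ..)
  set w : EE n → ℝ≥0∞ := N.indicator fun y => ‖h y‖ₑ ^ 2 with hw
  have hwm : Measurable w := Measurable.indicator (by fun_prop) hNm
  have hwi : ∫⁻ y, w y ≤ ENNReal.ofReal (24 * n * (R / d)) * ∫⁻ y, ‖h y‖ₑ ^ 2 := by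
    rw [hw, lintegral_indicator hNm]
    calc ∫⁻ y in N, ‖h y‖ₑ ^ 2 ≤ ∑ i : Fin n, ∫⁻ y in slab n i d 0 θ ∪ slab n i d (1 - θ) θ, ‖h y‖ₑ ^ 2 := by
          rw [hN]
          exact (lintegral_iUnion_le _ _).trans (le_of_eq (tsum_fintype _))
      _ ≤ ∑ i : Fin n, ENNReal.ofReal (4 * θ) * ∫⁻ y, ‖h y‖ₑ ^ 2 := by
          refine Finset.sum_le_sum fun i _ => ?_
          refine (lintegral_union_le _ _ _).trans ?_
          refine (add_le_add (slab_le i hd le_rfl hθ0 hθ1 hh)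
            (slab_le i hd (by linarith) hθ0 hθ1 hh)).trans (le_of_eq ?_)
          rw [← add_mul, ← ENNReal.ofReal_add (by positivity) (by positivity)]
          ring_nf
      _ = _ := by
          rw [Finset.sum_const, Finset.card_univ, Fintype.card_fin, nsmul_eq_mul, ← mul_assoc,
            ← ENNReal.ofReal_natCast, ← ENNReal.ofReal_mul (by positivity)]
          congr 2
          rw [hθ]; ring
  obtain ⟨h1, h2⟩ := tonelli_ball (n := n) (by positivity : 0 < 4 * R) hwm
  refine ⟨_, h1.const_mul (ENNReal.ofReal (cT n * (R ^ n)⁻¹)), fun x => ?_, ?_⟩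
  · by_cases hx : ∀ y, ‖x - y‖ ≤ 2 * R → cub d y = cub d x
    · have hz : pv 2 (Fl ℓ R h x) (Icc R (2 * R)) ≤ 0 := by
        have hF : ∀ t ∈ Icc R (2 * R), Fl ℓ R h x t = 0 := by
          intro t ht
          rw [Fl, ← odd_ann ℓ x (A := Ioc R t) measurableSet_Ioc (h x)]
          refine setIntegral_congr_fun (meas_ann x R t) fun y hy => ?_
          change Kr ℓ (x - y) * h y = Kr ℓ (x - y) * h x
          rw [sig_const hh (hx y (hy.2.trans ht.2))]
        refine pv_le' two_pos fun N u _ hu => ?_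
        simp [hF _ (hu _)]
      simp [le_antisymm hz (zero_le)]
    · push Not at hx
      obtain ⟨y, hy, hne⟩ := hx
      refine (pow_le_pow_left' (pv_anti_exp one_pos one_le_two _ _) 2).trans
        ((triv_est ℓ hR hm x).trans ?_)
      refine mul_le_mul_right (setLIntegral_mono_ae' measurableSet_ball ?_) _
      refine Eventually.of_forall fun y' hy' => ?_
      suffices y' ∈ N by rw [hw, indicator_of_mem this]
      obtain ⟨i, hi⟩ : ∃ i, ⌊y i / d⌋ ≠ ⌊x i / d⌋ := by
        by_contra hc
        push Not at hc
        exact hne (funext hc)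
      have hxy : |x i - y i| ≤ 2 * R := (abs_coord_le i (x - y)).trans hy
      have hxy' : |x i - y' i| < 4 * R := by
        refine (abs_coord_le i (x - y')).trans_lt ?_
        rw [← dist_eq_norm, dist_comm]; exact hy'
      obtain ⟨k, hk⟩ : ∃ k : ℤ, |x i / d - k| ≤ 2 * R / d := by
        have hxyd : |x i / d - y i / d| ≤ 2 * R / d := by
          rw [← sub_div, abs_div, abs_of_pos hd]; gcongr
        rw [abs_le] at hxyd
        rcases lt_or_gt_of_ne hi with hlt | hlt
        · refine ⟨⌊x i / d⌋, ?_⟩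
          have a1 := Int.floor_le (x i / d)
          have a2 : y i / d < ⌊x i / d⌋ := Int.floor_lt.1 hlt
          rw [abs_le]; constructor <;> linarith
        · refine ⟨⌊y i / d⌋, ?_⟩
          have a1 := Int.floor_le (y i / d)
          have a2 : x i / d < ⌊y i / d⌋ := Int.floor_lt.1 hlt
          rw [abs_le]; constructor <;> linarith
      have hyk : |y' i / d - k| < θ := by
        have : |x i / d - y' i / d| < 4 * R / d := by
          rw [← sub_div, abs_div, abs_of_pos hd]; gcongr
        have e : θ = 4 * R / d + 2 * R / d := by rw [hθ]; ring
        rw [abs_lt] at this ⊢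
        rw [abs_le] at hk
        constructor <;> linarith [this.1, this.2, hk.1, hk.2]
      rw [abs_lt] at hyk
      refine mem_iUnion.2 ⟨i, ?_⟩
      rcases le_or_gt (k:ℝ) (y' i / d) with hle | hlt
      · left
        have hf : ⌊y' i / d⌋ = k := Int.floor_eq_iff.2 ⟨hle, by linarith [hyk.2]⟩
        refine ⟨Int.fract_nonneg _, ?_⟩
        rw [Int.fract, hf]; linarith [hyk.2]
      · right
        have hf : ⌊y' i / d⌋ = k - 1 := Int.floor_eq_iff.2 ⟨by push_cast; linarith [hyk.1], by push_cast; linarith⟩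
        refine ⟨?_, ?_⟩
        · rw [Int.fract, hf]; push_cast; linarith [hyk.1]
        · have := Int.fract_lt_one (y' i / d); linarith
  · rw [lintegral_const_mul _ h1, h2, ← mul_assoc, ← ENNReal.ofReal_mul (by positivity)]
    refine (mul_le_mul_right hwi _).trans ?_
    rw [← mul_assoc, ← ENNReal.ofReal_mul (by positivity)]
    refine mul_le_mul_left (ENNReal.ofReal_le_ofReal ?_) _
    have : cT n * (R ^ n)⁻¹ * (om n * (4 * R) ^ n) * (24 * n * (R / d)) =
        cT n * (24 * n) * om n * 4 ^ n * (R / d) := by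
      rw [mul_pow]; field_simp
    rw [this, cX]
    gcongr
    linarith

end coarse

section ops
variable {n : ℕ} (ℓ : Fin n)

/-- the Hilbert space -/
abbrev HH (n : ℕ) := Lp ℝ 2 (volume : Measure (EE n))

theorem Fl_congr {f g : EE n → ℝ} (h : f =ᵐ[volume] g) (R : ℝ) (x : EE n) (ε : ℝ) :
    Fl ℓ R f x ε = Fl ℓ R g x ε := by
  refine integral_congr_ae (ae_restrict_of_ae ?_)
  filter_upwards [h] with y hy
  rw [hy]

theorem meas_ann2 (R S : ℝ) :
    MeasurableSet {p : EE n × EE n | R < ‖p.1 - p.2‖ ∧ ‖p.1 - p.2‖ ≤ S} := by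
  have h : Measurable fun p : EE n × EE n => ‖p.1 - p.2‖ := by fun_prop
  exact (measurableSet_lt measurable_const h).inter (measurableSet_le h measurable_const)

theorem Fl_meas {h : EE n → ℝ} (hm : AEStronglyMeasurable h volume) (R S : ℝ) :
    Measurable fun x => Fl ℓ R h x S := by
  obtain ⟨g, hg, hgh⟩ := hm
  simp only [Fl_congr ℓ hgh]
  have hS : MeasurableSet {p : EE n × EE n | R < ‖p.1 - p.2‖ ∧ ‖p.1 - p.2‖ ≤ S} :=
    meas_ann2 R S
  have hJ : Measurable fun p : EE n × EE n =>
      {p : EE n × EE n | R < ‖p.1 - p.2‖ ∧ ‖p.1 - p.2‖ ≤ S}.indicator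
        (fun p => Kr ℓ (p.1 - p.2) * g p.2) p :=
    (((Kr_meas ℓ).comp (by fun_prop)).mul (hg.measurable.comp measurable_snd)).indicator hS
  have e : ∀ x : EE n, Fl ℓ R g x S = ∫ y, {p : EE n × EE n | R < ‖p.1 - p.2‖ ∧ ‖p.1 - p.2‖ ≤ S}.indicator
        (fun p => Kr ℓ (p.1 - p.2) * g p.2) (x, y) := by
    intro x
    rw [Fl, ← integral_indicator (meas_ann x R S)]
    rfl
  simp only [e]
  exact (hJ.stronglyMeasurable.integral_prod_right').measurable

theorem Fl_int {R S : ℝ} (hR : 0 < R) {h : EE n → ℝ} (hm : MemLp h 2) (x : EE n) :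
    IntegrableOn (fun y => Kr ℓ (x - y) * h y) {y : EE n | R < ‖x - y‖ ∧ ‖x - y‖ ≤ S} :=
  ann_integrable ℓ hR ((memLp_intOn hm x (S + 1)).mono_set (ann_sub_ball x (by linarith)))

theorem Fl_add {R : ℝ} (hR : 0 < R) {f g : EE n → ℝ} (hf : MemLp f 2) (hg : MemLp g 2)
    (x : EE n) (S : ℝ) : Fl ℓ R (fun y => f y + g y) x S = Fl ℓ R f x S + Fl ℓ R g x S := by
  unfold Fl
  rw [← integral_add (Fl_int ℓ hR hf x) (Fl_int ℓ hR hg x)]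
  simp only [mul_add]

theorem Fl_smul (R : ℝ) (f : EE n → ℝ) (c : ℝ) (x : EE n) (S : ℝ) :
    Fl ℓ R (fun y => c * f y) x S = c * Fl ℓ R f x S := by
  unfold Fl
  rw [← integral_const_mul]
  congr 1; ext y; ring

theorem Fl_self (R : ℝ) (f : EE n → ℝ) (x : EE n) : Fl ℓ R f x R = 0 := by
  unfold Fl
  have : {y : EE n | R < ‖x - y‖ ∧ ‖x - y‖ ≤ R} = ∅ := by
    ext y; simp only [mem_ofPred_eq, mem_empty_iff_false, iff_false]; intro h; linarith [h.1, h.2]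
  rw [this]; simp

theorem Fl_le_pv {p : ℝ} (hp : 0 < p) {R : ℝ} (hR : 0 < R) (f : EE n → ℝ) (x : EE n) {t : ℝ}
    (ht : t ∈ Icc R (2 * R)) :
    ‖Fl ℓ R f x t‖ₑ ≤ pv p (Fl ℓ R f x) (Icc R (2 * R)) := by
  have := enorm_sub_le_pv hp (Fl ℓ R f x) (s := Icc R (2 * R)) (t := R) (t' := t)
    ⟨le_rfl, by linarith⟩ ht ht.1
  rwa [Fl_self, sub_zero] at this

theorem lp_norm_sq (f : HH n) : ENNReal.ofReal (‖f‖ ^ 2) = ∫⁻ x, ‖f x‖ₑ ^ 2 := by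
  rw [Lp.norm_def, ← ENNReal.toReal_pow, ENNReal.ofReal_toReal (ENNReal.pow_ne_top (Lp.eLpNorm_ne_top f)),
    eLpNorm_eq_lintegral_rpow_enorm_toReal two_ne_zero ENNReal.ofNat_ne_top]
  rw [← ENNReal.rpow_natCast, ← ENNReal.rpow_mul]
  simp

theorem memLp_lint {f : EE n → ℝ} (hf : MemLp f 2) : ∫⁻ x, ‖f x‖ₑ ^ 2 < ∞ := by
  have := lintegral_rpow_enorm_lt_top_of_eLpNorm_lt_top two_ne_zero ENNReal.ofNat_ne_top hf.2
  simpa using this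

theorem memLp_of_lint {f : EE n → ℝ} (hm : AEStronglyMeasurable f volume)
    (h : ∫⁻ x, ‖f x‖ₑ ^ 2 < ∞) : MemLp f 2 := by
  refine ⟨hm, ?_⟩
  rw [eLpNorm_lt_top_iff_lintegral_rpow_enorm_lt_top two_ne_zero ENNReal.ofNat_ne_top]
  simpa using h

theorem Fl_anti {R : ℝ} (hR : 0 < R) {f g : EE n → ℝ} (hfm : Measurable f) (hgm : Measurable g)
    (hf : MemLp f 2) (hg : MemLp g 2) :
    ∫ x, Fl ℓ R f x (2 * R) * g x = - ∫ x, f x * Fl ℓ R g x (2 * R) := by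
  set D := {p : EE n × EE n | R < ‖p.1 - p.2‖ ∧ ‖p.1 - p.2‖ ≤ 2 * R} with hD
  have hS : MeasurableSet D :=
    meas_ann2 R (2 * R)
  set J : EE n → EE n → ℝ := fun x y => D.indicator
        (fun p => Kr ℓ (p.1 - p.2) * f p.2 * g p.1) (x, y) with hJ
  have hJm : Measurable (Function.uncurry J) :=
    ((((Kr_meas ℓ).comp (by fun_prop)).mul (hfm.comp measurable_snd)).mul
      (hgm.comp measurable_fst)).indicator hS
  have hJi : Integrable (Function.uncurry J) (volume.prod volume) := by
    refine ⟨hJm.aestronglyMeasurable, ?_⟩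
    rw [hasFiniteIntegral_iff_enorm, lintegral_prod _ hJm.enorm.aemeasurable]
    obtain ⟨h1, h2⟩ := tonelli_ball (n := n) (by positivity : 0 < 4 * R)
      (w := fun y => ‖f y‖ₑ ^ 2) (by fun_prop)
    have hb : ∀ x, ∫⁻ y, ‖J x y‖ₑ ≤ ENNReal.ofReal ((R ^ n)⁻¹) *
        ((∫⁻ y in Metric.ball x (4 * R), ‖f y‖ₑ ^ 2) +
          ENNReal.ofReal (om n * (4 * R) ^ n) * ‖g x‖ₑ ^ 2) := by
      intro x
      rw [← vol_ball x (by positivity), mul_comm (volume _), ← setLIntegral_const,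
        ← lintegral_add_right _ (by fun_prop), ← lintegral_const_mul _ (by fun_prop),
        ← lintegral_indicator measurableSet_ball]
      refine lintegral_mono fun y => ?_
      by_cases hy : (x, y) ∈ D
      · have hy' : y ∈ Metric.ball x (4 * R) :=
          ann_sub_ball x (R := R) (S := 2 * R) (by linarith) hy
        rw [indicator_of_mem hy', hJ]
        simp only
        rw [indicator_of_mem hy, mul_assoc, enorm_mul]
        gcongr
        · rw [Real.enorm_eq_ofReal_abs]
          refine ENNReal.ofReal_le_ofReal ((Kr_abs_le ℓ _).trans ?_)
          have := hy.1.le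
          simp only at this ⊢
          gcongr
        · simp only
          rw [enorm_mul]
          rcases le_total ‖f y‖ₑ ‖g x‖ₑ with h | h
          · exact (mul_le_mul_left h _).trans (by rw [sq, sq]; exact le_add_self)
          · exact (mul_le_mul_right h _).trans (by rw [sq, sq]; exact le_self_add)
      · simp only [hJ]
        rw [indicator_of_notMem hy]; simp
    refine (lintegral_mono hb).trans_lt ?_
    rw [lintegral_const_mul _ (by fun_prop), lintegral_add_left h1, h2,
      lintegral_const_mul _ (by fun_prop)]
    refine ENNReal.mul_lt_top ENNReal.ofReal_lt_top (ENNReal.add_lt_top.2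
      ⟨ENNReal.mul_lt_top ENNReal.ofReal_lt_top (memLp_lint hf),
       ENNReal.mul_lt_top ENNReal.ofReal_lt_top (memLp_lint hg)⟩)
  have e1 : ∀ x, Fl ℓ R f x (2 * R) * g x = ∫ y, J x y := by
    intro x
    rw [Fl, ← integral_mul_const, ← integral_indicator (meas_ann x R (2 * R))]
    rfl
  have e2 : ∀ y, f y * Fl ℓ R g y (2 * R) = - ∫ x, J x y := by
    intro y
    rw [Fl, ← integral_const_mul, ← integral_indicator (meas_ann y R (2 * R)), ← integral_neg]
    congr 1
    ext x
    simp only [hJ, hD, indicator, mem_ofPred_eq, norm_sub_rev y x]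
    split_ifs
    · rw [← neg_sub x y, Kr_neg]; ring
    · simp
  simp only [e1, e2]
  rw [integral_neg, neg_neg]
  exact integral_integral_swap hJi

theorem exists_T {R : ℝ} (hR : 0 < R) : ∃ T : HH n →L[ℝ] HH n,
    (∀ f : HH n, T f =ᵐ[volume] fun x => Fl ℓ R f x (2 * R)) ∧
    (∀ f g : HH n, inner ℝ (T f) g = - inner ℝ f (T g)) := by
  have hcT := cT_pos n
  have hom := om_pos n
  set C := cT n * om n * 4 ^ n with hC
  have hbd : ∀ f : HH n, ∫⁻ x, ‖Fl ℓ R f x (2 * R)‖ₑ ^ 2 ≤ ENNReal.ofReal (C * ‖f‖ ^ 2) := by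
    intro f
    obtain ⟨Φ, h1, h2, h3⟩ := triv_phi ℓ hR (Lp.stronglyMeasurable f).measurable (Lp.memLp f)
    rw [← lp_norm_sq, ← ENNReal.ofReal_mul (by positivity)] at h3
    refine le_trans (lintegral_mono fun x => ?_) h3
    refine le_trans ?_ (h2 x)
    gcongr
    exact Fl_le_pv ℓ one_pos hR _ _ ⟨by linarith, le_rfl⟩
  have hmem : ∀ f : HH n, MemLp (fun x => Fl ℓ R f x (2 * R)) 2 := fun f =>
    memLp_of_lint (Fl_meas ℓ (Lp.memLp f).1 _ _).aestronglyMeasurable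
      ((hbd f).trans_lt ENNReal.ofReal_lt_top)
  let L : HH n →ₗ[ℝ] HH n :=
    { toFun := fun f => (hmem f).toLp _
      map_add' := by
        intro f g
        rw [← MemLp.toLp_add]
        refine MemLp.toLp_congr _ _ (Eventually.of_forall fun x => ?_)
        simp only [Pi.add_apply]
        rw [Fl_congr ℓ (Lp.coeFn_add f g), ← Fl_add ℓ hR (Lp.memLp f) (Lp.memLp g)]
        rfl
      map_smul' := by
        intro c f
        rw [RingHom.id_apply, ← MemLp.toLp_const_smul]
        refine MemLp.toLp_congr _ _ (Eventually.of_forall fun x => ?_)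
        simp only [Pi.smul_apply, smul_eq_mul]
        rw [Fl_congr ℓ (Lp.coeFn_smul c f), ← Fl_smul ℓ]
        rfl }
  have hLae : ∀ f : HH n, L f =ᵐ[volume] fun x => Fl ℓ R f x (2 * R) := fun f => (hmem f).coeFn_toLp
  refine ⟨L.mkContinuous (Real.sqrt C) fun f => ?_, hLae, fun f g => ?_⟩
  · have h : ENNReal.ofReal (‖L f‖ ^ 2) ≤ ENNReal.ofReal (C * ‖f‖ ^ 2) := by
      rw [lp_norm_sq]
      refine le_trans (le_of_eq (lintegral_congr_ae ?_)) (hbd f)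
      filter_upwards [hLae f] with x hx
      rw [hx]
    rw [ENNReal.ofReal_le_ofReal_iff (by positivity)] at h
    refine le_of_sq_le_sq ?_ (by positivity)
    rw [mul_pow, Real.sq_sqrt (by positivity)]
    exact h
  · rw [L2.inner_def, L2.inner_def]
    have h := Fl_anti ℓ hR (Lp.stronglyMeasurable f).measurable (Lp.stronglyMeasurable g).measurable
      (Lp.memLp f) (Lp.memLp g)
    refine Eq.trans ?_ (h.trans ?_)
    · refine integral_congr_ae ?_
      filter_upwards [hLae f] with x hx
      simp only [LinearMap.mkContinuous_apply, hx]
      simp [mul_comm]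
    · congr 1
      refine integral_congr_ae ?_
      filter_upwards [hLae g] with x hx
      simp only [LinearMap.mkContinuous_apply, hx]
      simp [mul_comm]

end ops

section proj
variable {n : ℕ} (ℓ : Fin n)

/-- projection onto functions constant on cubes -/
def Ed (n : ℕ) (d : ℝ) : HH n →L[ℝ] HH n :=
  (lpMeas ℝ ℝ (sig n d) 2 (volume : Measure (EE n))).subtypeL.comp (condExpL2 ℝ ℝ (sig_le d))

theorem Ed_mem (d : ℝ) (x : HH n) : Ed n d x ∈ lpMeas ℝ ℝ (sig n d) 2 (volume : Measure (EE n)) :=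
  (condExpL2 ℝ ℝ (sig_le d) x).2

theorem Ed_sa (d : ℝ) (x y : HH n) : inner ℝ (Ed n d x) y = inner ℝ x (Ed n d y) :=
  inner_condExpL2_left_eq_right (sig_le d)

theorem Ed_fix {d : ℝ} {x : HH n} (hx : x ∈ lpMeas ℝ ℝ (sig n d) 2 (volume : Measure (EE n))) :
    Ed n d x = x := by
  haveI : Fact (sig n d ≤ (inferInstance : MeasurableSpace (EE n))) := ⟨sig_le d⟩
  exact Submodule.starProjection_eq_self_iff.2 hx

theorem lpMeas_mono {d d' : ℝ} (h : sig n d' ≤ sig n d) {x : HH n}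
    (hx : x ∈ lpMeas ℝ ℝ (sig n d') 2 (volume : Measure (EE n))) :
    x ∈ lpMeas ℝ ℝ (sig n d) 2 (volume : Measure (EE n)) := by
  rw [mem_lpMeas_iff_aestronglyMeasurable] at hx ⊢
  exact hx.mono h

theorem Ed_nest {d d' : ℝ} (h : sig n d' ≤ sig n d) (x : HH n) : Ed n d (Ed n d' x) = Ed n d' x :=
  Ed_fix (lpMeas_mono h (Ed_mem d' x))

theorem Ed_nest' {d d' : ℝ} (h : sig n d' ≤ sig n d) (x : HH n) : Ed n d' (Ed n d x) = Ed n d' x := by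
  refine ext_inner_right ℝ fun y => ?_
  rw [Ed_sa, Ed_sa, Ed_nest h, ← Ed_sa]

theorem Ed_perp (d : ℝ) (x : HH n) : Perp d (⇑(x - Ed n d x)) := by
  intro φ hφ hφL
  have hmem : hφL.toLp φ ∈ lpMeas ℝ ℝ (sig n d) 2 (volume : Measure (EE n)) := by
    rw [mem_lpMeas_iff_aestronglyMeasurable]
    exact ⟨φ, hφ.stronglyMeasurable, hφL.coeFn_toLp⟩
  have h : inner ℝ (hφL.toLp φ) (x - Ed n d x) = 0 := by
    rw [inner_sub_right, ← Ed_sa, Ed_fix hmem, sub_self]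
  rw [L2.inner_def] at h
  rw [← h]
  refine integral_congr_ae ?_
  filter_upwards [hφL.coeFn_toLp] with y hy
  rw [hy]; simp [mul_comm]

theorem lpMeas_rep {d : ℝ} {x : HH n} (hx : x ∈ lpMeas ℝ ℝ (sig n d) 2 (volume : Measure (EE n))) :
    ∃ h : EE n → ℝ, Measurable[sig n d] h ∧ MemLp h 2 ∧ x =ᵐ[volume] h := by
  rw [mem_lpMeas_iff_aestronglyMeasurable] at hx
  obtain ⟨h, h1, h2⟩ := hx
  exact ⟨h, h1.measurable, (memLp_congr_ae h2).1 (Lp.memLp x), h2⟩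

theorem sig_anti (s : ℝ) {j k : ℕ} (h : j ≤ k) : sig n (s * 2 ^ k) ≤ sig n (s * 2 ^ j) := by
  induction k, h using Nat.le_induction with
  | base => exact le_rfl
  | succ k _ ih =>
    refine le_trans ?_ ih
    have := sig_mono (n := n) (d := s * 2 ^ k)
    rwa [show 2 * (s * 2 ^ k) = s * 2 ^ (k + 1) by ring] at this

/-- the chain of projections -/
def Pch (n : ℕ) (s : ℝ) (m : ℕ) (j : ℕ) : HH n →L[ℝ] HH n :=
  if j = 0 then ContinuousLinearMap.id ℝ _ else if j ≤ m + 1 then Ed n (s * 2 ^ (j - 1)) else 0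

theorem Pch_zero (s : ℝ) (m : ℕ) (x : HH n) : Pch n s m 0 x = x := by simp [Pch]

theorem Pch_succ (s : ℝ) {m k : ℕ} (h : k ≤ m) : Pch n s m (k + 1) = Ed n (s * 2 ^ k) := by
  simp [Pch, h]

theorem Pch_top (s : ℝ) {m j : ℕ} (h : m + 2 ≤ j) : Pch n s m j = 0 := by
  have h1 : j ≠ 0 := by omega
  have h2 : ¬ j ≤ m + 1 := by omega
  simp [Pch, h1, h2]

theorem Pch_cases (s : ℝ) (m j : ℕ) : j = 0 ∨ (∃ k ≤ m, j = k + 1) ∨ m + 2 ≤ j := by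
  rcases Nat.eq_zero_or_pos j with h | h
  · exact Or.inl h
  · rcases Nat.lt_or_ge j (m + 2) with h' | h'
    · exact Or.inr (Or.inl ⟨j - 1, by omega, by omega⟩)
    · exact Or.inr (Or.inr h')

theorem chain (s : ℝ) (m : ℕ) : ProjChain (Pch n s m) m where
  sa := by
    intro j x y
    rcases Pch_cases s m j with rfl | ⟨k, hk, rfl⟩ | hj
    · simp [Pch_zero]
    · rw [Pch_succ s hk, Ed_sa]
    · simp [Pch_top s hj]
  nest := by
    intro j k x hjk
    rcases Pch_cases s m k with rfl | ⟨k, hk, rfl⟩ | hk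
    · obtain rfl : j = 0 := by omega
      simp [Pch_zero]
    · rcases Pch_cases s m j with rfl | ⟨j, hj, rfl⟩ | hj
      · rw [Pch_zero]
      · rw [Pch_succ s hk, Pch_succ s hj, Ed_nest (sig_anti s (by omega))]
      · omega
    · simp [Pch_top s hk]
  nest' := by
    intro j k x hjk
    rcases Pch_cases s m k with rfl | ⟨k, hk, rfl⟩ | hk
    · obtain rfl : j = 0 := by omega
      simp [Pch_zero]
    · rcases Pch_cases s m j with rfl | ⟨j, hj, rfl⟩ | hj
      · rw [Pch_zero]
      · rw [Pch_succ s hk, Pch_succ s hj, Ed_nest' (sig_anti s (by omega))]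
      · omega
    · simp [Pch_top s hk]
  zero := Pch_zero s m
  top := fun x => by simp [Pch_top s le_rfl]

/-- fine estimate for elements of `HH` -/
theorem fine_H {R d : ℝ} (hR : 0 < R) (hd : 0 < d) (y : HH n) (hy : Ed n d y = 0) :
    ∃ Φ : EE n → ℝ≥0∞, Measurable Φ ∧ (∀ x, pv 2 (Fl ℓ R y x) (Icc R (2 * R)) ^ 2 ≤ Φ x) ∧
      ∫⁻ x, Φ x ≤ ENNReal.ofReal (cX n * (d / R) * ‖y‖ ^ 2) := by
  have hp := Ed_perp d y
  rw [hy, sub_zero] at hp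
  have := fine_phi ℓ hR hd (Lp.stronglyMeasurable y).measurable (Lp.memLp y) hp
  have hc := cX_pos n
  rwa [← lp_norm_sq, ← ENNReal.ofReal_mul (by positivity)] at this

theorem coarse_H {R d : ℝ} (hR : 0 < R) (hd : 0 < d) (y : HH n) (hy : Ed n d y = y) :
    ∃ Φ : EE n → ℝ≥0∞, Measurable Φ ∧ (∀ x, pv 2 (Fl ℓ R y x) (Icc R (2 * R)) ^ 2 ≤ Φ x) ∧
      ∫⁻ x, Φ x ≤ ENNReal.ofReal (cX n * (R / d) * ‖y‖ ^ 2) := by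
  obtain ⟨h, h1, h2, h3⟩ := lpMeas_rep (hy ▸ Ed_mem d y)
  obtain ⟨Φ, a1, a2, a3⟩ := coarse_phi ℓ hR hd h1 h2
  have hc := cX_pos n
  refine ⟨Φ, a1, fun x => ?_, ?_⟩
  · have : Fl ℓ R y x = Fl ℓ R h x := funext fun t => Fl_congr ℓ h3 R x t
    rw [this]; exact a2 x
  · rw [ENNReal.ofReal_mul (by positivity), lp_norm_sq]
    refine a3.trans (le_of_eq ?_)
    congr 1
    refine lintegral_congr_ae ?_
    filter_upwards [h3] with z hz
    rw [hz]

theorem T_bound {R c : ℝ} (hR : 0 < R) (hc : 0 ≤ c) {T : HH n →L[ℝ] HH n}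
    (hT : ∀ f : HH n, T f =ᵐ[volume] fun x => Fl ℓ R f x (2 * R)) (y : HH n)
    (h : ∃ Φ : EE n → ℝ≥0∞, Measurable Φ ∧ (∀ x, pv 2 (Fl ℓ R y x) (Icc R (2 * R)) ^ 2 ≤ Φ x) ∧
      ∫⁻ x, Φ x ≤ ENNReal.ofReal (c * ‖y‖ ^ 2)) : ‖T y‖ ≤ Real.sqrt c * ‖y‖ := by
  obtain ⟨Φ, h1, h2, h3⟩ := h
  have h : ENNReal.ofReal (‖T y‖ ^ 2) ≤ ENNReal.ofReal (c * ‖y‖ ^ 2) := by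
    rw [lp_norm_sq]
    refine le_trans ?_ h3
    refine lintegral_mono_ae ?_
    filter_upwards [hT y] with x hx
    rw [hx]
    refine le_trans ?_ (h2 x)
    gcongr
    exact Fl_le_pv ℓ two_pos hR _ _ ⟨by linarith, le_rfl⟩
  rw [ENNReal.ofReal_le_ofReal_iff (by positivity)] at h
  refine le_of_sq_le_sq ?_ (by positivity)
  rw [mul_pow, Real.sq_sqrt hc]
  exact h

theorem sqrt_half_pow (c : ℝ) (hc : 0 ≤ c) (k : ℕ) :
    Real.sqrt (c * (1/2) ^ k) ≤ Real.sqrt c * ((9/10 : ℝ) ^ 2) ^ k := by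
  rw [Real.sqrt_mul hc]
  gcongr
  rw [Real.sqrt_le_left (by positivity), ← pow_mul, mul_comm k 2, pow_mul]
  gcongr
  norm_num

/-- constant for the operator part -/
def cO (n : ℕ) : ℝ := (Real.sqrt (cX n) / (9/10 : ℝ) ^ 2) ^ 2 * (2 * (1 - (9/10:ℝ))⁻¹) ^ 4

theorem cO_nonneg (n : ℕ) : 0 ≤ cO n := by unfold cO; positivity

theorem op_main {s : ℝ} (hs : 0 < s) (m : ℕ) {T : ℕ → HH n →L[ℝ] HH n}
    (hT : ∀ i (f : HH n), T i f =ᵐ[volume] fun x => Fl ℓ (s * 2 ^ i) f x (2 * (s * 2 ^ i)))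
    (anti : ∀ i (f g : HH n), inner ℝ (T i f) g = - inner ℝ f (T i g)) (f : HH n) :
    ‖∑ i ∈ Finset.range m, T i f‖ ^ 2 ≤ cO n * ‖f‖ ^ 2 ∧
    ∑ k ∈ Finset.range (m + 1), ‖∑ i ∈ Finset.Ico k m, T i f -
      Ed n (s * 2 ^ k) (∑ i ∈ Finset.range m, T i f)‖ ^ 2 ≤ cO n * ‖f‖ ^ 2 := by
  have hc := cX_pos n
  have h := (chain (n := n) s m).main (T := T) (μ := 9/10) (A := Real.sqrt (cX n))
    (by norm_num) (by norm_num) (by positivity) anti ?_ ?_ f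
  · refine ⟨h.1, le_trans (le_of_eq ?_) h.2⟩
    refine Finset.sum_congr rfl fun k hk => ?_
    rw [Pch_succ s (by have := Finset.mem_range.1 hk; omega)]
  · intro i j x hi hj
    rcases Pch_cases s m j with rfl | ⟨k, hk, rfl⟩ | hj'
    · simp only [Pch_zero, sub_self, map_zero, norm_zero]; positivity
    · have h1 := fine_H ℓ (R := s * 2 ^ i) (d := s * 2 ^ k) (by positivity) (by positivity)
        (x - Ed n (s * 2 ^ k) x) (by rw [map_sub, Ed_nest le_rfl, sub_self])
      have e : cX n * (s * 2 ^ k / (s * 2 ^ i)) = cX n * (1/2) ^ (i + 1 - (k + 1)) := by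
        obtain ⟨r, rfl⟩ := Nat.exists_eq_add_of_le (by omega : k ≤ i)
        rw [show k + r + 1 - (k + 1) = r by omega, pow_add, one_div, inv_pow]
        field_simp
      rw [e] at h1
      have h2 := T_bound ℓ (by positivity) (by positivity) (hT i) _ h1
      rw [Pch_succ s hk]
      refine h2.trans ?_
      have h3 := (chain (n := n) s m).norm_sub_le (k+1) x
      rw [Pch_succ s hk] at h3
      gcongr
      exact sqrt_half_pow _ hc.le _
    · omega
  · intro i j x hi hj
    rcases Pch_cases s m j with rfl | ⟨k, hk, rfl⟩ | hj'
    · omega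
    · have h1 := coarse_H ℓ (R := s * 2 ^ i) (d := s * 2 ^ k) (by positivity) (by positivity)
        (Ed n (s * 2 ^ k) x) (by rw [Ed_nest le_rfl])
      have e : cX n * (s * 2 ^ i / (s * 2 ^ k)) = cX n * (1/2) ^ (k + 1 - (i + 1)) := by
        obtain ⟨r, rfl⟩ := Nat.exists_eq_add_of_le (by omega : i ≤ k)
        rw [show i + r + 1 - (i + 1) = r by omega, pow_add, one_div, inv_pow]
        field_simp
      rw [e] at h1
      have h2 := T_bound ℓ (by positivity) (by positivity) (hT i) _ h1
      rw [Pch_succ s hk]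
      refine h2.trans ?_
      have h3 := (chain (n := n) s m).norm_le (k+1) x
      rw [Pch_succ s hk] at h3
      gcongr
      exact sqrt_half_pow _ hc.le _
    · rw [Pch_top s hj']; simp; positivity

theorem sum_cs {ι : Type*} (S : Finset ι) (a b : ι → ℝ≥0∞) :
    (∑ j ∈ S, a j * b j) ^ 2 ≤ (∑ j ∈ S, a j ^ 2) * ∑ j ∈ S, b j ^ 2 := by
  have h := ENNReal.inner_le_Lp_mul_Lq S a b (Real.HolderConjugate.two_two)
  refine (pow_le_pow_left' h 2).trans (le_of_eq ?_)
  rw [mul_pow]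
  simp only [← ENNReal.rpow_natCast, ← ENNReal.rpow_mul]
  norm_num

theorem delta_phi {s : ℝ} (hs : 0 < s) {m k j : ℕ} (hk : k < m) (f : HH n) :
    ∃ Φ : EE n → ℝ≥0∞, Measurable Φ ∧
      (∀ x, pv 2 (Fl ℓ (s * 2 ^ k) (⇑(Pch n s m j f - Pch n s m (j+1) f)) x)
        (Icc (s * 2 ^ k) (2 * (s * 2 ^ k))) ^ 2 ≤ Φ x) ∧
      ∫⁻ x, Φ x ≤ ENNReal.ofReal (2 * cX n * (1/2) ^ nd k j *
        ‖Pch n s m j f - Pch n s m (j+1) f‖ ^ 2) := by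
  have hc := cX_pos n
  have hP := chain (n := n) s m
  set y := Pch n s m j f - Pch n s m (j+1) f with hy
  rcases le_or_gt j k with hjk | hjk
  · obtain ⟨Φ, h1, h2, h3⟩ := fine_H ℓ (R := s * 2 ^ k) (d := s * 2 ^ j) (by positivity)
      (by positivity) y (by
        rw [← Pch_succ s (by omega : j ≤ m), hy, map_sub, hP.nest' _ _ _ (Nat.le_succ j),
          hP.nest _ _ _ le_rfl, sub_self])
    refine ⟨Φ, h1, h2, h3.trans (ENNReal.ofReal_le_ofReal ?_)⟩
    refine mul_le_mul_of_nonneg_right ?_ (by positivity)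
    obtain ⟨r, rfl⟩ := Nat.exists_eq_add_of_le hjk
    rw [show nd (j + r) j = r by unfold nd; omega, pow_add, one_div, inv_pow]
    have : s * 2 ^ j / (s * (2 ^ j * 2 ^ r)) = ((2:ℝ) ^ r)⁻¹ := by field_simp
    rw [this]
    gcongr
    linarith
  · rcases Nat.lt_or_ge j (m + 2) with hjm | hjm
    · obtain ⟨i, rfl⟩ : ∃ i, j = i + 1 := ⟨j - 1, by omega⟩
      obtain ⟨Φ, h1, h2, h3⟩ := coarse_H ℓ (R := s * 2 ^ k) (d := s * 2 ^ i) (by positivity)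
        (by positivity) y (by
          rw [← Pch_succ s (by omega : i ≤ m), hy, map_sub, hP.nest _ _ _ (Nat.le_succ (i+1)),
            hP.nest _ _ _ le_rfl])
      refine ⟨Φ, h1, h2, h3.trans (ENNReal.ofReal_le_ofReal ?_)⟩
      refine mul_le_mul_of_nonneg_right ?_ (by positivity)
      obtain ⟨r, rfl⟩ := Nat.exists_eq_add_of_le (by omega : k ≤ i)
      rw [show nd k (k + r + 1) = r + 1 by unfold nd; omega, pow_add, one_div, inv_pow]
      have : s * 2 ^ k / (s * (2 ^ k * 2 ^ r)) = ((2:ℝ) ^ r)⁻¹ := by field_simp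
      rw [this, pow_succ]
      apply le_of_eq
      field_simp
    · obtain ⟨Φ, h1, h2, h3⟩ := coarse_H ℓ (R := s * 2 ^ k) (d := s * 2 ^ k) (by positivity)
        (by positivity) y (by rw [hy, Pch_top s hjm, Pch_top s (by omega)]; simp)
      refine ⟨Φ, h1, h2, h3.trans (ENNReal.ofReal_le_ofReal ?_)⟩
      rw [hy, Pch_top s hjm, Pch_top s (by omega)]; simp

theorem Fl_sum {R : ℝ} (hR : 0 < R) {ι : Type*} (S : Finset ι) (F : ι → HH n) (x : EE n) (t : ℝ) :
    Fl ℓ R (⇑(∑ j ∈ S, F j)) x t = ∑ j ∈ S, Fl ℓ R (F j) x t := by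
  classical
  induction S using Finset.induction_on with
  | empty =>
    rw [Finset.sum_empty, Finset.sum_empty, Fl_congr ℓ (Lp.coeFn_zero ℝ 2 volume)]
    simp [Fl]
  | insert a S ha ih =>
    rw [Finset.sum_insert ha, Finset.sum_insert ha, ← ih, Fl_congr ℓ (Lp.coeFn_add _ _)]
    exact Fl_add ℓ hR (Lp.memLp _) (Lp.memLp _) x t

theorem local_phi {s : ℝ} (hs : 0 < s) (m : ℕ) (f : HH n) :
    ∃ Φ : ℕ → EE n → ℝ≥0∞, (∀ k, Measurable (Φ k)) ∧
      (∀ k < m, ∀ x, pv 2 (Fl ℓ (s * 2 ^ k) f x)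
        (Icc (s * 2 ^ k) (2 * (s * 2 ^ k))) ^ 2 ≤ Φ k x) ∧
      ∑ k ∈ Finset.range m, ∫⁻ x, Φ k x ≤ ENNReal.ofReal (112 * cX n * ‖f‖ ^ 2) := by
  classical
  have hc := cX_pos n
  have hP := chain (n := n) s m
  have key : ∀ k j, ∃ Φ : EE n → ℝ≥0∞, Measurable Φ ∧ (k < m →
      (∀ x, pv 2 (Fl ℓ (s * 2 ^ k) (⇑(Pch n s m j f - Pch n s m (j+1) f)) x)
        (Icc (s * 2 ^ k) (2 * (s * 2 ^ k))) ^ 2 ≤ Φ x) ∧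
      ∫⁻ x, Φ x ≤ ENNReal.ofReal (2 * cX n * (1/2) ^ nd k j *
        ‖Pch n s m j f - Pch n s m (j+1) f‖ ^ 2)) := by
    intro k j
    by_cases hk : k < m
    · obtain ⟨Φ, h1, h2⟩ := delta_phi ℓ hs (j := j) hk f
      exact ⟨Φ, h1, fun _ => h2⟩
    · exact ⟨0, measurable_zero, fun h => absurd h hk⟩
  choose Φ hΦm hΦ using key
  set w : ℕ → ℕ → ℝ := fun k j => (5/6) ^ nd k j with hw
  have hw0 : ∀ k j, 0 < w k j := fun k j => by positivity
  refine ⟨fun k x => 7 * ∑ j ∈ Finset.range (m + 2), ENNReal.ofReal ((w k j)⁻¹ ^ 2) * Φ k j x,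
    fun k => ?_, fun k hk x => ?_, ?_⟩
  · refine Measurable.const_mul (Finset.measurable_sum _ fun j _ => (hΦm k j).const_mul _) _
  · have e : Fl ℓ (s * 2 ^ k) f x = fun t => ∑ j ∈ Finset.range (m + 2),
        Fl ℓ (s * 2 ^ k) (⇑(Pch n s m j f - Pch n s m (j+1) f)) x t := by
      ext t
      rw [← Fl_sum ℓ (by positivity), hP.sum_delta]
    rw [e]
    refine (pow_le_pow_left' (pv_sum_le one_le_two _ _ _) 2).trans ?_
    have e2 : ∀ j, pv 2 (Fl ℓ (s * 2 ^ k) (⇑(Pch n s m j f - Pch n s m (j+1) f)) x)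
        (Icc (s * 2 ^ k) (2 * (s * 2 ^ k))) = ENNReal.ofReal (w k j) *
        (ENNReal.ofReal ((w k j)⁻¹) * pv 2 (Fl ℓ (s * 2 ^ k) (⇑(Pch n s m j f - Pch n s m (j+1) f)) x)
        (Icc (s * 2 ^ k) (2 * (s * 2 ^ k)))) := by
      intro j
      rw [← mul_assoc (ENNReal.ofReal (w k j)), ← ENNReal.ofReal_mul (hw0 k j).le, mul_inv_cancel₀ (hw0 k j).ne']
      simp
    rw [Finset.sum_congr rfl fun j _ => e2 j]
    refine (sum_cs _ _ _).trans (mul_le_mul' ?_ (Finset.sum_le_sum fun j _ => ?_))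
    · simp only [← ENNReal.ofReal_pow (hw0 k _).le]
      rw [← ENNReal.ofReal_sum_of_nonneg (fun j _ => by positivity),
        show (7 : ℝ≥0∞) = ENNReal.ofReal 7 by simp]
      refine ENNReal.ofReal_le_ofReal ?_
      have := sum_pow_nd_le (μ := 25/36) (by norm_num) (by norm_num) (Finset.range (m+2)) k
      refine le_trans (le_of_eq (Finset.sum_congr rfl fun j _ => ?_)) (this.trans (by norm_num))
      simp only [hw]
      rw [← pow_mul, mul_comm, pow_mul]; norm_num
    · rw [mul_pow, ← ENNReal.ofReal_pow (by positivity)]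
      exact mul_le_mul_right ((hΦ k j hk).1 x) _
  · set a : ℕ → ℝ := fun j => ‖Pch n s m j f - Pch n s m (j+1) f‖ ^ 2 with ha
    have ha0 : ∀ j, 0 ≤ a j := fun j => by positivity
    calc ∑ k ∈ Finset.range m, ∫⁻ x, 7 * ∑ j ∈ Finset.range (m + 2), ENNReal.ofReal ((w k j)⁻¹ ^ 2) * Φ k j x
        ≤ ∑ k ∈ Finset.range m, ENNReal.ofReal (∑ j ∈ Finset.range (m + 2), 14 * cX n * (18/25) ^ nd k j * a j) := by
          refine Finset.sum_le_sum fun k hk => ?_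
          rw [lintegral_const_mul _ (Finset.measurable_sum _ fun j _ => (hΦm k j).const_mul _),
            lintegral_finset_sum _ (fun j _ => (hΦm k j).const_mul _), Finset.mul_sum,
            ENNReal.ofReal_sum_of_nonneg (fun j _ => by have := ha0 j; positivity)]
          refine Finset.sum_le_sum fun j _ => ?_
          rw [lintegral_const_mul _ (hΦm k j)]
          refine (mul_le_mul_right (mul_le_mul_right (hΦ k j (Finset.mem_range.1 hk)).2 _) _).trans ?_
          rw [← ENNReal.ofReal_mul (by positivity), show (7 : ℝ≥0∞) = ENNReal.ofReal 7 by simp,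
            ← ENNReal.ofReal_mul (by positivity)]
          refine ENNReal.ofReal_le_ofReal (le_of_eq ?_)
          have e3 : (w k j)⁻¹ ^ 2 * (1/2) ^ nd k j = (18/25) ^ nd k j := by
            simp only [hw]
            rw [← inv_pow, ← pow_mul, mul_comm _ 2, pow_mul, ← mul_pow]; norm_num
          rw [← e3]; ring
      _ = ENNReal.ofReal (∑ k ∈ Finset.range m, ∑ j ∈ Finset.range (m + 2), 14 * cX n * (18/25) ^ nd k j * a j) := by
          rw [ENNReal.ofReal_sum_of_nonneg]
          intro k _
          exact Finset.sum_nonneg fun j _ => by have := ha0 j; positivity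
      _ ≤ _ := by
          refine ENNReal.ofReal_le_ofReal ?_
          rw [Finset.sum_comm, ← hP.sum_delta_sq f, Finset.mul_sum]
          refine Finset.sum_le_sum fun j _ => ?_
          rw [← Finset.sum_mul, ← Finset.mul_sum]
          refine mul_le_mul_of_nonneg_right ?_ (ha0 j)
          have := sum_pow_nd_le (μ := 18/25) (by norm_num) (by norm_num) (Finset.range m) j
          simp only [nd_comm j] at this
          norm_num at this
          nlinarith

end proj

section thmA
variable {n : ℕ} (ℓ : Fin n)

theorem Fl_split' {R t u : ℝ} {f : EE n → ℝ} {x : EE n} (hRt : R ≤ t) (htu : t ≤ u)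
    (hi : IntegrableOn (fun y => Kr ℓ (x - y) * f y) {y : EE n | R < ‖x - y‖ ∧ ‖x - y‖ ≤ u}) :
    Fl ℓ R f x u = Fl ℓ R f x t + Fl ℓ t f x u := by
  unfold Fl
  rw [← setIntegral_union ?_ (meas_ann x t u)]
  · congr 2
    ext y
    simp only [mem_union, mem_ofPred_eq]
    constructor
    · rintro ⟨h1, h2⟩
      rcases le_or_gt ‖x - y‖ t with h | h
      · exact Or.inl ⟨h1, h⟩
      · exact Or.inr ⟨h, h2⟩
    · rintro (⟨h1, h2⟩ | ⟨h1, h2⟩)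
      · exact ⟨h1, h2.trans htu⟩
      · exact ⟨hRt.trans_lt h1, h2⟩
  · exact hi.mono_set fun y hy => ⟨hy.1, hy.2.trans htu⟩
  · exact hi.mono_set fun y hy => ⟨hRt.trans_lt hy.1, hy.2⟩
  · exact Set.disjoint_left.2 fun y h1 h2 => absurd h1.2 (not_le.2 h2.1)

theorem Fl_split {R t u : ℝ} (hR : 0 < R) {f : EE n → ℝ} (hf : MemLp f 2) (x : EE n)
    (hRt : R ≤ t) (htu : t ≤ u) : Fl ℓ R f x u = Fl ℓ R f x t + Fl ℓ t f x u :=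
  Fl_split' ℓ hRt htu (Fl_int ℓ hR hf x)

theorem sq_le_young {q Q : ℝ≥0∞} {al : ℝ} (hal : 0 < al) (h : q ^ 2 ≤ Q) :
    q ≤ ENNReal.ofReal al + ENNReal.ofReal al⁻¹ * Q := by
  rcases le_total q (ENNReal.ofReal al) with h1 | h1
  · exact h1.trans le_self_add
  · refine le_trans ?_ le_add_self
    refine le_trans ?_ (mul_le_mul_right h _)
    rw [sq, ← mul_assoc]
    calc q = 1 * q := (one_mul q).symm
      _ ≤ _ := by
        refine mul_le_mul_left ?_ _
        refine le_trans ?_ (mul_le_mul_right h1 _)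
        rw [← ENNReal.ofReal_mul (by positivity), inv_mul_cancel₀ hal.ne']
        simp

/-- dyadic scale -/
def dsc (s t : ℝ) : ℕ := Nat.log 2 ⌊t / s⌋₊

theorem dsc_spec {s t : ℝ} (hs : 0 < s) (ht : s ≤ t) :
    s * 2 ^ dsc s t ≤ t ∧ t < s * 2 ^ (dsc s t + 1) := by
  have h1 : 1 ≤ t / s := by rw [le_div_iff₀ hs]; linarith
  have h2 : ⌊t / s⌋₊ ≠ 0 := (Nat.floor_pos.2 h1).ne'
  constructor
  · have a : ((2 ^ dsc s t : ℕ) : ℝ) ≤ t / s := by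
      rw [← Nat.le_floor_iff (by positivity)]
      exact Nat.pow_log_le_self 2 h2
    push_cast at a
    rw [le_div_iff₀ hs] at a; linarith
  · have a : t / s < ((2 ^ (dsc s t + 1) : ℕ) : ℝ) := by
      rw [← Nat.floor_lt (by positivity)]
      exact Nat.lt_pow_succ_log_self (by norm_num) _
    push_cast at a
    rw [div_lt_iff₀ hs] at a; linarith

theorem dsc_mono {s t u : ℝ} (hs : 0 < s) (h : t ≤ u) : dsc s t ≤ dsc s u := by
  unfold dsc
  refine Nat.log_mono_right (Nat.floor_mono ?_)
  gcongr

/-- constant in theorem A -/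
def cA (n : ℕ) (ρ : ℝ) : ℝ := 3 + 1008 * cX n + martConst ρ * cO n + 9 * cO n

theorem cA_pos (n : ℕ) {ρ : ℝ} (hρ : 2 < ρ) : 0 < cA n ρ := by
  have := cX_pos n; have := cO_nonneg n; have := martConst_nonneg ρ
  unfold cA; positivity

theorem pv_empty {ι : Type*} [Preorder ι] (p : ℝ) (F : ι → ℝ) (b : ℝ≥0∞) : pv p F ∅ ≤ b :=
  pv_le fun _ _ _ hs => absurd (hs 0) (by simp)

set_option maxHeartbeats 2000000 in
theorem thmA {ρ : ℝ} (hρ : 2 < ρ) (f : HH n) {s al : ℝ} (hs : 0 < s) (hal : 0 < al) (m : ℕ) :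
    ∃ Ψ : EE n → ℝ≥0∞, Measurable Ψ ∧
      (∀ x, pv ρ (Fl ℓ s f x) (Ico s (s * 2 ^ m)) ≤ ENNReal.ofReal (3 * al) + Ψ x) ∧
      ∫⁻ x, Ψ x ≤ ENNReal.ofReal (cA n ρ * al⁻¹ * ‖f‖ ^ 2) := by
  classical
  have hcX := cX_pos n
  have hcO := cO_nonneg n
  have hmC := martConst_nonneg ρ
  have hT : ∀ i : ℕ, ∃ T : HH n →L[ℝ] HH n,
    (∀ f : HH n, T f =ᵐ[volume] fun x => Fl ℓ (s * 2 ^ i) f x (2 * (s * 2 ^ i))) ∧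
    (∀ f g : HH n, inner ℝ (T f) g = - inner ℝ f (T g)) := fun i => exists_T ℓ (by positivity)
  choose T hTf hTa using hT
  obtain ⟨hg1, hg2⟩ := op_main ℓ hs m hTf hTa f
  set g := ∑ i ∈ Finset.range m, T i f with hg
  have hrep : ∀ k : ℕ, ∃ h : EE n → ℝ, Measurable[sig n (s * 2 ^ k)] h ∧ MemLp h 2 ∧
      Ed n (s * 2 ^ k) g =ᵐ[volume] h := fun k => lpMeas_rep (Ed_mem _ _)
  choose e he1 he2 he3 using hrep
  -- martingale
  have hM : L2Mart (fun t => sig n (s * 2 ^ (m - t))) (fun t => e (m - t)) (⇑g) volume :=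
    { mono := fun t t' htt => sig_anti s (by omega)
      le := fun t => sig_le _
      meas := fun t => (he1 _).stronglyMeasurable
      mem := fun t => he2 _
      memg := Lp.memLp g
      orth := by
        intro t d hd hdL
        have := Ed_perp (s * 2 ^ (m - t)) g d hd.measurable hdL
        rw [← this]
        refine integral_congr_ae ?_
        filter_upwards [he3 (m - t), Lp.coeFn_sub g (Ed n (s * 2 ^ (m - t)) g)] with x h1 h2
        rw [h2, Pi.sub_apply, h1, mul_comm] }
  obtain ⟨Ψ1, hΨ1m, hΨ1, hΨ1i⟩ := hM.variation hρ hal m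
  obtain ⟨Φ, hΦm, hΦ, hΦi⟩ := local_phi ℓ hs m f
  set Tf : ℕ → EE n → ℝ := fun i x => Fl ℓ (s * 2 ^ i) f x (2 * (s * 2 ^ i)) with hTf'
  set D : ℕ → EE n → ℝ := fun k x => ∑ i ∈ Finset.Ico k m, Tf i x - e k x with hD
  have hTfm : ∀ i, Measurable (Tf i) := fun i => Fl_meas ℓ (Lp.memLp f).1 _ _
  have hDm : ∀ k, Measurable (D k) := fun k =>
    (Finset.measurable_sum _ fun i _ => hTfm i).sub ((he1 k).mono (sig_le _) le_rfl)
  refine ⟨fun x => ENNReal.ofReal al⁻¹ * (9 * ∑ k ∈ Finset.range m, Φ k x) + Ψ1 x +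
    ENNReal.ofReal al⁻¹ * (9 * ∑ k ∈ Finset.range (m + 1), ‖D k x‖ₑ ^ 2), ?_, fun x => ?_, ?_⟩
  · have h1 : Measurable fun x => ∑ k ∈ Finset.range m, Φ k x :=
      Finset.measurable_sum _ fun i _ => hΦm i
    have h2 : Measurable fun x => ∑ k ∈ Finset.range (m + 1), ‖D k x‖ₑ ^ 2 :=
      Finset.measurable_sum _ fun i _ => (hDm i).enorm.pow_const 2
    exact (((h1.const_mul _).const_mul _).add hΨ1m).add ((h2.const_mul _).const_mul _)
  · obtain ⟨L, hL⟩ : ∃ L : ℝ → ℝ, L = fun t => Fl ℓ (s * 2 ^ dsc s t) f x t := ⟨_, rfl⟩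
    obtain ⟨S, hS⟩ : ∃ S : ℕ → ℝ, S = fun k => Fl ℓ s f x (s * 2 ^ k) := ⟨_, rfl⟩
    have hdm : ∀ t ∈ Ico s (s * 2 ^ m), dsc s t < m := by
      intro t ht
      by_contra hc
      push Not at hc
      have h1 := (dsc_spec hs ht.1).1
      have h2 : s * 2 ^ m ≤ s * 2 ^ dsc s t := by gcongr; norm_num
      linarith [ht.2]
    have hsplit : pv ρ (Fl ℓ s f x) (Ico s (s * 2 ^ m)) ≤
        pv ρ S (Iic m) + pv 2 L (Ico s (s * 2 ^ m)) := by
      have e1 : pv ρ (Fl ℓ s f x) (Ico s (s * 2 ^ m)) =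
          pv ρ (fun t => S (dsc s t) + L t) (Ico s (s * 2 ^ m)) := by
        have : ∀ t ∈ Ico s (s * 2 ^ m), Fl ℓ s f x t = S (dsc s t) + L t := fun t ht => by
          rw [hS, hL]
          exact Fl_split ℓ hs (Lp.memLp f) x
            (le_mul_of_one_le_right hs.le (one_le_pow₀ (by norm_num))) (dsc_spec hs ht.1).1
        refine pv_congr fun t ht t' ht' _ => ?_
        rw [this t ht, this t' ht']
      rw [e1]
      refine (pv_add_le (by linarith) _ _ _).trans (add_le_add ?_ ?_)
      · exact pv_comp_le ρ S (dsc s) (fun t _ t' _ h => dsc_mono hs h) fun t ht => (hdm t ht).le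
      · exact pv_anti_exp two_pos hρ.le _ _
    have hLb : pv 2 L (Ico s (s * 2 ^ m)) ^ 2 ≤ 9 * ∑ k ∈ Finset.range m, Φ k x := by
      have h := pv_cells two_pos L (Ico s (s * 2 ^ m)) (dsc s) (fun t _ t' _ h => dsc_mono hs h)
        (fun k => if k < m then pv 2 (Fl ℓ (s * 2 ^ k) f x) (Icc (s * 2 ^ k) (2 * (s * 2 ^ k))) else 0)
        ?_ ?_
      · rw [ENNReal.rpow_two] at h
        refine h.trans (mul_le_mul' (le_of_eq (by norm_num)) ?_)
        rw [tsum_eq_sum (s := Finset.range m)]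
        · refine Finset.sum_le_sum fun k hk => ?_
          rw [if_pos (Finset.mem_range.1 hk), ENNReal.rpow_two]
          exact hΦ k (Finset.mem_range.1 hk) x
        · intro k hk
          rw [if_neg (by simpa using hk)]; simp
      · intro k
        split_ifs with hk
        · have hsub : {t ∈ Ico s (s * 2 ^ m) | dsc s t = k} ⊆ Icc (s * 2 ^ k) (2 * (s * 2 ^ k)) := by
            rintro t ⟨ht, rfl⟩
            have := dsc_spec hs ht.1
            rw [pow_succ] at this
            exact ⟨this.1, by linarith [this.2]⟩
          refine le_trans (le_of_eq ?_) (pv_mono_set hsub)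
          refine pv_congr ?_
          rintro t ⟨ht, h1⟩ t' ⟨ht', h2⟩ _
          simp only [hL]
          rw [h1, h2]
        · have : {t ∈ Ico s (s * 2 ^ m) | dsc s t = k} = ∅ := by
            ext t
            simp only [mem_ofPred_eq, mem_empty_iff_false, iff_false]
            rintro ⟨ht, rfl⟩
            exact hk (hdm t ht)
          rw [this]; exact pv_empty _ _ _
      · intro t ht
        rw [if_pos (hdm t ht)]
        have := dsc_spec hs ht.1
        rw [pow_succ] at this
        rw [hL]
        exact Fl_le_pv ℓ two_pos (by positivity) _ _ ⟨this.1, by linarith [this.2]⟩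
    have hSk : ∀ k ≤ m, S k = ∑ i ∈ Finset.range k, Tf i x := by
      intro k hk
      induction k with
      | zero => simp [hS, Fl_self]
      | succ k ih =>
        rw [Finset.sum_range_succ, ← ih (by omega)]
        simp only [hS, hTf']
        rw [Fl_split ℓ hs (Lp.memLp f) x (t := s * 2 ^ k)
          (le_mul_of_one_le_right hs.le (one_le_pow₀ (by norm_num)))
          (by rw [pow_succ]; have : 0 < s * 2 ^ k := by positivity
              linarith), pow_succ, show s * (2 ^ k * 2) = 2 * (s * 2 ^ k) by ring]
    have hSD : pv ρ S (Iic m) ≤ pv ρ (fun k => e k x) (Iic m) + pv 2 (fun k => D k x) (Iic m) := by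
      have e1 : pv ρ S (Iic m) = pv ρ (fun k => -(e k x + D k x)) (Iic m) := by
        have : ∀ k ∈ Iic m, S k = (∑ i ∈ Finset.range m, Tf i x) + -(e k x + D k x) := by
          intro k hk
          rw [hSk k hk, ← Finset.sum_range_add_sum_Ico _ (show k ≤ m from hk)]
          simp only [hD]; ring
        refine pv_congr fun t ht t' ht' _ => ?_
        rw [this t ht, this t' ht']; ring
      rw [e1, pv_neg]
      refine (pv_add_le (by linarith) _ _ _).trans (add_le_add le_rfl ?_)
      exact pv_anti_exp two_pos hρ.le _ _
    have hDb : pv 2 (fun k => D k x) (Iic m) ^ 2 ≤ 9 * ∑ k ∈ Finset.range (m + 1), ‖D k x‖ₑ ^ 2 := by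
      have h := pv_cells two_pos (fun k => D k x) (Iic m) id (fun t _ t' _ h => h)
        (fun k => if k ≤ m then ‖D k x‖ₑ else 0) ?_ ?_
      · rw [ENNReal.rpow_two] at h
        refine h.trans (mul_le_mul' (le_of_eq (by norm_num)) ?_)
        rw [tsum_eq_sum (s := Finset.range (m + 1))]
        · refine Finset.sum_le_sum fun k hk => ?_
          rw [if_pos (by simpa [Nat.lt_succ_iff] using hk), ENNReal.rpow_two]
        · intro k hk
          rw [if_neg (by simpa [Nat.lt_succ_iff] using hk)]; simp
      · intro k
        refine le_trans (pv_le' (b := 0) two_pos fun N u _ hu => ?_) zero_le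
        have : ∀ i, u i = k := fun i => (hu i).2
        simp [this]
      · intro k hk
        rw [if_pos (show id k ≤ m from hk)]; rfl
    have hE : pv ρ (fun k => e k x) (Iic m) ≤ ENNReal.ofReal al + Ψ1 x := by
      refine le_trans ?_ (hΨ1 x)
      refine le_trans (le_of_eq ?_) (pv_reverse ρ (fun k => e (m - k) x) m)
      refine pv_congr fun t ht t' ht' _ => ?_
      have a1 : m - (m - t) = t := by have : t ≤ m := ht; omega
      have a2 : m - (m - t') = t' := by have : t' ≤ m := ht'; omega
      rw [a1, a2]
    calc pv ρ (Fl ℓ s f x) (Ico s (s * 2 ^ m))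
        ≤ (pv ρ (fun k => e k x) (Iic m) + pv 2 (fun k => D k x) (Iic m)) +
          pv 2 L (Ico s (s * 2 ^ m)) := hsplit.trans (add_le_add hSD le_rfl)
      _ ≤ ((ENNReal.ofReal al + Ψ1 x) + (ENNReal.ofReal al + ENNReal.ofReal al⁻¹ * (9 * ∑ k ∈ Finset.range (m + 1), ‖D k x‖ₑ ^ 2)))
          + (ENNReal.ofReal al + ENNReal.ofReal al⁻¹ * (9 * ∑ k ∈ Finset.range m, Φ k x)) :=
        add_le_add (add_le_add hE (sq_le_young hal hDb)) (sq_le_young hal hLb)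
      _ = _ := by
        rw [show 3 * al = al + al + al by ring, ENNReal.ofReal_add (by positivity) hal.le,
          ENNReal.ofReal_add hal.le hal.le]
        ring
  · have h1 : Measurable fun x => ∑ k ∈ Finset.range m, Φ k x :=
      Finset.measurable_sum _ fun i _ => hΦm i
    have h2 : Measurable fun x => ∑ k ∈ Finset.range (m + 1), ‖D k x‖ₑ ^ 2 :=
      Finset.measurable_sum _ fun i _ => (hDm i).enorm.pow_const 2
    have hDi : ∀ k, ∫⁻ x, ‖D k x‖ₑ ^ 2 = ENNReal.ofReal (‖∑ i ∈ Finset.Ico k m, T i f -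
      Ed n (s * 2 ^ k) g‖ ^ 2) := by
      intro k
      rw [lp_norm_sq]
      refine lintegral_congr_ae ?_
      have hall : ∀ᵐ x ∂(volume : Measure (EE n)), ∀ i, T i f x = Tf i x := ae_all_iff.2 fun i => hTf i f
      filter_upwards [hall, he3 k, Lp.coeFn_sub (∑ i ∈ Finset.Ico k m, T i f) (Ed n (s * 2 ^ k) g),
        Lp.coeFn_finsetSum (Finset.Ico k m) (fun i => T i f)] with x a1 a2 a3 a4
      rw [a3, Pi.sub_apply, a4, a2]
      simp only [hD]
      congr 3
      simp [a1]
    have hgi : ∫ x, g x ^ 2 = ‖g‖ ^ 2 := by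
      rw [← real_inner_self_eq_norm_sq, L2.inner_def]
      congr 1; ext x; simp [sq]
    rw [lintegral_add_right _ ((h2.const_mul _).const_mul _), lintegral_add_right _ hΨ1m,
      lintegral_const_mul _ (h1.const_mul _), lintegral_const_mul _ h1,
      lintegral_const_mul _ (h2.const_mul _), lintegral_const_mul _ h2,
      lintegral_finset_sum _ (fun i _ => hΦm i),
      lintegral_finset_sum _ (fun i _ => (hDm i).enorm.pow_const 2)]
    simp only [hDi]
    rw [← ENNReal.ofReal_sum_of_nonneg (fun i _ => by positivity)]
    rw [hgi] at hΨ1i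
    calc _ ≤ ENNReal.ofReal al⁻¹ * (ENNReal.ofReal 9 * ENNReal.ofReal (112 * cX n * ‖f‖ ^ 2)) +
          ENNReal.ofReal (martConst ρ * al⁻¹ * (cO n * ‖f‖ ^ 2)) +
          ENNReal.ofReal al⁻¹ * (ENNReal.ofReal 9 * ENNReal.ofReal (cO n * ‖f‖ ^ 2)) := by
          rw [show ENNReal.ofReal 9 = 9 by simp]
          gcongr
          refine hΨ1i.trans (ENNReal.ofReal_le_ofReal ?_)
          gcongr
      _ = ENNReal.ofReal ((1008 * cX n + martConst ρ * cO n + 9 * cO n) * al⁻¹ * ‖f‖ ^ 2) := by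
          rw [← ENNReal.ofReal_mul (by norm_num), ← ENNReal.ofReal_mul (by positivity),
            ← ENNReal.ofReal_mul (by norm_num), ← ENNReal.ofReal_mul (by positivity),
            ← ENNReal.ofReal_add (by positivity) (by positivity),
            ← ENNReal.ofReal_add (by positivity) (by positivity)]
          congr 1; ring
      _ ≤ _ := by
          refine ENNReal.ofReal_le_ofReal ?_
          unfold cA
          gcongr
          linarith

end thmA

section limit
variable {n : ℕ} (ℓ : Fin n)

theorem thmB {ρ : ℝ} (hρ : 2 < ρ) (f : HH n) {al : ℝ} (hal : 0 < al) :
    ∃ Ψ : EE n → ℝ≥0∞, Measurable Ψ ∧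
      (∀ x, ∀ N : ℕ, pv ρ (Fl ℓ ((2:ℝ) ^ N)⁻¹ f x) (Ico ((2:ℝ) ^ N)⁻¹ (2 ^ N)) ≤
        ENNReal.ofReal (3 * al) + Ψ x) ∧
      ∫⁻ x, Ψ x ≤ ENNReal.ofReal (cA n ρ * al⁻¹ * ‖f‖ ^ 2) := by
  have h : ∀ N : ℕ, ∃ Ψ : EE n → ℝ≥0∞, Measurable Ψ ∧
      (∀ x, pv ρ (Fl ℓ ((2:ℝ) ^ N)⁻¹ f x) (Ico ((2:ℝ) ^ N)⁻¹ (((2:ℝ) ^ N)⁻¹ * 2 ^ (2 * N))) ≤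
        ENNReal.ofReal (3 * al) + Ψ x) ∧
      ∫⁻ x, Ψ x ≤ ENNReal.ofReal (cA n ρ * al⁻¹ * ‖f‖ ^ 2) :=
    fun N => thmA ℓ hρ f (by positivity) hal (2 * N)
  choose Ψ hm hp hi using h
  have e : ∀ N : ℕ, ((2:ℝ) ^ N)⁻¹ * 2 ^ (2 * N) = 2 ^ N := fun N => by
    rw [two_mul, pow_add]; field_simp
  simp only [e] at hp
  have hmono : ∀ x, ∀ N N' : ℕ, N ≤ N' →
      pv ρ (Fl ℓ ((2:ℝ) ^ N)⁻¹ f x) (Ico ((2:ℝ) ^ N)⁻¹ (2 ^ N)) ≤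
      pv ρ (Fl ℓ ((2:ℝ) ^ N')⁻¹ f x) (Ico ((2:ℝ) ^ N')⁻¹ (2 ^ N')) := by
    intro x N N' hN
    have h2 : (2:ℝ) ^ N ≤ 2 ^ N' := pow_le_pow_right₀ (by norm_num) hN
    have h1 : ((2:ℝ) ^ N')⁻¹ ≤ ((2:ℝ) ^ N)⁻¹ := inv_anti₀ (by positivity) h2
    refine le_trans (le_of_eq ?_) (pv_mono_set (Ico_subset_Ico h1 h2))
    refine pv_congr fun t ht t' ht' _ => ?_
    rw [Fl_split ℓ (by positivity : 0 < ((2:ℝ) ^ N')⁻¹) (Lp.memLp f) x h1 ht.1,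
      Fl_split ℓ (by positivity : 0 < ((2:ℝ) ^ N')⁻¹) (Lp.memLp f) x h1 ht'.1]
    ring
  refine ⟨fun x => liminf (fun N => Ψ N x) atTop, Measurable.liminf hm, fun x N => ?_, ?_⟩
  · rw [← tsub_le_iff_left]
    refine le_liminf_of_le (by isBoundedDefault) ?_
    filter_upwards [eventually_ge_atTop N] with N' hN'
    rw [tsub_le_iff_left]
    exact (hmono x N N' hN').trans (hp N' x)
  · refine (lintegral_liminf_le hm).trans ?_
    refine liminf_le_of_le (by isBoundedDefault) fun b hb => ?_
    obtain ⟨N, hN⟩ := hb.exists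
    exact hN.trans (hi N)

theorem tr_eq {a : ℝ} (ha : 0 < a) (ε : ℝ) (f : EE n → ℝ) (x : EE n) :
    truncRiesz n ℓ a ε f x = Fl ℓ ε f x a := by
  unfold truncRiesz Fl
  have e : ({y : EE n | ε < ‖x - y‖ ∧ ‖x - y‖ < a} : Set (EE n)) =ᵐ[volume]
      {y : EE n | ε < ‖x - y‖ ∧ ‖x - y‖ ≤ a} := by
    have h0 : volume (Metric.sphere x a) = 0 := Measure.addHaar_sphere_of_ne_zero _ _ ha.ne'
    rw [← compl_mem_ae_iff] at h0
    filter_upwards [h0] with y hy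
    have hy' : ‖x - y‖ ≠ a := by
      intro h; apply hy; simpa [dist_eq_norm, norm_sub_rev] using h
    refine propext ⟨fun h => ⟨h.1, h.2.le⟩, fun h => ⟨h.1, lt_of_le_of_ne h.2 hy'⟩⟩
  rw [setIntegral_congr_set e]
  rfl

theorem Fl_empty {R S : ℝ} (h : S ≤ R) (f : EE n → ℝ) (x : EE n) : Fl ℓ R f x S = 0 := by
  unfold Fl
  have : {y : EE n | R < ‖x - y‖ ∧ ‖x - y‖ ≤ S} = ∅ := by
    ext y; simp only [mem_ofPred_eq, mem_empty_iff_false, iff_false]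
    rintro ⟨h1, h2⟩; linarith
  rw [this]; simp

theorem pv_tr {p : ℝ} {a : ℝ} (ha : 0 < a) {f : EE n → ℝ} (hf : MemLp f 2) (x : EE n) {b : ℝ≥0∞}
    (h : ∀ N : ℕ, pv p (Fl ℓ ((2:ℝ) ^ N)⁻¹ f x) (Ico ((2:ℝ) ^ N)⁻¹ (2 ^ N)) ≤ b) :
    pv p (fun ε => truncRiesz n ℓ a ε f x) (Ioi 0) ≤ b := by
  refine pv_le fun N u hu hs => ?_
  obtain ⟨N1, hN1⟩ := pow_unbounded_of_one_lt (max (a + 1) (max a⁻¹ (u 0)⁻¹)) (one_lt_two (α := ℝ))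
  have k1 : a < 2 ^ N1 := by linarith [le_max_left (a + 1) (max a⁻¹ (u 0)⁻¹)]
  have k2 : ((2:ℝ) ^ N1)⁻¹ ≤ a := by
    rw [inv_le_comm₀ (by positivity) ha]
    exact ((le_max_left _ _).trans (le_max_right _ _)).trans hN1.le
  have k3 : ((2:ℝ) ^ N1)⁻¹ ≤ u 0 := by
    rw [inv_le_comm₀ (by positivity) (hs 0)]
    exact ((le_max_right _ _).trans (le_max_right _ _)).trans hN1.le
  have hN' := h N1
  set s := ((2:ℝ) ^ N1)⁻¹ with hsd
  have hs0 : 0 < s := by positivity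
  have key : ∀ ε, s ≤ ε → truncRiesz n ℓ a ε f x = Fl ℓ s f x a - Fl ℓ s f x (min ε a) := by
    intro ε hε
    rw [tr_eq ℓ ha]
    rcases le_total ε a with h1 | h1
    · rw [min_eq_left h1, Fl_split ℓ hs0 hf x hε h1]; ring
    · rw [min_eq_right h1, Fl_empty ℓ h1]; ring
  have hus : ∀ i, s ≤ u i := fun i => k3.trans (hu (Nat.zero_le i))
  refine le_trans ?_ ((le_pv p (Fl ℓ s f x) (s := Ico s (2 ^ N1)) N (u := fun i => min (u i) a)
    (fun i j hij => min_le_min_right _ (hu hij))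
    fun i => ⟨le_min (hus i) k2, (min_le_right _ _).trans_lt k1⟩).trans hN')
  refine le_of_eq ?_
  congr 2
  ext i
  rw [key _ (hus _), key _ (hus _)]
  congr 1
  rw [sub_sub_sub_cancel_left, ← enorm_neg, neg_sub]

theorem eVar_le_pv {p : ℝ} (hp : 0 < p) (F : ℝ → ℝ) : eVar p F ≤ pv p F (Ioi 0) := by
  refine iSup_le ?_
  rintro ⟨t, ht1, ht2, ht3⟩
  rw [one_div, ENNReal.rpow_inv_le_iff hp]
  rw [ENNReal.tsum_eq_iSup_nat]
  refine iSup_le fun N => ?_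
  refine le_trans (le_of_eq ?_) (sum_le_pv hp F N (u := fun i => t (N - i))
    (fun i j hij => ht1.antitone (by omega)) fun i => ht2 _)
  rw [← Finset.sum_range_reflect]
  refine Finset.sum_congr rfl fun i hi => ?_
  have hi := Finset.mem_range.1 hi
  have e1 : N - 1 - i = N - (i + 1) := by omega
  have e2 : N - 1 - i + 1 = N - i := by omega
  simp only [e2]
  rw [e1, ← Real.norm_eq_abs, ← ENNReal.ofReal_rpow_of_nonneg (norm_nonneg _) hp.le, ofReal_norm]

theorem eVar_add_le {p : ℝ} (hp : 1 ≤ p) (F G : ℝ → ℝ) :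
    eVar p (fun t => F t + G t) ≤ eVar p F + eVar p G := by
  have hp0 : 0 < p := by linarith
  refine iSup_le fun t => ?_
  refine le_trans ?_ (add_le_add (le_iSup (fun t : {t : ℕ → ℝ // NullSeq t} =>
    (∑' j : ℕ, ENNReal.ofReal (|F (t.1 j) - F (t.1 (j + 1))| ^ p)) ^ (1 / p)) t)
    (le_iSup (fun t : {t : ℕ → ℝ // NullSeq t} =>
    (∑' j : ℕ, ENNReal.ofReal (|G (t.1 j) - G (t.1 (j + 1))| ^ p)) ^ (1 / p)) t))
  have e : ∀ v : ℝ, ENNReal.ofReal (|v| ^ p) = ‖v‖ₑ ^ p := fun v => by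
    rw [← Real.norm_eq_abs, ← ENNReal.ofReal_rpow_of_nonneg (norm_nonneg _) hp0.le, ofReal_norm]
  simp only [e]
  rw [one_div, ENNReal.rpow_inv_le_iff hp0, ENNReal.tsum_eq_iSup_nat]
  refine iSup_le fun N => ?_
  rw [← ENNReal.rpow_inv_le_iff hp0, ← one_div]
  refine le_trans (b := (∑ i ∈ Finset.range N, (‖F (t.1 i) - F (t.1 (i + 1))‖ₑ +
    ‖G (t.1 i) - G (t.1 (i + 1))‖ₑ) ^ p) ^ (1 / p)) ?_ ?_
  · gcongr with i
    refine le_trans (le_of_eq ?_) (enorm_add_le _ _)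
    congr 1; ring
  · refine (ENNReal.Lp_add_le _ _ _ hp).trans ?_
    gcongr <;> exact ENNReal.sum_le_tsum _

theorem eVar_neg (p : ℝ) (F : ℝ → ℝ) : eVar p (fun t => - F t) = eVar p F := by
  unfold eVar
  congr 1; ext t; congr 2; ext j
  rw [← abs_neg]; congr 3; ring

theorem eVar_diff {p : ℝ} (hp : 1 ≤ p) (F G : ℝ → ℝ) (hG : eVar p G ≠ ∞) :
    ENNReal.ofReal |(eVar p F).toReal - (eVar p G).toReal| ≤ eVar p (fun t => F t - G t) := by
  by_cases hD : eVar p (fun t => F t - G t) = ∞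
  · rw [hD]; exact le_top
  have h1 : eVar p F ≤ eVar p G + eVar p (fun t => F t - G t) := by
    have := eVar_add_le hp G (fun t => F t - G t)
    simpa using this
  have h2 : eVar p G ≤ eVar p F + eVar p (fun t => F t - G t) := by
    have := eVar_add_le hp F (fun t => -(F t - G t))
    rw [eVar_neg] at this
    simpa using this
  have hF : eVar p F ≠ ∞ := ne_top_of_le_ne_top (ENNReal.add_ne_top.2 ⟨hG, hD⟩) h1
  refine ENNReal.ofReal_le_of_le_toReal ?_
  rw [abs_sub_le_iff]
  have h1' := ENNReal.toReal_mono (ENNReal.add_ne_top.2 ⟨hG, hD⟩) h1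
  have h2' := ENNReal.toReal_mono (ENNReal.add_ne_top.2 ⟨hF, hD⟩) h2
  rw [ENNReal.toReal_add hG hD] at h1'
  rw [ENNReal.toReal_add hF hD] at h2'
  constructor <;> linarith

end limit

section JN
variable {n : ℕ}

theorem vol_cball (x : EE n) {r : ℝ} (hr : 0 < r) :
    volume (Metric.closedBall x r) = ENNReal.ofReal (om n * r ^ n) := by
  rw [Measure.addHaar_closedBall _ _ hr.le, mul_comm (om n), ENNReal.ofReal_mul (by positivity), om,
    ENNReal.ofReal_toReal measure_ball_lt_top.ne]
  simp

/-- average over a ball -/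
def av (f : EE n → ℝ) (x : EE n) (r : ℝ) : ℝ := avgOn f (Metric.ball x r)

theorem li_cball {f : EE n → ℝ} (hf : LocallyIntegrable f volume) (x : EE n) (r : ℝ) :
    IntegrableOn f (Metric.closedBall x r) :=
  hf.integrableOn_isCompact (isCompact_closedBall x r)

theorem li_ball {f : EE n → ℝ} (hf : LocallyIntegrable f volume) (x : EE n) (r : ℝ) :
    IntegrableOn f (Metric.ball x r) := (li_cball hf x r).mono_set Metric.ball_subset_closedBall

theorem const_ball (c : ℝ) (x : EE n) (r : ℝ) : IntegrableOn (fun _ => c) (Metric.ball x r) :=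
  integrableOn_const measure_ball_lt_top.ne

theorem bmo_lint {f : EE n → ℝ} (hf : LocallyIntegrable f volume) {M : ℝ} (hb : IsBMOWith f M)
    (x : EE n) {r : ℝ} (hr : 0 < r) :
    ∫⁻ y in Metric.ball x r, ‖f y - av f x r‖ₑ ≤ ENNReal.ofReal M * ENNReal.ofReal (om n * r ^ n) := by
  have h := hb x r hr
  have ho := om_pos n
  rw [vol_ball x hr, ENNReal.toReal_ofReal (by positivity), inv_mul_le_iff₀ (by positivity)] at h
  rw [← ofReal_integral_norm_eq_lintegral_enorm (f := fun y => f y - av f x r)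
    ((li_ball hf x r).sub (const_ball _ x r)),
    ← ENNReal.ofReal_mul' (by positivity)]
  refine ENNReal.ofReal_le_ofReal ?_
  simp only [Real.norm_eq_abs]
  rw [mul_comm M]
  exact h

theorem av_sub {f : EE n → ℝ} (hf : LocallyIntegrable f volume) (x : EE n) {r : ℝ} (hr : 0 < r)
    (c : ℝ) : ‖av f x r - c‖ₑ * ENNReal.ofReal (om n * r ^ n) ≤ ∫⁻ y in Metric.ball x r, ‖f y - c‖ₑ := by
  have ho := om_pos n
  refine le_trans (le_of_eq ?_) (enorm_integral_le_lintegral_enorm _)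
  rw [integral_sub (li_ball hf x r) (const_ball _ x r), ← ofReal_norm, ← ofReal_norm,
    ← ENNReal.ofReal_mul (norm_nonneg _)]
  congr 1
  have hp : 0 < om n * r ^ n := by positivity
  rw [← abs_of_pos hp, ← Real.norm_eq_abs, ← norm_mul, av, avgOn, setIntegral_const, measureReal_def,
    vol_ball x hr, ENNReal.toReal_ofReal hp.le, smul_eq_mul]
  congr 1
  field_simp

theorem av_sub_le {f : EE n → ℝ} (hf : LocallyIntegrable f volume) (x : EE n) {r : ℝ} (hr : 0 < r)
    {c C : ℝ} (hC : 0 ≤ C) (h : ∫⁻ y in Metric.ball x r, ‖f y - c‖ₑ ≤ ENNReal.ofReal C * ENNReal.ofReal (om n * r ^ n)) :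
    |av f x r - c| ≤ C := by
  have ho := om_pos n
  have := (av_sub hf x hr c).trans h
  rw [ENNReal.mul_le_mul_iff_left (by simpa using (by positivity : 0 < om n * r ^ n)) ENNReal.ofReal_ne_top,
    ← ofReal_norm, ENNReal.ofReal_le_ofReal_iff hC] at this
  exact this

theorem av_dbl {f : EE n → ℝ} (hf : LocallyIntegrable f volume) {M : ℝ} (hM : 0 ≤ M) (hb : IsBMOWith f M)
    (x : EE n) {r : ℝ} (hr : 0 < r) : |av f x r - av f x (2 * r)| ≤ 2 ^ n * M := by
  refine av_sub_le hf x hr (by positivity) ?_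
  refine (lintegral_mono_set (Metric.ball_subset_ball (by linarith : r ≤ 2 * r))).trans ?_
  refine (bmo_lint hf hb x (by positivity)).trans (le_of_eq ?_)
  have ho := om_pos n
  rw [← ENNReal.ofReal_mul' (by positivity), ← ENNReal.ofReal_mul' (by positivity)]
  congr 1; rw [mul_pow]; ring

theorem av_grow {f : EE n → ℝ} (hf : LocallyIntegrable f volume) {M : ℝ} (hM : 0 ≤ M) (hb : IsBMOWith f M)
    (x : EE n) {r : ℝ} (hr : 0 < r) (k : ℕ) : |av f x r - av f x (2 ^ k * r)| ≤ k * (2 ^ n * M) := by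
  induction k with
  | zero => simp
  | succ k ih =>
    have := av_dbl hf hM hb x (r := 2 ^ k * r) (by positivity)
    rw [← mul_assoc, ← pow_succ'] at this
    have h3 := abs_sub_le (av f x r) (av f x (2 ^ k * r)) (av f x (2 ^ (k + 1) * r))
    push_cast; linarith

theorem dbl_lint {f : EE n → ℝ} (hf : LocallyIntegrable f volume) {M : ℝ} (hM : 0 ≤ M) (hb : IsBMOWith f M)
    (x : EE n) {r : ℝ} (hr : 0 < r) :
    ∫⁻ y in Metric.ball x (2 * r), ‖f y - av f x r‖ₑ ≤
      ENNReal.ofReal (2 * 4 ^ n * M) * ENNReal.ofReal (om n * r ^ n) := by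
  have ho := om_pos n
  have h1 := bmo_lint hf hb x (r := 2 * r) (by positivity)
  have h2 := av_dbl hf hM hb x hr
  calc ∫⁻ y in Metric.ball x (2 * r), ‖f y - av f x r‖ₑ
      ≤ ∫⁻ y in Metric.ball x (2 * r), (‖f y - av f x (2 * r)‖ₑ + ENNReal.ofReal (2 ^ n * M)) := by
        refine lintegral_mono fun y => ?_
        have e : f y - av f x r = (f y - av f x (2 * r)) + (av f x (2 * r) - av f x r) := by ring
        rw [e]
        refine (enorm_add_le _ _).trans (add_le_add le_rfl ?_)
        rw [← ofReal_norm, Real.norm_eq_abs, abs_sub_comm]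
        exact ENNReal.ofReal_le_ofReal h2
    _ ≤ ENNReal.ofReal M * ENNReal.ofReal (om n * (2 * r) ^ n) + ENNReal.ofReal (2 ^ n * M) * ENNReal.ofReal (om n * (2 * r) ^ n) := by
        rw [lintegral_add_right _ measurable_const, setLIntegral_const, vol_ball x (by positivity)]
        exact add_le_add h1 le_rfl
    _ ≤ _ := by
        rw [← add_mul, ← ENNReal.ofReal_add hM (by positivity), ← ENNReal.ofReal_mul (by positivity),
          ← ENNReal.ofReal_mul (by positivity)]
        refine ENNReal.ofReal_le_ofReal ?_
        have h4 : (4:ℝ) ^ n = 2 ^ n * 2 ^ n := by rw [← mul_pow]; norm_num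
        have h5 : (1:ℝ) ≤ 2 ^ n := one_le_pow₀ (by norm_num)
        rw [mul_pow, h4]
        have : M ≤ 2 ^ n * M := by nlinarith
        calc (M + 2 ^ n * M) * (om n * (2 ^ n * r ^ n)) ≤ (2 ^ n * M + 2 ^ n * M) * (om n * (2 ^ n * r ^ n)) := by gcongr
          _ = _ := by ring

theorem leb_pt {f : EE n → ℝ} (hf : LocallyIntegrable f volume) (c : ℝ) {r : ℝ} (hr : 0 < r) {K : ℝ} (hK : 0 ≤ K) :
    ∀ᵐ y ∂(volume : Measure (EE n)), (∀ k : ℕ, ∫⁻ z in Metric.closedBall y (r / 5 ^ k), ‖f z - c‖ₑ ≤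
      ENNReal.ofReal K * ENNReal.ofReal (om n * (r / 5 ^ k) ^ n)) → |f y - c| ≤ K := by
  have hg : LocallyIntegrable (fun y => ‖f y - c‖) (volume : Measure (EE n)) :=
    fun y => (hf.sub (locallyIntegrable_const c) y).norm
  filter_upwards [IsUnifLocDoublingMeasure.ae_tendsto_average volume hg 1] with y hy hk
  have hδ : Tendsto (fun k : ℕ => r / 5 ^ k) atTop (nhdsWithin 0 (Ioi 0)) := by
    rw [tendsto_nhdsWithin_iff]
    constructor
    · have := (tendsto_pow_atTop_nhds_zero_of_lt_one (r := (5:ℝ)⁻¹) (by norm_num) (by norm_num)).const_mul r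
      simpa [div_eq_mul_inv] using this
    · exact Eventually.of_forall fun k => by simp only [mem_Ioi]; positivity
  have ht := hy (fun _ => y) (fun k : ℕ => r / 5 ^ k) hδ (Eventually.of_forall fun k => by
    simp only [Metric.mem_closedBall, dist_self]; positivity)
  refine le_of_tendsto' ht fun k => ?_
  have ho := om_pos n
  have hp : 0 < om n * (r / 5 ^ k) ^ n := by positivity
  rw [setAverage_eq, measureReal_def, vol_cball y (by positivity), ENNReal.toReal_ofReal hp.le, smul_eq_mul,
    inv_mul_le_iff₀ hp]
  have h := hk k
  rw [← ofReal_integral_norm_eq_lintegral_enorm, ← ENNReal.ofReal_mul hK,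
    ENNReal.ofReal_le_ofReal_iff (by positivity)] at h
  · linarith
  · exact (li_cball hf y _).sub (integrableOn_const measure_closedBall_lt_top.ne)

/-- JN increment -/
def cN (n : ℕ) : ℝ := 4 * 20 ^ n

theorem cN_pos (n : ℕ) : 0 < cN n := by unfold cN; positivity

theorem jn_step {f : EE n → ℝ} (hf : LocallyIntegrable f volume) {M : ℝ} (hM : 0 < M) (hb : IsBMOWith f M)
    {lam : ℝ} (hlam : 0 ≤ lam) {q : ℝ≥0∞}
    (hq : ∀ (x : EE n) (r : ℝ), 0 < r → volume {y ∈ Metric.ball x r | lam < |f y - av f x r|} ≤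
      q * ENNReal.ofReal (om n * r ^ n)) (x : EE n) {r : ℝ} (hr : 0 < r) :
    volume {y ∈ Metric.ball x r | lam + cN n * M < |f y - av f x r|} ≤
      q * ENNReal.ofReal (1 / 2) * ENNReal.ofReal (om n * r ^ n) := by
  have ho := om_pos n
  set K := cN n * M with hK
  have hKp : 0 < K := by unfold K cN; positivity
  set c := av f x r with hc
  set E : Set (EE n) := {y ∈ Metric.ball x r | lam + K < |f y - c|} with hE
  obtain hleb := leb_pt hf c hr hKp.le
  set L : Set (EE n) := {y | (∀ k : ℕ, ∫⁻ z in Metric.closedBall y (r / 5 ^ k), ‖f z - c‖ₑ ≤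
      ENNReal.ofReal K * ENNReal.ofReal (om n * (r / 5 ^ k) ^ n)) → |f y - c| ≤ K} with hL
  have hEL : volume E = volume (E ∩ L) := by
    rw [measure_inter_conull]
    exact hleb
  have hst : ∀ y ∈ E ∩ L, ∃ s : ℝ, 0 < s ∧ s ≤ r ∧
      ENNReal.ofReal K * ENNReal.ofReal (om n * s ^ n) ≤ ∫⁻ z in Metric.closedBall y s, ‖f z - c‖ₑ ∧
      ∫⁻ z in Metric.closedBall y (5 * s), ‖f z - c‖ₑ ≤
        ENNReal.ofReal K * ENNReal.ofReal (om n * (5 * s) ^ n) := by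
    rintro y ⟨⟨hy1, hy2⟩, hyL⟩
    classical
    have hex : ∃ k : ℕ, ¬ (∫⁻ z in Metric.closedBall y (r / 5 ^ k), ‖f z - c‖ₑ ≤
      ENNReal.ofReal K * ENNReal.ofReal (om n * (r / 5 ^ k) ^ n)) := by
      by_contra hcon
      push Not at hcon
      have := hyL hcon
      linarith
    obtain ⟨k, hk1, hk2⟩ : ∃ k : ℕ, ¬ (∫⁻ z in Metric.closedBall y (r / 5 ^ k), ‖f z - c‖ₑ ≤
      ENNReal.ofReal K * ENNReal.ofReal (om n * (r / 5 ^ k) ^ n)) ∧ ∀ j < k,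
        (∫⁻ z in Metric.closedBall y (r / 5 ^ j), ‖f z - c‖ₑ ≤
      ENNReal.ofReal K * ENNReal.ofReal (om n * (r / 5 ^ j) ^ n)) :=
      ⟨Nat.find hex, Nat.find_spec hex, fun j hj => not_not.1 (Nat.find_min hex hj)⟩
    rcases k with _ | k
    · exfalso
      apply hk1
      simp only [pow_zero, div_one]
      have hsub : Metric.closedBall y r ⊆ Metric.ball x (2 * r) := by
        intro z hz
        rw [Metric.mem_ball] at hy1 ⊢
        rw [Metric.mem_closedBall] at hz
        linarith [dist_triangle z y x]
      refine (lintegral_mono_set hsub).trans ((dbl_lint hf hM.le hb x hr).trans ?_)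
      gcongr
      unfold K cN
      have : (4:ℝ) ^ n ≤ 20 ^ n := by gcongr; norm_num
      have h4 : (0:ℝ) ≤ 4 ^ n := by positivity
      exact mul_le_mul_of_nonneg_right (by linarith) hM.le
    · refine ⟨r / 5 ^ (k + 1), by positivity, ?_, (not_le.1 hk1).le, ?_⟩
      · exact div_le_self hr.le (one_le_pow₀ (by norm_num))
      · have e : 5 * (r / 5 ^ (k + 1)) = r / 5 ^ k := by rw [pow_succ]; field_simp
        rw [e]; exact hk2 k (by omega)
  choose! s hs0 hsr hs1 hs2 using hst
  obtain ⟨u, huE, hud, huc⟩ := Vitali.exists_disjoint_subfamily_covering_enlargement_closedBall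
    (E ∩ L) (fun y => y) s r hsr 4 (by norm_num)
  have hcnt : u.Countable := hud.countable_of_nonempty_interior fun i hi => by
    refine ⟨i, mem_interior.2 ⟨Metric.ball i (s i), Metric.ball_subset_closedBall, Metric.isOpen_ball,
      Metric.mem_ball_self (hs0 i (huE hi))⟩⟩
  have hcov : E ∩ L ⊆ ⋃ b ∈ u, {y ∈ Metric.ball b (5 * s b) | lam < |f y - av f b (5 * s b)|} := by
    intro y hy
    obtain ⟨b, hbu, hbs⟩ := huc y hy
    have hb0 := hs0 b (huE hbu)
    have h1 := hbs (Metric.mem_closedBall_self (hs0 y hy).le)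
    simp only [mem_iUnion, mem_ofPred_eq]
    refine ⟨b, hbu, ?_, ?_⟩
    · rw [Metric.mem_ball]; rw [Metric.mem_closedBall] at h1; linarith
    · have h2 : |av f b (5 * s b) - c| ≤ K := by
        refine av_sub_le hf b (by positivity) hKp.le ?_
        exact (lintegral_mono_set Metric.ball_subset_closedBall).trans (hs2 b (huE hbu))
      have h3 := hy.1.2
      have h4 := abs_sub_le (f y) (av f b (5 * s b)) c
      linarith
  have hsum : ENNReal.ofReal K * ∑' b : u, ENNReal.ofReal (om n * s b ^ n) ≤
      ENNReal.ofReal (2 * 4 ^ n * M) * ENNReal.ofReal (om n * r ^ n) := by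
    rw [← ENNReal.tsum_mul_left]
    refine le_trans (ENNReal.tsum_le_tsum fun b => hs1 b (huE b.2)) ?_
    rw [← lintegral_biUnion hcnt (fun i _ => Metric.isClosed_closedBall.measurableSet) hud]
    refine (lintegral_mono_set ?_).trans (dbl_lint hf hM.le hb x hr)
    intro z hz
    simp only [mem_iUnion] at hz
    obtain ⟨b, hbu, hz⟩ := hz
    have h1 := (huE hbu).1.1
    have h2 := hsr b (huE hbu)
    rw [Metric.mem_ball] at h1 ⊢
    rw [Metric.mem_closedBall] at hz
    linarith [dist_triangle z b x]
  calc volume E ≤ ∑' b : u, q * ENNReal.ofReal (om n * (5 * s b) ^ n) := by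
        rw [hEL]
        refine (measure_mono hcov).trans ((measure_biUnion_le _ hcnt _).trans ?_)
        exact ENNReal.tsum_le_tsum fun b => hq b _ (by have := hs0 b (huE b.2); positivity)
    _ = q * (ENNReal.ofReal (5 ^ n) * ∑' b : u, ENNReal.ofReal (om n * s b ^ n)) := by
        rw [← ENNReal.tsum_mul_left, ← ENNReal.tsum_mul_left]
        congr 1; funext b; congr 1
        rw [← ENNReal.ofReal_mul (by positivity)]; congr 1; rw [mul_pow]; ring
    _ = q * (ENNReal.ofReal (5 ^ n / K) * (ENNReal.ofReal K * ∑' b : u, ENNReal.ofReal (om n * s b ^ n))) := by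
        rw [← mul_assoc (ENNReal.ofReal (5 ^ n / K)), ← ENNReal.ofReal_mul (by positivity), div_mul_cancel₀ _ hKp.ne']
    _ ≤ q * (ENNReal.ofReal (5 ^ n / K) * (ENNReal.ofReal (2 * 4 ^ n * M) * ENNReal.ofReal (om n * r ^ n))) := by
        gcongr
    _ = _ := by
        rw [mul_assoc, ← mul_assoc (ENNReal.ofReal (5 ^ n / K)), ← ENNReal.ofReal_mul (by positivity)]
        rw [← mul_assoc]
        congr 3
        have : (20:ℝ) ^ n = 5 ^ n * 4 ^ n := by rw [← mul_pow]; norm_num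
        unfold K cN
        rw [this]
        field_simp; norm_num

theorem jn {f : EE n → ℝ} (hf : LocallyIntegrable f volume) {M : ℝ} (hM : 0 < M) (hb : IsBMOWith f M)
    (j : ℕ) : ∀ (x : EE n) (r : ℝ), 0 < r →
      volume {y ∈ Metric.ball x r | j * (cN n * M) < |f y - av f x r|} ≤
      ENNReal.ofReal ((1 / 2) ^ j) * ENNReal.ofReal (om n * r ^ n) := by
  have := cN_pos n
  induction j with
  | zero =>
    intro x r hr
    rw [← vol_ball x hr]
    simpa using measure_mono (fun y hy => hy.1)
  | succ j ih =>
    intro x r hr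
    have h := jn_step hf hM hb (by positivity) ih x hr
    rw [← ENNReal.ofReal_mul (by positivity), ← pow_succ] at h
    convert h using 5
    push_cast; ring

/-- JN L2 constant -/
def cJ (n : ℕ) : ℝ := cN n ^ 2 * ∑' j : ℕ, ((j : ℝ) + 1) ^ 2 * (1 / 2) ^ j

theorem summ_sq (c : ℝ) : Summable fun j : ℕ => ((j : ℝ) + c) ^ 2 * (1 / 2 : ℝ) ^ j := by
  have h : ∀ k : ℕ, Summable fun j : ℕ => (j : ℝ) ^ k * (1 / 2 : ℝ) ^ j := fun k =>
    summable_pow_mul_geometric_of_norm_lt_one k (by norm_num)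
  have := ((h 2).add ((h 1).mul_left (2 * c))).add ((h 0).mul_left (c ^ 2))
  refine this.congr fun j => ?_
  ring

theorem cJ_nonneg (n : ℕ) : 0 ≤ cJ n :=
  mul_nonneg (by positivity) (tsum_nonneg fun j => by positivity)

theorem jn_L2 {f : EE n → ℝ} (hf : LocallyIntegrable f volume) {M : ℝ} (hM : 0 < M) (hb : IsBMOWith f M)
    (x : EE n) {r : ℝ} (hr : 0 < r) :
    ∫⁻ y in Metric.ball x r, ‖f y - av f x r‖ₑ ^ 2 ≤
      ENNReal.ofReal (cJ n * M ^ 2) * ENNReal.ofReal (om n * r ^ n) := by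
  have hc := cN_pos n
  set K := cN n * M with hK
  have hKp : 0 < K := by positivity
  set μ := (volume : Measure (EE n)).restrict (Metric.ball x r) with hμ
  set S : ℕ → Set (EE n) := fun j => {y | j * K < |f y - av f x r|} with hS
  have hfm : AEMeasurable (fun y => |f y - av f x r|) μ :=
    ((hf.aestronglyMeasurable.aemeasurable.restrict).sub_const _).abs
  have hSm : ∀ j, NullMeasurableSet (S j) μ := fun j => nullMeasurableSet_lt aemeasurable_const hfm
  have hpt : ∀ y, ‖f y - av f x r‖ₑ ^ 2 ≤
      ∑' j : ℕ, (S j).indicator (fun _ => ENNReal.ofReal (((j + 1) * K) ^ 2)) y := by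
    intro y
    by_cases h0 : |f y - av f x r| = 0
    · have : f y - av f x r = 0 := by simpa using h0
      rw [this]; simp
    have hpos : 0 < |f y - av f x r| := lt_of_le_of_ne (abs_nonneg _) (Ne.symm h0)
    classical
    have hex : ∃ j : ℕ, |f y - av f x r| ≤ (j + 1) * K := by
      obtain ⟨j, hj⟩ := exists_nat_ge (|f y - av f x r| / K)
      rw [div_le_iff₀ hKp] at hj
      exact ⟨j, by nlinarith⟩
    have h1 := Nat.find_spec hex
    have h2 : ∀ i < Nat.find hex, ¬ _ := fun i hi => Nat.find_min hex hi
    set j := Nat.find hex with hj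
    have hjS : y ∈ S j := by
      simp only [hS, mem_ofPred_eq]
      rcases Nat.eq_zero_or_pos j with h | h
      · rw [h]; simpa using hpos
      · have := h2 (j - 1) (by omega)
        have e : ((j - 1 : ℕ) : ℝ) + 1 = j := by
          rw [Nat.cast_sub h]; simp
        rw [e] at this
        exact not_le.1 this
    refine le_trans ?_ (ENNReal.le_tsum j)
    rw [indicator_of_mem hjS, ← ofReal_norm, ← ENNReal.ofReal_pow (norm_nonneg _)]
    refine ENNReal.ofReal_le_ofReal ?_
    rw [Real.norm_eq_abs]
    gcongr
  calc ∫⁻ y in Metric.ball x r, ‖f y - av f x r‖ₑ ^ 2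
      ≤ ∫⁻ y, ∑' j : ℕ, (S j).indicator (fun _ => ENNReal.ofReal (((j + 1) * K) ^ 2)) y ∂μ :=
        lintegral_mono hpt
    _ = ∑' j : ℕ, ENNReal.ofReal (((j + 1) * K) ^ 2) * μ (S j) := by
        rw [lintegral_tsum fun j => (aemeasurable_const.indicator₀ (hSm j))]
        congr 1; funext j
        rw [lintegral_indicator_const₀ (hSm j)]
    _ ≤ ∑' j : ℕ, ENNReal.ofReal (K ^ 2) * ENNReal.ofReal (((j : ℝ) + 1) ^ 2 * (1 / 2) ^ j) * ENNReal.ofReal (om n * r ^ n) := by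
        refine ENNReal.tsum_le_tsum fun j => ?_
        have : μ (S j) ≤ ENNReal.ofReal ((1 / 2) ^ j) * ENNReal.ofReal (om n * r ^ n) := by
          rw [hμ, Measure.restrict_apply₀ (hSm j)]
          refine le_trans (measure_mono ?_) (jn hf hM hb j x r hr)
          rintro y ⟨h1, h2⟩
          exact ⟨h2, h1⟩
        refine (mul_le_mul_right this _).trans (le_of_eq ?_)
        rw [← mul_assoc, ← ENNReal.ofReal_mul (p := K ^ 2) (by positivity), ← ENNReal.ofReal_mul (p := ((j + 1) * K) ^ 2) (by positivity)]
        congr 2; ring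
    _ = _ := by
        rw [ENNReal.tsum_mul_right, ENNReal.tsum_mul_left,
          ← ENNReal.ofReal_tsum_of_nonneg (fun j => by positivity) (summ_sq 1),
          ← ENNReal.ofReal_mul (by positivity)]
        congr 2
        unfold cJ; rw [hK]; ring

/-- growth constant -/
def cG (n : ℕ) : ℝ := 2 * cJ n + 2 * 4 ^ n

theorem cG_pos (n : ℕ) : 0 < cG n := by have := cJ_nonneg n; unfold cG; positivity

theorem jn_grow {f : EE n → ℝ} (hf : LocallyIntegrable f volume) {M : ℝ} (hM : 0 < M) (hb : IsBMOWith f M)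
    (x : EE n) {r : ℝ} (hr : 0 < r) (k : ℕ) :
    ∫⁻ y in Metric.ball x (2 ^ k * r), ‖f y - av f x r‖ₑ ^ 2 ≤
      ENNReal.ofReal (cG n * (k + 1) ^ 2 * M ^ 2) * ENNReal.ofReal (om n * (2 ^ k * r) ^ n) := by
  have ho := om_pos n
  have hJ := cJ_nonneg n
  have h1 := jn_L2 hf hM hb x (r := 2 ^ k * r) (by positivity)
  have h2 := av_grow hf hM.le hb x hr k
  have hsq : ∀ a b : ℝ, ‖a + b‖ₑ ^ 2 ≤ 2 * ‖a‖ₑ ^ 2 + ENNReal.ofReal (2 * |b| ^ 2) := fun a b => by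
    rw [← ofReal_norm, ← ofReal_norm, ← ENNReal.ofReal_pow (norm_nonneg _), ← ENNReal.ofReal_pow (norm_nonneg _),
      show (2:ℝ≥0∞) = ENNReal.ofReal 2 by simp, ← ENNReal.ofReal_mul (by norm_num),
      ← ENNReal.ofReal_add (by positivity) (by positivity)]
    refine ENNReal.ofReal_le_ofReal ?_
    rw [Real.norm_eq_abs, Real.norm_eq_abs, sq_abs, sq_abs, sq_abs]
    nlinarith [sq_nonneg (a - b)]
  calc ∫⁻ y in Metric.ball x (2 ^ k * r), ‖f y - av f x r‖ₑ ^ 2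
      ≤ ∫⁻ y in Metric.ball x (2 ^ k * r), (2 * ‖f y - av f x (2 ^ k * r)‖ₑ ^ 2 +
          ENNReal.ofReal (2 * (k * (2 ^ n * M)) ^ 2)) := by
        refine lintegral_mono fun y => ?_
        have e : f y - av f x r = (f y - av f x (2 ^ k * r)) + (av f x (2 ^ k * r) - av f x r) := by ring
        simp only [e]
        refine (hsq _ _).trans (add_le_add le_rfl (ENNReal.ofReal_le_ofReal ?_))
        rw [abs_sub_comm]; gcongr
    _ ≤ 2 * (ENNReal.ofReal (cJ n * M ^ 2) * ENNReal.ofReal (om n * (2 ^ k * r) ^ n)) +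
        ENNReal.ofReal (2 * (k * (2 ^ n * M)) ^ 2) * ENNReal.ofReal (om n * (2 ^ k * r) ^ n) := by
        rw [lintegral_add_right _ measurable_const, setLIntegral_const, vol_ball x (by positivity),
          lintegral_const_mul' _ _ (by simp)]
        gcongr
    _ ≤ _ := by
        rw [← mul_assoc, ← add_mul, show (2:ℝ≥0∞) = ENNReal.ofReal 2 by simp, ← ENNReal.ofReal_mul (by norm_num),
          ← ENNReal.ofReal_add (by positivity) (by positivity)]
        gcongr
        have h4 : (4:ℝ) ^ n = 2 ^ n * 2 ^ n := by rw [← mul_pow]; norm_num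
        unfold cG
        rw [h4]
        have : (2 * cJ n + 2 * (2 ^ n * 2 ^ n)) * (k + 1) ^ 2 * M ^ 2 = 2 * (cJ n * M ^ 2) +
          2 * (k * (2 ^ n * M)) ^ 2 + (2 * cJ n * M ^ 2 * (k ^ 2 + 2 * k) + 2 * (2 ^ n * 2 ^ n) * M ^ 2 * (2 * k + 1)) := by ring
        rw [this]
        have : 0 ≤ (2 * cJ n * M ^ 2 * ((k:ℝ) ^ 2 + 2 * k) + 2 * (2 ^ n * 2 ^ n) * M ^ 2 * (2 * k + 1)) := by positivity
        linarith

end JN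

section final
variable {n : ℕ} (ℓ : Fin n)

/-- far-part constant -/
def cTl (n : ℕ) : ℝ := cC n * (2 ^ (n + 1) * (cG n * om n * 2 ^ n / 8 * ∑' k : ℕ, ((k : ℝ) + 5) ^ 2 * (1 / 2) ^ k))

theorem cTl_nonneg (n : ℕ) : 0 ≤ cTl n := by
  have := cC_nonneg n; have := (cG_pos n).le; have := (om_pos n).le
  have : 0 ≤ ∑' k : ℕ, ((k : ℝ) + 5) ^ 2 * (1 / 2 : ℝ) ^ k := tsum_nonneg fun j => by positivity
  unfold cTl; positivity

/-- near part -/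
def fN (f : EE n → ℝ) (x₀ : EE n) (r₀ : ℝ) : EE n → ℝ :=
  (Metric.ball x₀ (8 * r₀)).indicator fun y => f y - av f x₀ r₀

/-- far part, cut off -/
def fF (f : EE n → ℝ) (a : ℝ) (x₀ : EE n) (r₀ : ℝ) : EE n → ℝ :=
  (Metric.ball x₀ (a + 2 * r₀) \ Metric.ball x₀ (8 * r₀)).indicator fun y => f y - av f x₀ r₀

theorem fN_int {f : EE n → ℝ} (hf : LocallyIntegrable f volume) (x₀ : EE n) (r₀ : ℝ) :
    Integrable (fN f x₀ r₀) :=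
  (integrable_indicator_iff Metric.isOpen_ball.measurableSet).2
    ((li_ball hf x₀ _).sub (const_ball _ x₀ _))

theorem fF_int {f : EE n → ℝ} (hf : LocallyIntegrable f volume) (a : ℝ) (x₀ : EE n) (r₀ : ℝ) :
    Integrable (fF f a x₀ r₀) :=
  (integrable_indicator_iff (Metric.isOpen_ball.measurableSet.diff Metric.isOpen_ball.measurableSet)).2
    (((li_ball hf x₀ _).sub (const_ball _ x₀ _)).mono_set sdiff_subset)

theorem fF_supp {f : EE n → ℝ} {a : ℝ} {x₀ : EE n} {r₀ : ℝ} {y : EE n} (h : fF f a x₀ r₀ y ≠ 0) :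
    8 * r₀ ≤ ‖x₀ - y‖ := by
  by_contra hc
  apply h
  unfold fF
  rw [indicator_of_notMem]
  rintro ⟨_, h2⟩
  apply h2
  rw [Metric.mem_ball, dist_comm, dist_eq_norm]
  exact not_le.1 hc

theorem tr_split {f : EE n → ℝ} (hf : LocallyIntegrable f volume) {a : ℝ} (ha : 0 < a) (x₀ : EE n) {r₀ : ℝ}
    (hr : 0 < r₀) {x : EE n} (hx : ‖x₀ - x‖ ≤ r₀) {ε : ℝ} (hε : 0 < ε) :
    truncRiesz n ℓ a ε f x = truncRiesz n ℓ a ε (fN f x₀ r₀) x + truncRiesz n ℓ a ε (fF f a x₀ r₀) x := by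
  rw [tr_eq ℓ ha, tr_eq ℓ ha, tr_eq ℓ ha]
  have h0 : Fl ℓ ε (fun _ => av f x₀ r₀) x a = 0 := by
    have := odd_ann ℓ x (A := Ioc ε a) measurableSet_Ioc (av f x₀ r₀)
    simpa [Fl] using this
  have i1 : IntegrableOn (fun y => Kr ℓ (x - y) * av f x₀ r₀) {y : EE n | ε < ‖x - y‖ ∧ ‖x - y‖ ≤ a} :=
    ann_integrable ℓ hε ((const_ball _ x _).mono_set (ann_sub_ball x (lt_add_one a)))
  have i2 : IntegrableOn (fun y => Kr ℓ (x - y) * fN f x₀ r₀ y) {y : EE n | ε < ‖x - y‖ ∧ ‖x - y‖ ≤ a} :=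
    ann_integrable ℓ hε (fN_int hf x₀ r₀).integrableOn
  have i3 : IntegrableOn (fun y => Kr ℓ (x - y) * fF f a x₀ r₀ y) {y : EE n | ε < ‖x - y‖ ∧ ‖x - y‖ ≤ a} :=
    ann_integrable ℓ hε (fF_int hf a x₀ r₀).integrableOn
  rw [← zero_add (Fl ℓ ε (fN f x₀ r₀) x a), ← h0]
  unfold Fl
  have i12 : IntegrableOn (fun y => Kr ℓ (x - y) * av f x₀ r₀ + Kr ℓ (x - y) * fN f x₀ r₀ y)
      {y : EE n | ε < ‖x - y‖ ∧ ‖x - y‖ ≤ a} := i1.add i2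
  rw [← integral_add i1 i2, ← integral_add i12 i3]
  refine setIntegral_congr_fun (meas_ann x ε a) fun y hy => ?_
  have hy1 : ‖x₀ - y‖ < a + 2 * r₀ := by
    have := norm_add_le (x₀ - x) (x - y)
    rw [sub_add_sub_cancel] at this
    linarith [hy.2]
  have hy2 : y ∈ Metric.ball x₀ (a + 2 * r₀) := by
    rwa [Metric.mem_ball, dist_comm, dist_eq_norm]
  have : f y = av f x₀ r₀ + fN f x₀ r₀ y + fF f a x₀ r₀ y := by
    unfold fN fF
    by_cases h : y ∈ Metric.ball x₀ (8 * r₀)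
    · rw [indicator_of_mem h, indicator_of_notMem (fun h' => h'.2 h)]; ring
    · rw [indicator_of_notMem h, indicator_of_mem (show y ∈ Metric.ball x₀ (a + 2 * r₀) \ Metric.ball x₀ (8 * r₀) from ⟨hy2, h⟩)]; ring
  beta_reduce
  rw [this]; ring

/-- cumulative integral -/
def Gc (h : EE n → ℝ) (x : EE n) (ε : ℝ) : ℝ := ∫ y in {y | ‖x - y‖ ≤ ε}, Kr ℓ (x - y) * h y

theorem tr_Gc {h : EE n → ℝ} {a : ℝ} (ha : 0 < a) {x : EE n} (hi : Integrable fun y => Kr ℓ (x - y) * h y)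
    (ε : ℝ) : truncRiesz n ℓ a ε h x = Gc ℓ h x a - Gc ℓ h x (min ε a) := by
  rw [tr_eq ℓ ha]
  rcases le_total ε a with h1 | h1
  · rw [min_eq_left h1]
    unfold Gc Fl
    have hm : MeasurableSet {y : EE n | ‖x - y‖ ≤ ε} := measurableSet_le (meas_nrm x) measurable_const
    have hsub : {y : EE n | ‖x - y‖ ≤ ε} ⊆ {y | ‖x - y‖ ≤ a} := fun y hy => le_trans hy h1
    rw [← setIntegral_sdiff hm hi.integrableOn hsub]
    congr 2
    ext y
    simp only [mem_ofPred_eq, Set.mem_sdiff, not_le]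
    tauto
  · rw [min_eq_right h1, Fl_empty ℓ h1, sub_self]

theorem far_Kint {f : EE n → ℝ} (hf : LocallyIntegrable f volume) (a : ℝ) (x₀ : EE n) {r₀ : ℝ}
    (hr : 0 < r₀) {x : EE n} (hx : ‖x₀ - x‖ ≤ r₀) : Integrable fun y => Kr ℓ (x - y) * fF f a x₀ r₀ y := by
  refine Kh_integrable ℓ (fF_int hf a x₀ r₀) (by fun_prop) (by positivity : 0 < 4 * r₀) fun y hy => ?_
  have := fF_supp hy
  have h2 := norm_add_le (x₀ - x) (x - y)
  rw [sub_add_sub_cancel] at h2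
  linarith

theorem far_fin {ρ : ℝ} (hρ : 2 < ρ) {f : EE n → ℝ} (hf : LocallyIntegrable f volume) {a : ℝ} (ha : 0 < a)
    (x₀ : EE n) {r₀ : ℝ} (hr : 0 < r₀) :
    eVar ρ (fun ε => truncRiesz n ℓ a ε (fF f a x₀ r₀) x₀) ≠ ∞ := by
  have hi := far_Kint ℓ hf a x₀ hr (x := x₀) (by simpa using hr.le)
  have hfin : ∫⁻ y, ‖Kr ℓ (x₀ - y) * fF f a x₀ r₀ y‖ₑ < ∞ := hi.2
  refine ne_top_of_le_ne_top hfin.ne ?_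
  refine (eVar_le_pv (by linarith) _).trans ((pv_anti_exp one_pos (by linarith) _ _).trans ?_)
  refine le_trans ?_ (pv_int hi (meas_nrm x₀) univ)
  have e : pv 1 (fun ε => truncRiesz n ℓ a ε (fF f a x₀ r₀) x₀) (Ioi 0) =
      pv 1 (fun ε => - Gc ℓ (fF f a x₀ r₀) x₀ (min ε a)) (Ioi 0) := by
    refine pv_congr fun t _ t' _ _ => ?_
    rw [tr_Gc ℓ ha hi, tr_Gc ℓ ha hi]; ring
  rw [e, pv_neg]
  exact pv_comp_le 1 (Gc ℓ (fF f a x₀ r₀) x₀) (fun ε => min ε a)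
    (fun _ _ _ _ h => min_le_min_right _ h) (fun _ _ => mem_univ _)

theorem far_tail {f : EE n → ℝ} (hf : LocallyIntegrable f volume) {M : ℝ} (hM : 0 < M) (hb : IsBMOWith f M)
    (x₀ : EE n) {r₀ : ℝ} (hr : 0 < r₀) :
    ∫⁻ y in {y | 8 * r₀ ≤ ‖x₀ - y‖}, ‖f y - av f x₀ r₀‖ₑ ^ 2 * ENNReal.ofReal (‖x₀ - y‖ ^ (n+1))⁻¹ ≤
      ENNReal.ofReal (cG n * om n * 2 ^ n / 8 * (∑' k : ℕ, ((k : ℝ) + 5) ^ 2 * (1 / 2) ^ k) * M ^ 2 * r₀⁻¹) := by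
  have hG := cG_pos n
  have ho := om_pos n
  refine (tail_le x₀ (by positivity) _).trans ?_
  calc _ ≤ ∑' k : ℕ, ENNReal.ofReal (cG n * om n * 2 ^ n / 8 * M ^ 2 * r₀⁻¹) *
        ENNReal.ofReal (((k : ℝ) + 5) ^ 2 * (1 / 2) ^ k) := by
        refine ENNReal.tsum_le_tsum fun k => ?_
        have h := jn_grow hf hM hb x₀ hr (k + 4)
        have e : (2:ℝ) ^ (k + 1) * (8 * r₀) = 2 ^ (k + 4) * r₀ := by rw [pow_add, pow_add]; ring
        rw [e]
        refine (mul_le_mul_right h _).trans (le_of_eq ?_)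
        rw [← ENNReal.ofReal_mul (by positivity), ← ENNReal.ofReal_mul (by positivity), ← ENNReal.ofReal_mul (by positivity)]
        congr 1
        rw [← e]
        push_cast
        have e2 : (2:ℝ) ^ (k + 1) * (8 * r₀) = 2 * (2 ^ k * (8 * r₀)) := by rw [pow_succ]; ring
        have e3 : (2:ℝ) ^ k * (8 * r₀) ≠ 0 := by positivity
        rw [e2, mul_pow 2 (2 ^ k * (8 * r₀)) n, one_div, inv_pow, pow_succ (2 ^ k * (8 * r₀)) n]
        have e4 : ((2:ℝ) ^ k * (8 * r₀)) ^ n ≠ 0 := pow_ne_zero _ e3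
        generalize ((2:ℝ) ^ k * (8 * r₀)) ^ n = A at e4 ⊢
        field_simp
        ring
    _ = _ := by
        rw [ENNReal.tsum_mul_left, ← ENNReal.ofReal_tsum_of_nonneg (fun j => by positivity) (summ_sq 5),
          ← ENNReal.ofReal_mul (by positivity)]
        congr 1; ring

theorem far_pv {ρ : ℝ} (hρ : 2 < ρ) {f : EE n → ℝ} (hf : LocallyIntegrable f volume) {M : ℝ} (hM : 0 < M)
    (hb : IsBMOWith f M) {a : ℝ} (ha : 0 < a) (x₀ : EE n) {r₀ : ℝ} (hr : 0 < r₀) {x : EE n} (hx : ‖x₀ - x‖ ≤ r₀) :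
    pv ρ (fun ε => truncRiesz n ℓ a ε (fF f a x₀ r₀) x - truncRiesz n ℓ a ε (fF f a x₀ r₀) x₀) (Ioi 0) ≤
      ENNReal.ofReal ((1 + cTl n) * M) := by
  set h := fF f a x₀ r₀ with hh
  have hi := far_Kint ℓ hf a x₀ hr hx
  have hi0 := far_Kint ℓ hf a x₀ hr (x := x₀) (by simpa using hr.le)
  have hT := cTl_nonneg n
  have h1 : pv ρ (fun ε => truncRiesz n ℓ a ε h x - truncRiesz n ℓ a ε h x₀) (Ioi 0) ≤
      pv 2 (fun ε => Gc ℓ h x ε - Gc ℓ h x₀ ε) univ := by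
    refine (pv_anti_exp two_pos hρ.le _ _).trans ?_
    have e : pv 2 (fun ε => truncRiesz n ℓ a ε h x - truncRiesz n ℓ a ε h x₀) (Ioi 0) =
        pv 2 (fun ε => - (Gc ℓ h x (min ε a) - Gc ℓ h x₀ (min ε a))) (Ioi 0) := by
      refine pv_congr fun t _ t' _ _ => ?_
      rw [tr_Gc ℓ ha hi, tr_Gc ℓ ha hi, tr_Gc ℓ ha hi0, tr_Gc ℓ ha hi0]; ring
    rw [e, pv_neg]
    exact pv_comp_le 2 (fun ε => Gc ℓ h x ε - Gc ℓ h x₀ ε) (fun ε => min ε a)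
      (fun _ _ _ _ h => min_le_min_right _ h) (fun _ _ => mem_univ _)
  have h2 := core ℓ (x := x) hr (fF_int hf a x₀ r₀) (fun y hy => by
      by_contra hc
      have h1 := fF_supp hc
      have h2 := norm_add_le (x₀ - x) (x - y)
      rw [sub_add_sub_cancel] at h2
      linarith) (z := fun y => x₀ - y) (by fun_prop) (fun y _ => by
      rw [sub_sub_sub_cancel_right, norm_sub_rev]; exact hx)
  have h3 : ∫⁻ y, ‖h y‖ₑ ^ 2 * ENNReal.ofReal (‖x - y‖ ^ (n+1))⁻¹ ≤
      ENNReal.ofReal (2 ^ (n + 1)) * ∫⁻ y in {y | 8 * r₀ ≤ ‖x₀ - y‖}, ‖f y - av f x₀ r₀‖ₑ ^ 2 * ENNReal.ofReal (‖x₀ - y‖ ^ (n+1))⁻¹ := by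
    rw [← lintegral_const_mul' _ _ ENNReal.ofReal_ne_top,
      ← lintegral_indicator (measurableSet_le measurable_const (meas_nrm x₀))]
    refine lintegral_mono fun y => ?_
    by_cases hy : h y = 0
    · simp [hy]
    have hs := fF_supp hy
    have hv : h y = f y - av f x₀ r₀ := by
      rw [hh] at hy ⊢
      unfold fF at hy ⊢
      exact indicator_of_mem (mem_of_indicator_ne_zero hy) _
    rw [indicator_of_mem (show y ∈ {y | 8 * r₀ ≤ ‖x₀ - y‖} from hs), hv, mul_left_comm]
    refine mul_le_mul_right ?_ _
    rw [← ENNReal.ofReal_mul (by positivity)]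
    refine ENNReal.ofReal_le_ofReal ?_
    have h2 := norm_add_le (x₀ - x) (x - y)
    rw [sub_add_sub_cancel] at h2
    have hp0 : 0 < ‖x₀ - y‖ := by linarith
    have hp : ‖x₀ - y‖ / 2 ≤ ‖x - y‖ := by linarith
    calc (‖x - y‖ ^ (n+1))⁻¹ ≤ ((‖x₀ - y‖ / 2) ^ (n+1))⁻¹ := by gcongr
      _ = _ := by rw [div_pow, inv_div, div_eq_mul_inv]
  have h4 : pv 2 (fun ε => Gc ℓ h x ε - Gc ℓ h x₀ ε) univ ^ 2 ≤ ENNReal.ofReal (cTl n * M ^ 2) := by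
    refine h2.trans ((mul_le_mul_right (h3.trans (mul_le_mul_right (far_tail hf hM hb x₀ hr) _)) _).trans (le_of_eq ?_))
    have hc := cC_nonneg n
    rw [← ENNReal.ofReal_mul (by positivity), ← ENNReal.ofReal_mul (by positivity)]
    congr 1
    unfold cTl
    field_simp
  refine h1.trans ((sq_le_young hM h4).trans (le_of_eq ?_))
  rw [← ENNReal.ofReal_mul (by positivity), ← ENNReal.ofReal_add hM.le (by positivity)]
  congr 1
  field_simp

/-- final constant -/
def cZ (n : ℕ) (ρ : ℝ) : ℝ := 4 + cTl n + 16 * cA n ρ * cG n * 8 ^ n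

theorem cZ_pos (n : ℕ) {ρ : ℝ} (hρ : 2 < ρ) : 0 < cZ n ρ := by
  have := cTl_nonneg n; have := cA_pos n hρ; have := cG_pos n
  unfold cZ; positivity

theorem main_bound {ρ : ℝ} (hρ : 2 < ρ) {f : EE n → ℝ} (hf : LocallyIntegrable f volume) {M : ℝ} (hM : 0 < M)
    (hb : IsBMOWith f M) {a : ℝ} (ha : 0 < a) (x₀ : EE n) {r₀ : ℝ} (hr : 0 < r₀) :
    ∫⁻ x in Metric.ball x₀ r₀, ENNReal.ofReal |(eVar ρ (fun ε => truncRiesz n ℓ a ε f x)).toReal -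
      (eVar ρ (fun ε => truncRiesz n ℓ a ε (fF f a x₀ r₀) x₀)).toReal| ≤
      ENNReal.ofReal (cZ n ρ * M) * volume (Metric.ball x₀ r₀) := by
  have hT := cTl_nonneg n
  have hA := cA_pos n hρ
  have hG := cG_pos n
  have ho := om_pos n
  have hL : ∫⁻ y, ‖fN f x₀ r₀ y‖ₑ ^ 2 ≤ ENNReal.ofReal (16 * cG n * 8 ^ n * M ^ 2 * (om n * r₀ ^ n)) := by
    have h := jn_grow hf hM hb x₀ hr 3
    rw [show (2:ℝ) ^ 3 * r₀ = 8 * r₀ by norm_num] at h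
    rw [← lintegral_indicator Metric.isOpen_ball.measurableSet] at h
    refine le_trans (lintegral_mono fun y => ?_) (h.trans (le_of_eq ?_))
    · unfold fN
      by_cases hy : y ∈ Metric.ball x₀ (8 * r₀)
      · rw [indicator_of_mem hy, indicator_of_mem hy]
      · rw [indicator_of_notMem hy, indicator_of_notMem hy]; simp
    · rw [← ENNReal.ofReal_mul (by positivity)]
      congr 1; push_cast; rw [mul_pow]; ring
  have hmem : MemLp (fN f x₀ r₀) 2 := memLp_of_lint (fN_int hf x₀ r₀).1 (hL.trans_lt ENNReal.ofReal_lt_top)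
  set F : HH n := hmem.toLp _ with hF
  have hFe : F =ᵐ[volume] fN f x₀ r₀ := hmem.coeFn_toLp
  have hFn : ENNReal.ofReal (‖F‖ ^ 2) ≤ ENNReal.ofReal (16 * cG n * 8 ^ n * M ^ 2 * (om n * r₀ ^ n)) := by
    rw [lp_norm_sq]
    refine le_trans (le_of_eq (lintegral_congr_ae ?_)) hL
    filter_upwards [hFe] with y hy
    rw [hy]
  obtain ⟨Ψ, hΨm, hΨ, hΨi⟩ := thmB ℓ hρ F hM
  have hpt : ∀ x ∈ Metric.ball x₀ r₀, ENNReal.ofReal |(eVar ρ (fun ε => truncRiesz n ℓ a ε f x)).toReal -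
      (eVar ρ (fun ε => truncRiesz n ℓ a ε (fF f a x₀ r₀) x₀)).toReal| ≤
      ENNReal.ofReal ((4 + cTl n) * M) + Ψ x := by
    intro x hx
    have hx' : ‖x₀ - x‖ ≤ r₀ := by
      rw [Metric.mem_ball, dist_comm, dist_eq_norm] at hx; exact hx.le
    refine (eVar_diff (by linarith) _ _ (far_fin ℓ hρ hf ha x₀ hr)).trans ?_
    refine (eVar_le_pv (by linarith) _).trans ?_
    have e : pv ρ (fun ε => truncRiesz n ℓ a ε f x - truncRiesz n ℓ a ε (fF f a x₀ r₀) x₀) (Ioi 0) =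
        pv ρ (fun ε => truncRiesz n ℓ a ε F x + (truncRiesz n ℓ a ε (fF f a x₀ r₀) x -
          truncRiesz n ℓ a ε (fF f a x₀ r₀) x₀)) (Ioi 0) := by
      have : ∀ ε, truncRiesz n ℓ a ε F x = truncRiesz n ℓ a ε (fN f x₀ r₀) x := fun ε => by
        rw [tr_eq ℓ ha, tr_eq ℓ ha]; exact Fl_congr ℓ hFe _ _ _
      refine pv_congr fun t ht t' ht' _ => ?_
      rw [this, this, tr_split ℓ hf ha x₀ hr hx' ht, tr_split ℓ hf ha x₀ hr hx' ht']; ring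
    rw [e]
    refine (pv_add_le (by linarith) _ _ _).trans ?_
    refine (add_le_add (pv_tr ℓ ha (Lp.memLp F) x (hΨ x)) (far_pv ℓ hρ hf hM hb ha x₀ hr hx')).trans (le_of_eq ?_)
    rw [show (4 + cTl n) * M = 3 * M + (1 + cTl n) * M by ring, ENNReal.ofReal_add (by positivity) (by positivity)]
    ring
  calc _ ≤ ∫⁻ x in Metric.ball x₀ r₀, (ENNReal.ofReal ((4 + cTl n) * M) + Ψ x) :=
        setLIntegral_mono' Metric.isOpen_ball.measurableSet hpt
    _ ≤ ENNReal.ofReal ((4 + cTl n) * M) * volume (Metric.ball x₀ r₀) +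
        ENNReal.ofReal (cA n ρ * M⁻¹) * ENNReal.ofReal (16 * cG n * 8 ^ n * M ^ 2 * (om n * r₀ ^ n)) := by
        rw [lintegral_add_right _ hΨm, setLIntegral_const]
        refine add_le_add le_rfl ((setLIntegral_le_lintegral _ _).trans (hΨi.trans ?_))
        rw [ENNReal.ofReal_mul (by positivity)]
        gcongr
    _ = _ := by
        rw [vol_ball x₀ hr, ← ENNReal.ofReal_mul (by positivity), ← ENNReal.ofReal_mul (by positivity),
          ← ENNReal.ofReal_add (by positivity) (by positivity),
          ← ENNReal.ofReal_mul (by have := cZ_pos n hρ; positivity)]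
        congr 1
        unfold cZ
        field_simp

end final

/-- let `ρ > 2`, `ℓ ∈ {1,…,n}` and `a > 0`. For every `f ∈ BMO(ℝⁿ)`
(with norm at most `M`), the variation `V_ρ(R^ε_{ℓ,a})(f)` of the doubly truncated
Riesz transforms belongs to `BMO(ℝⁿ)` with `‖V_ρ(R^ε_{ℓ,a})(f)‖_{BMO} ≤ C M`, where
`C` is independent of `f` and of `a`. -/
theorem variation_truncRiesz_bmo (n : ℕ) (hn : 1 ≤ n) (ℓ : Fin n) (ρ : ℝ) (hρ : 2 < ρ) :
    ∃ C > 0, ∀ a : ℝ, 0 < a → ∀ (f : EuclideanSpace ℝ (Fin n) → ℝ) (M : ℝ),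
      LocallyIntegrable f volume → IsBMOWith f M →
      ∀ (x₀ : EuclideanSpace ℝ (Fin n)) (r₀ : ℝ), 0 < r₀ → ∃ cB : ℝ,
        ∫⁻ x in Metric.ball x₀ r₀,
            ENNReal.ofReal |(eVar ρ (fun ε => truncRiesz n ℓ a ε f x)).toReal - cB|
          ≤ ENNReal.ofReal (C * M) * volume (Metric.ball x₀ r₀) := by
  refine ⟨cZ n ρ, cZ_pos n hρ, fun a ha f M hf hb x₀ r₀ hr =>
    ⟨(eVar ρ (fun ε => truncRiesz n ℓ a ε (fF f a x₀ r₀) x₀)).toReal, ?_⟩⟩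
  have hM : 0 ≤ M := le_trans (mul_nonneg (by positivity) (integral_nonneg fun y => abs_nonneg _)) (hb x₀ r₀ hr)
  have ht : Tendsto (fun k : ℕ => M + 1 / ((k : ℝ) + 1)) atTop (nhds M) := by
    simpa using tendsto_one_div_add_atTop_nhds_zero_nat.const_add M
  have ht2 : Tendsto (fun k : ℕ => ENNReal.ofReal (cZ n ρ * (M + 1 / ((k : ℝ) + 1))) * volume (Metric.ball x₀ r₀))
      atTop (nhds (ENNReal.ofReal (cZ n ρ * M) * volume (Metric.ball x₀ r₀))) :=
    ENNReal.Tendsto.mul_const (ENNReal.tendsto_ofReal (ht.const_mul _)) (Or.inr measure_ball_lt_top.ne)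
  refine ge_of_tendsto' ht2 fun k => ?_
  have hk : 0 < 1 / ((k : ℝ) + 1) := by positivity
  exact main_bound ℓ hρ hf (by linarith) (fun x r h => (hb x r h).trans (by linarith)) ha x₀ hr

end
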